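/- Let m ∈ (m_s, 1) and let u be a radial energy solution of the fast diffusion equation with exponent m and extinction time T > 0. Then for every ε ∈ (0,T) and every integer k ≥ 1 there exist constants C₁ > 0 and C₂ > 0 such that |∂ᵏ_r u(r,t)| ≤ C₁ (1 − t/T)^{1/(1−m)} e^{−(N−1)r/m} and |∂ᵏ_t u(r,t)| ≤ C₂ (1 − t/T)^{1/(1−m) − k} e^{k(N−1)(1/m − 1) r} e^{−(N−1)r/m} for all r ≥ 0 and all t ∈ [ε, T). -/

import Mathlib

open MeasureTheory Set Filter Topology

/-- Membership in the radial energy space `H¹_rad` on hyperbolic space `ℍ^N`: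
`v` is locally absolutely continuous on `(0,∞)` (expressed via the fundamental theorem
of calculus for its a.e. derivative) and both `v` and `v'` are square-integrable with
respect to the weight `(sinh s)^(N-1)`. -/
def MemH1rad (N : ℕ) (v : ℝ → ℝ) : Prop :=
  (∀ a b : ℝ, 0 < a → a ≤ b → v b - v a = ∫ s in a..b, deriv v s) ∧
  MeasureTheory.IntegrableOn (fun s => (v s) ^ 2 * Real.sinh s ^ (N - 1)) (Set.Ioi 0) ∧
  MeasureTheory.IntegrableOn (fun s => (deriv v s) ^ 2 * Real.sinh s ^ (N - 1)) (Set.Ioi 0)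

/-- The squared `H¹` norm `‖v‖_2² + ‖v'‖_2²` with weight `(sinh s)^(N-1)`. -/
noncomputable def H1normSq (N : ℕ) (v : ℝ → ℝ) : ℝ :=
  (∫ s in Set.Ioi (0:ℝ), (v s) ^ 2 * Real.sinh s ^ (N - 1)) +
  (∫ s in Set.Ioi (0:ℝ), (deriv v s) ^ 2 * Real.sinh s ^ (N - 1))

/-- A radial energy solution of the fast diffusion equation `u_t = Δ(u^m)` on `ℍ^N`,
with exponent `m`, extinction time `T` (initial datum `u(·,0)`). -/
structure IsRadialEnergySolution (N : ℕ) (m T : ℝ) (u : ℝ → ℝ → ℝ) : Prop where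
  continuousOn : ContinuousOn (fun p : ℝ × ℝ => u p.1 p.2) (Set.Ici 0 ×ˢ Set.Icc 0 T)
  nonneg : ∀ r ∈ Set.Ici (0:ℝ), ∀ t ∈ Set.Icc (0:ℝ) T, 0 ≤ u r t
  smooth : ContDiffOn ℝ (⊤ : ℕ∞) (fun p : ℝ × ℝ => u p.1 p.2) (Set.Ici 0 ×ˢ Set.Ioo 0 T)
  pos : ∀ r ∈ Set.Ici (0:ℝ), ∀ t ∈ Set.Ioo (0:ℝ) T, 0 < u r t
  pde : ∀ r > (0:ℝ), ∀ t ∈ Set.Ioo (0:ℝ) T,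
    deriv (fun τ => u r τ) t
      = deriv (deriv (fun ρ => u ρ t ^ m)) r
        + ((N : ℝ) - 1) * (Real.cosh r / Real.sinh r) * deriv (fun ρ => u ρ t ^ m) r
  neumann : ∀ t ∈ Set.Ioo (0:ℝ) T, deriv (fun ρ => u ρ t ^ m) 0 = 0
  extinction : ∀ r ∈ Set.Ici (0:ℝ), u r T = 0
  energy : ∀ t ∈ Set.Ioo (0:ℝ) T, MemH1rad N (fun ρ => u ρ t ^ m)
  energy_bdd : ∀ ε ∈ Set.Ioo (0:ℝ) T, ∃ C : ℝ, ∀ t ∈ Set.Ico ε T,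
    H1normSq N (fun ρ => u ρ t ^ m) ≤ C
  init_bdd : ∃ M : ℝ, ∀ r ∈ Set.Ici (0:ℝ), u r 0 ≤ M
  init_nonzero : ∃ r ∈ Set.Ici (0:ℝ), u r 0 ≠ 0
  init_energy : MemH1rad N (fun ρ => u ρ 0 ^ m)

open Real (exp sinh cosh mul_rpow exp_pos exp_add rpow_le_rpow rpow_mul rpow_add_one exp_le_one_iff smoothTransition rpow_natCast exp_mul rpow_one rpow_le_rpow_of_nonpos cosh_pos rpow_pos_of_pos rpow_add sinh_zero exp_le_exp)

noncomputable def Ds (F : ℝ → ℝ → ℝ) (r s : ℝ) : ℝ := deriv (F r) s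
noncomputable def Dr (F : ℝ → ℝ → ℝ) (r s : ℝ) : ℝ := derivWithin (fun ρ => F ρ s) (Ici 0) r
def Sm (I : Set ℝ) (F : ℝ → ℝ → ℝ) : Prop :=
  ContDiffOn ℝ (⊤ : ℕ∞) (fun p : ℝ × ℝ => F p.1 p.2) (Ici 0 ×ˢ I)
noncomputable def HH (d : ℕ) (r : ℝ) : ℝ := (d:ℝ) * (cosh r / sinh r)
noncomputable def LL (d : ℕ) (F : ℝ → ℝ → ℝ) (r s : ℝ) : ℝ := Dr (Dr F) r s + HH d r * Dr F r s

section
variable {I : Set ℝ} {F G : ℝ → ℝ → ℝ} {r s : ℝ}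

lemma udS (hI : IsOpen I) : UniqueDiffOn ℝ (Ici (0:ℝ) ×ˢ I) :=
  (uniqueDiffOn_Ici 0).prod hI.uniqueDiffOn

lemma Sm.fd (hI : IsOpen I) (h : Sm I F) :
    ContDiffOn ℝ (⊤ : ℕ∞) (fderivWithin ℝ (fun p : ℝ × ℝ => F p.1 p.2) (Ici 0 ×ˢ I)) (Ici 0 ×ˢ I) :=
  h.fderivWithin (udS hI) (by simp)

lemma Sm.hasF (h : Sm I F) (hr : 0 ≤ r) (hs : s ∈ I) :
    HasFDerivWithinAt (fun p : ℝ × ℝ => F p.1 p.2)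
      (fderivWithin ℝ (fun p : ℝ × ℝ => F p.1 p.2) (Ici 0 ×ˢ I) (r, s)) (Ici 0 ×ˢ I) (r, s) :=
  ((h.differentiableOn (by simp)) (r, s) ⟨hr, hs⟩).hasFDerivWithinAt

lemma hasDr_aux {E : Type*} [NormedAddCommGroup E] [NormedSpace ℝ E] {f : ℝ × ℝ → E} {f' : ℝ × ℝ →L[ℝ] E}
    (h : HasFDerivWithinAt f f' (Ici 0 ×ˢ I) (r, s)) (hs : s ∈ I) :
    HasDerivWithinAt (fun ρ => f (ρ, s)) (f' (1, 0)) (Ici 0) r := by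
  have h1 : HasDerivWithinAt (fun ρ : ℝ => (ρ, s)) ((1:ℝ), (0:ℝ)) (Ici 0) r :=
    (hasDerivWithinAt_id _ _).prodMk (hasDerivWithinAt_const _ _ _)
  exact h.comp_hasDerivWithinAt (f := fun ρ : ℝ => (ρ, s)) r h1 (fun x hx => ⟨hx, hs⟩)

lemma hasDs_aux {E : Type*} [NormedAddCommGroup E] [NormedSpace ℝ E] {f : ℝ × ℝ → E} {f' : ℝ × ℝ →L[ℝ] E}
    (hI : IsOpen I) (h : HasFDerivWithinAt f f' (Ici 0 ×ˢ I) (r, s)) (hr : 0 ≤ r) (hs : s ∈ I) :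
    HasDerivAt (fun τ => f (r, τ)) (f' (0, 1)) s := by
  have h1 : HasDerivWithinAt (fun τ : ℝ => (r, τ)) ((0:ℝ), (1:ℝ)) I s :=
    (hasDerivWithinAt_const _ _ _).prodMk (hasDerivWithinAt_id _ _)
  exact (h.comp_hasDerivWithinAt (f := fun τ : ℝ => (r, τ)) s h1 (fun x hx => ⟨hr, hx⟩)).hasDerivAt
    (hI.mem_nhds hs)

lemma Dr_eq {x : ℝ} (hr : 0 ≤ r) (h : HasDerivWithinAt (fun ρ => F ρ s) x (Ici 0) r) : Dr F r s = x :=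
  h.derivWithin (uniqueDiffOn_Ici 0 r hr)

lemma Ds_eq {x : ℝ} (h : HasDerivAt (fun τ => F r τ) x s) : Ds F r s = x := h.deriv

lemma Sm.Dr_fd (h : Sm I F) (hr : 0 ≤ r) (hs : s ∈ I) :
    Dr F r s = fderivWithin ℝ (fun p : ℝ × ℝ => F p.1 p.2) (Ici 0 ×ˢ I) (r, s) (1, 0) :=
  Dr_eq hr (hasDr_aux (h.hasF hr hs) hs)

lemma Sm.Ds_fd (hI : IsOpen I) (h : Sm I F) (hr : 0 ≤ r) (hs : s ∈ I) :
    Ds F r s = fderivWithin ℝ (fun p : ℝ × ℝ => F p.1 p.2) (Ici 0 ×ˢ I) (r, s) (0, 1) :=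
  Ds_eq (hasDs_aux hI (h.hasF hr hs) hr hs)

lemma Sm.hasDr (h : Sm I F) (hr : 0 ≤ r) (hs : s ∈ I) :
    HasDerivWithinAt (fun ρ => F ρ s) (Dr F r s) (Ici 0) r := by
  rw [h.Dr_fd hr hs]; exact (hasDr_aux (h.hasF hr hs) hs)

lemma Sm.hasDr' (h : Sm I F) (hr : 0 < r) (hs : s ∈ I) :
    HasDerivAt (fun ρ => F ρ s) (Dr F r s) r := (h.hasDr hr.le hs).hasDerivAt (Ici_mem_nhds hr)

lemma Sm.hasDs (hI : IsOpen I) (h : Sm I F) (hr : 0 ≤ r) (hs : s ∈ I) :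
    HasDerivAt (fun τ => F r τ) (Ds F r s) s := by
  rw [h.Ds_fd hI hr hs]; exact (hasDs_aux hI (h.hasF hr hs) hr hs)

lemma Sm.dr (hI : IsOpen I) (h : Sm I F) : Sm I (Dr F) := by
  have : ContDiffOn ℝ (⊤ : ℕ∞) (fun p : ℝ × ℝ =>
    fderivWithin ℝ (fun p : ℝ × ℝ => F p.1 p.2) (Ici 0 ×ˢ I) p (1, 0)) (Ici 0 ×ˢ I) :=
    (h.fd hI).clm_apply contDiffOn_const
  exact this.congr fun p hp => h.Dr_fd hp.1 hp.2

lemma Sm.ds (hI : IsOpen I) (h : Sm I F) : Sm I (Ds F) := by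
  have : ContDiffOn ℝ (⊤ : ℕ∞) (fun p : ℝ × ℝ =>
    fderivWithin ℝ (fun p : ℝ × ℝ => F p.1 p.2) (Ici 0 ×ˢ I) p (0, 1)) (Ici 0 ×ˢ I) :=
    (h.fd hI).clm_apply contDiffOn_const
  exact this.congr fun p hp => h.Ds_fd hI hp.1 hp.2

lemma Sm.comm (hI : IsOpen I) (h : Sm I F) (hr : 0 ≤ r) (hs : s ∈ I) :
    Dr (Ds F) r s = Ds (Dr F) r s := by
  set S := Ici (0:ℝ) ×ˢ I
  set f' := fderivWithin ℝ (fun p : ℝ × ℝ => F p.1 p.2) S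
  have h2 : HasFDerivWithinAt f' (fderivWithin ℝ f' S (r, s)) S (r, s) :=
    (((h.fd hI).differentiableOn (by simp)) (r, s) ⟨hr, hs⟩).hasFDerivWithinAt
  have a1 : Dr (Ds F) r s = fderivWithin ℝ f' S (r, s) (1, 0) (0, 1) := by
    refine Dr_eq hr ?_
    have := (hasDr_aux h2 hs).clm_apply (hasDerivWithinAt_const r (Ici 0) ((0:ℝ), (1:ℝ)))
    simp only [map_zero, add_zero] at this
    exact this.congr (fun x hx => h.Ds_fd hI hx hs) (h.Ds_fd hI hr hs)
  have a2 : Ds (Dr F) r s = fderivWithin ℝ f' S (r, s) (0, 1) (1, 0) := by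
    refine Ds_eq ?_
    have := (hasDs_aux hI h2 hr hs).clm_apply (hasDerivAt_const s ((1:ℝ), (0:ℝ)))
    simp only [map_zero, add_zero] at this
    exact this.congr_of_eventuallyEq (by
      filter_upwards [hI.mem_nhds hs] with x hx using h.Dr_fd hr hx)
  have hsym : IsSymmSndFDerivWithinAt ℝ (fun p : ℝ × ℝ => F p.1 p.2) S (r, s) := by
    refine (h (r, s) ⟨hr, hs⟩).isSymmSndFDerivWithinAt (by simp; exact (WithTop.coe_le_coe (b := (2:ℕ∞))).2 le_top) (udS hI) ?_ ⟨hr, hs⟩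
    rw [interior_prod_eq, closure_prod_eq, hI.interior_eq, interior_Ici, closure_Ioi]
    exact ⟨hr, subset_closure hs⟩
  rw [a1, a2]; exact hsym (1, 0) (0, 1)

lemma Sm.cont (h : Sm I F) : ContinuousOn (fun p : ℝ × ℝ => F p.1 p.2) (Ici 0 ×ˢ I) := h.continuousOn
lemma Sm.contr (h : Sm I F) (hs : s ∈ I) : ContinuousOn (fun ρ => F ρ s) (Ici 0) :=
  h.cont.comp (f := fun ρ => (ρ, s)) (by fun_prop) fun _ hx => ⟨hx, hs⟩
lemma Sm.conts (h : Sm I F) (hr : 0 ≤ r) : ContinuousOn (fun τ => F r τ) I :=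
  h.cont.comp (f := fun τ => (r, τ)) (by fun_prop) fun _ hx => ⟨hr, hx⟩

lemma Sm.add (hF : Sm I F) (hG : Sm I G) : Sm I (fun r s => F r s + G r s) := ContDiffOn.add hF hG
lemma Sm.sub (hF : Sm I F) (hG : Sm I G) : Sm I (fun r s => F r s - G r s) := ContDiffOn.sub hF hG
lemma Sm.mul (hF : Sm I F) (hG : Sm I G) : Sm I (fun r s => F r s * G r s) := ContDiffOn.mul hF hG
lemma Sm.neg (hF : Sm I F) : Sm I (fun r s => - F r s) := ContDiffOn.neg hF
lemma Sm.pow (hF : Sm I F) (n : ℕ) : Sm I (fun r s => F r s ^ n) := ContDiffOn.pow hF n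
lemma Sm.const (c : ℝ) : Sm I (fun _ _ => c) := contDiffOn_const
lemma Sm.of (h : ContDiff ℝ (⊤ : ℕ∞) (fun p : ℝ × ℝ => F p.1 p.2)) : Sm I F := h.contDiffOn
lemma Sm.rpow (hF : Sm I F) (h : ∀ r, 0 ≤ r → ∀ s ∈ I, 0 < F r s) (γ : ℝ) : Sm I (fun r s => F r s ^ γ) :=
  ContDiffOn.rpow_const_of_ne hF fun p hp => (h p.1 hp.1 p.2 hp.2).ne'
lemma Sm.congr (hF : Sm I F) (h : ∀ r, 0 ≤ r → ∀ s ∈ I, G r s = F r s) : Sm I G :=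
  ContDiffOn.congr hF fun p hp => h p.1 hp.1 p.2 hp.2
lemma Sm.mono {J : Set ℝ} (hF : Sm I F) (h : J ⊆ I) : Sm J F :=
  ContDiffOn.mono hF (prod_mono_right h)

lemma Dr_congr (hr : 0 ≤ r) (h : ∀ r, 0 ≤ r → G r s = F r s) : Dr G r s = Dr F r s :=
  derivWithin_congr (fun x hx => h x hx) (h r hr)
lemma Ds_congr (hI : IsOpen I) (hs : s ∈ I) (h : ∀ s ∈ I, G r s = F r s) : Ds G r s = Ds F r s :=
  EventuallyEq.deriv_eq (by filter_upwards [hI.mem_nhds hs] with x hx using h x hx)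
lemma LL_congr {d : ℕ} (hr : 0 ≤ r) (h : ∀ r, 0 ≤ r → G r s = F r s) : LL d G r s = LL d F r s := by
  unfold LL
  rw [Dr_congr hr h, Dr_congr (F := Dr F) hr fun r hr => Dr_congr hr h]
/-- local version, for positive r -/
lemma Dr_congr' (hr : 0 < r) (h : ∀ᶠ x in 𝓝 r, G x s = F x s) : Dr G r s = Dr F r s := by
  unfold Dr
  exact Filter.EventuallyEq.derivWithin_eq (h.filter_mono nhdsWithin_le_nhds) h.self_of_nhds

/-! calculus rules -/
lemma Dr_add (hF : Sm I F) (hG : Sm I G) (hr : 0 ≤ r) (hs : s ∈ I) :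
    Dr (fun r s => F r s + G r s) r s = Dr F r s + Dr G r s := Dr_eq hr ((hF.hasDr hr hs).add (hG.hasDr hr hs))
lemma Dr_sub (hF : Sm I F) (hG : Sm I G) (hr : 0 ≤ r) (hs : s ∈ I) :
    Dr (fun r s => F r s - G r s) r s = Dr F r s - Dr G r s := Dr_eq hr ((hF.hasDr hr hs).sub (hG.hasDr hr hs))
lemma Dr_mul (hF : Sm I F) (hG : Sm I G) (hr : 0 ≤ r) (hs : s ∈ I) :
    Dr (fun r s => F r s * G r s) r s = Dr F r s * G r s + F r s * Dr G r s :=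
  Dr_eq hr ((hF.hasDr hr hs).mul (hG.hasDr hr hs))
lemma Dr_const (c : ℝ) (hr : 0 ≤ r) : Dr (fun _ _ => c) r s = 0 := Dr_eq hr (hasDerivWithinAt_const _ _ _)
lemma Dr_pow (hF : Sm I F) (n : ℕ) (hr : 0 ≤ r) (hs : s ∈ I) :
    Dr (fun r s => F r s ^ n) r s = n * F r s ^ (n-1) * Dr F r s := Dr_eq hr ((hF.hasDr hr hs).pow n)
lemma Dr_rpow (hF : Sm I F) (h : ∀ r, 0 ≤ r → ∀ s ∈ I, 0 < F r s) (γ : ℝ) (hr : 0 ≤ r) (hs : s ∈ I) :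
    Dr (fun r s => F r s ^ γ) r s = γ * F r s ^ (γ-1) * Dr F r s := by
  refine Dr_eq hr (((hF.hasDr hr hs).rpow_const (p := γ) (Or.inl (h r hr s hs).ne')).congr_deriv (by ring))
lemma Ds_add (hI : IsOpen I) (hF : Sm I F) (hG : Sm I G) (hr : 0 ≤ r) (hs : s ∈ I) :
    Ds (fun r s => F r s + G r s) r s = Ds F r s + Ds G r s := Ds_eq ((hF.hasDs hI hr hs).add (hG.hasDs hI hr hs))
lemma Ds_sub (hI : IsOpen I) (hF : Sm I F) (hG : Sm I G) (hr : 0 ≤ r) (hs : s ∈ I) :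
    Ds (fun r s => F r s - G r s) r s = Ds F r s - Ds G r s := Ds_eq ((hF.hasDs hI hr hs).sub (hG.hasDs hI hr hs))
lemma Ds_mul (hI : IsOpen I) (hF : Sm I F) (hG : Sm I G) (hr : 0 ≤ r) (hs : s ∈ I) :
    Ds (fun r s => F r s * G r s) r s = Ds F r s * G r s + F r s * Ds G r s :=
  Ds_eq ((hF.hasDs hI hr hs).mul (hG.hasDs hI hr hs))
lemma Ds_const (c : ℝ) : Ds (fun _ _ => c) r s = 0 := Ds_eq (hasDerivAt_const _ _)
lemma Ds_pow (hI : IsOpen I) (hF : Sm I F) (n : ℕ) (hr : 0 ≤ r) (hs : s ∈ I) :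
    Ds (fun r s => F r s ^ n) r s = n * F r s ^ (n-1) * Ds F r s := Ds_eq ((hF.hasDs hI hr hs).pow n)
lemma Ds_rpow (hI : IsOpen I) (hF : Sm I F) (h : ∀ r, 0 ≤ r → ∀ s ∈ I, 0 < F r s) (γ : ℝ) (hr : 0 ≤ r) (hs : s ∈ I) :
    Ds (fun r s => F r s ^ γ) r s = γ * F r s ^ (γ-1) * Ds F r s := by
  refine Ds_eq (((hF.hasDs hI hr hs).rpow_const (p := γ) (Or.inl (h r hr s hs).ne')).congr_deriv (by ring))

variable {d : ℕ}
lemma LL_add (hI : IsOpen I) (hF : Sm I F) (hG : Sm I G) (hr : 0 ≤ r) (hs : s ∈ I) :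
    LL d (fun r s => F r s + G r s) r s = LL d F r s + LL d G r s := by
  unfold LL
  rw [Dr_congr (F := fun r s => Dr F r s + Dr G r s) hr (fun x hx => Dr_add hF hG hx hs), Dr_add (hF.dr hI) (hG.dr hI) hr hs, Dr_add hF hG hr hs]; ring
lemma LL_sub (hI : IsOpen I) (hF : Sm I F) (hG : Sm I G) (hr : 0 ≤ r) (hs : s ∈ I) :
    LL d (fun r s => F r s - G r s) r s = LL d F r s - LL d G r s := by
  unfold LL
  rw [Dr_congr (F := fun r s => Dr F r s - Dr G r s) hr (fun x hx => Dr_sub hF hG hx hs), Dr_sub (hF.dr hI) (hG.dr hI) hr hs, Dr_sub hF hG hr hs]; ring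
lemma LL_const (c : ℝ) (hr : 0 ≤ r) : LL d (fun _ _ => c) r s = 0 := by
  unfold LL
  rw [Dr_congr (F := fun _ _ => 0) hr (fun x hx => Dr_const c hx), Dr_const _ hr, Dr_const _ hr]; ring
lemma LL_mul (hI : IsOpen I) (hF : Sm I F) (hG : Sm I G) (hr : 0 ≤ r) (hs : s ∈ I) :
    LL d (fun r s => F r s * G r s) r s
      = LL d F r s * G r s + F r s * LL d G r s + 2 * Dr F r s * Dr G r s := by
  unfold LL
  rw [Dr_congr (F := fun r s => Dr F r s * G r s + F r s * Dr G r s) hr (fun x hx => Dr_mul hF hG hx hs),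
    Dr_add ((hF.dr hI).mul hG) (hF.mul (hG.dr hI)) hr hs, Dr_mul (hF.dr hI) hG hr hs,
    Dr_mul hF (hG.dr hI) hr hs, Dr_mul hF hG hr hs]; ring
lemma LL_sq (hI : IsOpen I) (hF : Sm I F) (hr : 0 ≤ r) (hs : s ∈ I) :
    LL d (fun r s => F r s ^ 2) r s = 2 * F r s * LL d F r s + 2 * Dr F r s ^ 2 := by
  rw [LL_congr (F := fun r s => F r s * F r s) hr (fun x _ => pow_two _), LL_mul hI hF hF hr hs]; ring
lemma Sm.ll_comm (hI : IsOpen I) (h : Sm I F) (hr : 0 ≤ r) (hs : s ∈ I) :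
    LL d (Ds F) r s = Ds (fun r s => LL d F r s) r s := by
  unfold LL
  have e : Ds (fun r s => HH d r * Dr F r s) r s = HH d r * Ds (Dr F) r s :=
    Ds_eq (((h.dr hI).hasDs hI hr hs).const_mul _)
  rw [Dr_congr hr (fun x hx => h.comm hI hx hs), (h.dr hI).comm hI hr hs, h.comm hI hr hs, ← e]
  exact (Ds_eq ((((h.dr hI).dr hI).hasDs hI hr hs).add
    (((h.dr hI).hasDs hI hr hs).const_mul (HH d r)) |>.congr_deriv (by rw [e]))).symm
end

section
variable {I : Set ℝ} {F G : ℝ → ℝ → ℝ} {r s : ℝ} {d : ℕ}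

lemma sinh_pos' (hr : 0 < r) : 0 < sinh r := Real.sinh_pos_iff.2 hr
lemma sinh_nn (hr : 0 ≤ r) : 0 ≤ sinh r := Real.sinh_nonneg_iff.2 hr

lemma hasDeriv_w (d : ℕ) (hr : 0 < r) :
    HasDerivAt (fun ρ => sinh ρ ^ d) (sinh r ^ d * HH d r) r := by
  have := (Real.hasDerivAt_sinh r).pow d
  refine this.congr_deriv ?_
  have h := (sinh_pos' hr).ne'
  unfold HH
  rcases d with _ | d
  · simp
  · simp only [Nat.add_sub_cancel, pow_succ]; field_simp

lemma Sm.hasFlux (hI : IsOpen I) (h : Sm I F) (hr : 0 < r) (hs : s ∈ I) :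
    HasDerivAt (fun ρ => sinh ρ ^ d * Dr F ρ s) (sinh r ^ d * LL d F r s) r := by
  refine ((hasDeriv_w d hr).mul ((h.dr hI).hasDr' hr hs)).congr_deriv ?_
  unfold LL; ring

lemma contHH (d : ℕ) : ContinuousOn (HH d) (Ioi 0) := by
  unfold HH
  exact ContinuousOn.mul continuousOn_const (ContinuousOn.div Real.continuous_cosh.continuousOn
    Real.continuous_sinh.continuousOn fun x hx => (sinh_pos' hx).ne')

lemma Sm.contLL (hI : IsOpen I) (h : Sm I F) (hs : s ∈ I) : ContinuousOn (fun r => LL d F r s) (Ioi 0) := by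
  unfold LL
  exact ((((h.dr hI).dr hI).contr hs).mono Ioi_subset_Ici_self).add
    ((contHH d).mul (((h.dr hI).contr hs).mono Ioi_subset_Ici_self))

lemma max_LL (hI : IsOpen I) (h : Sm I F) (hs : s ∈ I) {r0 δ : ℝ} (hr0 : 0 ≤ r0) (hδ : 0 < δ)
    (hz : sinh r0 ^ d * Dr F r0 s = 0)
    (hmax : ∀ r ∈ Ioo r0 (r0 + δ), F r s ≤ F r0 s) : ∃ r ∈ Ioo r0 (r0 + δ), LL d F r s ≤ 0 := by
  by_contra! hc
  have c1 : ContinuousOn (fun ρ => sinh ρ ^ d * Dr F ρ s) (Ici 0) :=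
    (by fun_prop : Continuous (fun ρ => sinh ρ ^ d)).continuousOn.mul ((h.dr hI).contr hs)
  have sub : Icc r0 (r0 + δ/2) ⊆ Ici 0 := fun x hx => hr0.trans hx.1
  have m1 : StrictMonoOn (fun ρ => sinh ρ ^ d * Dr F ρ s) (Icc r0 (r0 + δ/2)) := by
    refine strictMonoOn_of_deriv_pos (convex_Icc _ _) (c1.mono sub) ?_
    intro x hx
    rw [interior_Icc] at hx
    have hx0 : 0 < x := hr0.trans_lt hx.1
    rw [(h.hasFlux hI hx0 hs).deriv]
    exact mul_pos (pow_pos (sinh_pos' hx0) _) (hc x ⟨hx.1, by linarith [hx.2]⟩)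
  have m2 : StrictMonoOn (fun ρ => F ρ s) (Icc r0 (r0 + δ/2)) := by
    refine strictMonoOn_of_deriv_pos (convex_Icc _ _) ((h.contr hs).mono sub) ?_
    intro x hx
    rw [interior_Icc] at hx
    have hx0 : 0 < x := hr0.trans_lt hx.1
    rw [(h.hasDr' hx0 hs).deriv]
    have := m1 (left_mem_Icc.2 (by linarith)) (Ioo_subset_Icc_self hx) hx.1
    simp only [hz] at this
    exact pos_of_mul_pos_right this (pow_pos (sinh_pos' hx0) _).le
  have := m2 (left_mem_Icc.2 (by linarith)) (right_mem_Icc.2 (by linarith)) (by linarith)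
  have h2 := hmax (r0 + δ/2) ⟨by linarith, by linarith⟩
  simp only at this
  linarith

lemma Ds_nonneg_of_max (hI : IsOpen I) (h : Sm I F) (hr : 0 ≤ r) (hs : s ∈ I) {s0 : ℝ} (h0 : s0 < s)
    (hm : ∀ τ ∈ Ioo s0 s, F r τ ≤ F r s) : 0 ≤ Ds F r s := by
  have := (h.hasDs hI hr hs).hasDerivWithinAt (s := Iio s)
  rw [hasDerivWithinAt_iff_tendsto_slope' (by simp)] at this
  refine ge_of_tendsto this ?_
  filter_upwards [Ioo_mem_nhdsLT h0] with τ hτ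
  rw [slope_def_field]
  exact div_nonneg_of_nonpos (by linarith [hm τ hτ]) (by linarith [hτ.2])

theorem MP (hI : IsOpen I) {Z : ℝ → ℝ → ℝ} (hZ : Sm I Z) {α β s0 s1 M : ℝ} (hα : 0 ≤ α)
    (hs : Icc s0 s1 ⊆ I) (hd : 1 ≤ d) (a b : ℝ → ℝ → ℝ) {δ : ℝ} (hδ : 0 < δ)
    (h0 : ∀ r ∈ Icc α β, Z r s0 ≤ M) (hβ : ∀ s ∈ Icc s0 s1, Z β s ≤ M)
    (hα' : 0 < α → ∀ s ∈ Icc s0 s1, Z α s ≤ M)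
    (ha : ∀ r ∈ Ioo α β, ∀ s ∈ Ioc s0 s1, 0 ≤ a r s)
    (hb : α = 0 → ∀ s ∈ Ioc s0 s1, Tendsto (fun r => b r s) (𝓝[>] 0) (𝓝 0))
    (hmain : ∀ r ∈ Ioo α β, ∀ s ∈ Ioc s0 s1, M < Z r s →
      Ds Z r s ≤ a r s * LL d Z r s + b r s * Dr Z r s - δ) :
    ∀ r ∈ Icc α β, ∀ s ∈ Icc s0 s1, Z r s ≤ M := by
  intro r1 hr1 t1 ht1
  have hne : (Icc α β ×ˢ Icc s0 s1).Nonempty := ⟨(r1, t1), hr1, ht1⟩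
  have hsub : Icc α β ×ˢ Icc s0 s1 ⊆ Ici 0 ×ˢ I := prod_mono (fun x hx => hα.trans hx.1) hs
  obtain ⟨⟨r, s⟩, ⟨hr, hss⟩, hmax⟩ :=
    (isCompact_Icc.prod isCompact_Icc).exists_isMaxOn hne (hZ.cont.mono hsub)
  simp only at hr hss
  have hmx : ∀ x ∈ Icc α β, ∀ y ∈ Icc s0 s1, Z x y ≤ Z r s := fun x hx y hy => hmax (mk_mem_prod hx hy)
  by_contra! hM
  have hM' : M < Z r s := hM.trans_le (hmx _ hr1 _ ht1)
  have hsI := hs hss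
  have hs0 : s0 < s := lt_of_le_of_ne hss.1 (by rintro rfl; exact absurd (h0 r hr) (not_le.2 hM'))
  have hrβ : r < β := lt_of_le_of_ne hr.2 (by rintro rfl; exact absurd (hβ s hss) (not_le.2 hM'))
  have hr0 : 0 ≤ r := hα.trans hr.1
  have hDs : 0 ≤ Ds Z r s := Ds_nonneg_of_max hI hZ hr0 hsI hs0
    fun τ hτ => hmx r hr τ ⟨hτ.1.le, hτ.2.le.trans hss.2⟩
  rcases hr0.eq_or_lt with h00 | h00
  · -- r = 0
    subst h00
    have hα0 : α = 0 := le_antisymm hr.1 hα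
    subst hα0
    have c1 : Tendsto (fun x => Ds Z x s) (𝓝[>] 0) (𝓝 (Ds Z 0 s)) :=
      (((hZ.ds hI).contr hsI) 0 self_mem_Ici).mono_left (nhdsWithin_mono _ Ioi_subset_Ici_self)
    have c2 : Tendsto (fun x => Dr Z x s) (𝓝[>] 0) (𝓝 (Dr Z 0 s)) :=
      (((hZ.dr hI).contr hsI) 0 self_mem_Ici).mono_left (nhdsWithin_mono _ Ioi_subset_Ici_self)
    have c3 : Tendsto (fun x => Z x s) (𝓝[>] 0) (𝓝 (Z 0 s)) :=
      ((hZ.contr hsI) 0 self_mem_Ici).mono_left (nhdsWithin_mono _ Ioi_subset_Ici_self)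
    have c4 := (hb rfl s ⟨hs0, hss.2⟩).mul c2
    rw [zero_mul] at c4
    have ev := (c1.eventually (lt_mem_nhds (show Ds Z 0 s > -(δ/2) by linarith))).and
      ((c3.eventually (lt_mem_nhds hM')).and ((c4.eventually (gt_mem_nhds (show (0:ℝ) < δ/2 by linarith))).and
        (Ioo_mem_nhdsGT hrβ)))
    obtain ⟨ε, hε, hev⟩ := (mem_nhdsGT_iff_exists_Ioo_subset).1 ev
    have hε : 0 < ε := hε
    obtain ⟨x, hx, hL⟩ := max_LL (d := d) hI hZ hsI le_rfl (lt_min hε hrβ)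
      (by simp [sinh_zero, zero_pow (show d ≠ 0 by omega)])
      (fun x hx => hmx x ⟨hx.1.le, by have := hx.2; simp at this; linarith [this.2]⟩ s hss)
    have hx2 := hx.2
    simp only [zero_add, lt_min_iff] at hx2
    obtain ⟨e1, e2, e3, e4⟩ := hev ⟨hx.1, hx2.1⟩
    have := hmain x e4 s ⟨hs0, hss.2⟩ e2
    have h5 := mul_nonneg (ha x e4 s ⟨hs0, hss.2⟩) (neg_nonneg.2 hL)
    linarith
  · have hrα : α < r := by
      refine lt_of_le_of_ne hr.1 ?_
      rintro rfl; exact absurd (hα' h00 s hss) (not_le.2 hM')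
    have hDr : Dr Z r s = 0 := by
      have : IsLocalMax (fun x => Z x s) r := by
        filter_upwards [Icc_mem_nhds hrα hrβ] with x hx using hmx x hx s hss
      exact this.hasDerivAt_eq_zero (hZ.hasDr' h00 hsI)
    have hL : LL d Z r s ≤ 0 := by
      by_contra! hL
      have cc : ContinuousAt (fun r => LL d Z r s) r := (hZ.contLL hI hsI).continuousAt (Ioi_mem_nhds h00)
      obtain ⟨ε, hε, hev⟩ := Metric.eventually_nhds_iff_ball.1 (cc.eventually (lt_mem_nhds hL))
      obtain ⟨x, hx, hxL⟩ := max_LL (d := d) hI hZ hsI hr0 (lt_min hε (sub_pos.2 hrβ)) (by rw [hDr, mul_zero])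
        (fun x hx => hmx x ⟨(hrα.trans hx.1).le, by
          have := hx.2.le.trans (add_le_add le_rfl (min_le_right _ _)); linarith⟩ s hss)
      have : x ∈ Metric.ball r ε := by
        rw [Metric.mem_ball, Real.dist_eq, abs_of_pos (sub_pos.2 hx.1)]
        have := hx.2.trans_le (add_le_add le_rfl (min_le_left _ _)); linarith
      exact absurd hxL (not_le.2 (hev x this))
    have := hmain r ⟨hrα, hrβ⟩ s ⟨hs0, hss.2⟩ hM'
    rw [hDr] at this
    have h5 := mul_nonneg (ha r ⟨hrα, hrβ⟩ s ⟨hs0, hss.2⟩) (neg_nonneg.2 hL)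
    linarith
end

section
variable {I : Set ℝ} {F G : ℝ → ℝ → ℝ} {r s a b : ℝ} {d : ℕ}

lemma Sm.ii (h : Sm I F) (ha : 0 ≤ a) (hb : 0 ≤ b) (hs : s ∈ I) :
    IntervalIntegrable (fun r => F r s) volume a b :=
  ((h.contr hs).mono fun _ hx => (le_min ha hb).trans hx.1).intervalIntegrable

lemma Sm.iis (h : Sm I F) (hr : 0 ≤ r) (hs : uIcc a b ⊆ I) :
    IntervalIntegrable (fun s => F r s) volume a b := ((h.conts hr).mono hs).intervalIntegrable

lemma Sm.bdd (h : Sm I F) (ha : 0 ≤ a) {s0 s1 : ℝ} (hs : Icc s0 s1 ⊆ I) :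
    ∃ C, ∀ r ∈ Icc a b, ∀ s ∈ Icc s0 s1, |F r s| ≤ C := by
  obtain ⟨C, hC⟩ := (isCompact_Icc.prod isCompact_Icc).exists_bound_of_continuousOn
    (h.cont.mono (prod_mono (fun x (hx : x ∈ Icc a b) => ha.trans hx.1) hs))
  exact ⟨C, fun r hr s hs => hC (r, s) ⟨hr, hs⟩⟩

lemma exists_Icc_nhds (hI : IsOpen I) (hs : s ∈ I) : ∃ ε > 0, Icc (s - ε) (s + ε) ⊆ I := by
  obtain ⟨ε, hε, h⟩ := Metric.isOpen_iff.1 hI s hs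
  refine ⟨ε/2, by linarith, fun x hx => h ?_⟩
  rw [Metric.mem_ball, Real.dist_eq, abs_lt]; constructor <;> linarith [hx.1, hx.2]

lemma Sm.hasInt (hI : IsOpen I) (h : Sm I F) (ha : 0 ≤ a) (hab : a ≤ b) (hs : s ∈ I) :
    HasDerivAt (fun s => ∫ r in a..b, F r s) (∫ r in a..b, Ds F r s) s := by
  obtain ⟨ε, hε, hsub⟩ := exists_Icc_nhds hI hs
  obtain ⟨C, hC⟩ := (h.ds hI).bdd (b := b) ha hsub
  have hb := ha.trans hab
  have hnh : Ioo (s - ε) (s + ε) ∈ 𝓝 s := Ioo_mem_nhds (by linarith) (by linarith)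
  have key := intervalIntegral.hasDerivAt_integral_of_dominated_loc_of_deriv_le (μ := volume)
    (F := fun s r => F r s) (F' := fun s r => Ds F r s) (x₀ := s) (a := a) (b := b) (bound := fun _ => C) hnh
    (by filter_upwards [hnh] with x hx using
          (h.ii ha hb (hsub (Ioo_subset_Icc_self hx))).def'.aestronglyMeasurable)
    (h.ii ha hb hs) ((h.ds hI).ii ha hb hs).def'.aestronglyMeasurable
    (by
      refine Eventually.of_forall fun x hx y hy => ?_
      rw [uIoc_of_le hab] at hx
      exact hC x ⟨hx.1.le, hx.2⟩ y (Ioo_subset_Icc_self hy))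
    intervalIntegrable_const
    (by
      refine Eventually.of_forall fun x hx y hy => ?_
      rw [uIoc_of_le hab] at hx
      exact h.hasDs hI (ha.trans hx.1.le) (hsub (Ioo_subset_Icc_self hy)))
  exact key.2

lemma Sm.contInt (hI : IsOpen I) (h : Sm I F) (ha : 0 ≤ a) (hab : a ≤ b) :
    ContinuousOn (fun s => ∫ r in a..b, F r s) I := fun _ hs =>
  (h.hasInt hI ha hab hs).continuousAt.continuousWithinAt

lemma Sm.ftcr (h : Sm I F) (hI : IsOpen I) (ha : 0 ≤ a) (hab : a ≤ b) (hs : s ∈ I) :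
    ∫ r in a..b, Dr F r s = F b s - F a s :=
  intervalIntegral.integral_eq_sub_of_hasDerivAt_of_le hab
    ((h.contr hs).mono fun _ hx => ha.trans hx.1) (fun _ hx => h.hasDr' (ha.trans_lt hx.1) hs)
    ((h.dr hI).ii ha (ha.trans hab) hs)


/-- FTC for the flux -/
lemma Sm.flux (hI : IsOpen I) (h : Sm I F) (hd : 1 ≤ d) {g : ℝ → ℝ → ℝ} (hg : Sm I g)
    (e : ∀ r > 0, ∀ s ∈ I, g r s = LL d F r s) (hb : 0 ≤ b) (hs : s ∈ I) :
    ∫ r in (0:ℝ)..b, sinh r ^ d * g r s = sinh b ^ d * Dr F b s := by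
  have c1 : ContinuousOn (fun ρ => sinh ρ ^ d * Dr F ρ s) (Ici 0) :=
    (by fun_prop : Continuous (fun ρ => sinh ρ ^ d)).continuousOn.mul ((h.dr hI).contr hs)
  have := intervalIntegral.integral_eq_sub_of_hasDerivAt_of_le hb
    (c1.mono fun _ hx => hx.1) (fun x hx => (h.hasFlux hI hx.1 hs).congr_deriv
      (show sinh x ^ d * LL d F x s = sinh x ^ d * g x s by rw [e x hx.1 s hs]))
    ((((by fun_prop : Continuous (fun ρ => sinh ρ ^ d)).continuousOn.mul (hg.contr hs)).mono
      (by rw [uIcc_of_le hb]; exact fun _ hx => hx.1)).intervalIntegrable)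
  rw [this]; simp [zero_pow (show d ≠ 0 by omega)]

end

structure Sol (d : ℕ) (q c0 : ℝ) (I : Set ℝ) (v : ℝ → ℝ → ℝ) : Prop where
  sm : Sm I v
  pos : ∀ r, 0 ≤ r → ∀ s ∈ I, 0 < v r s
  eq : ∀ r > 0, ∀ s ∈ I, q * v r s ^ (q-1) * Ds v r s = c0 * LL d v r s

section
variable {I : Set ℝ} {d : ℕ} {q c0 : ℝ} {v : ℝ → ℝ → ℝ} {r s : ℝ}

lemma Sol.mono {J : Set ℝ} (h : Sol d q c0 I v) (hJ : J ⊆ I) : Sol d q c0 J v :=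
  ⟨h.sm.mono hJ, fun r hr s hs => h.pos r hr s (hJ hs), fun r hr s hs => h.eq r hr s (hJ hs)⟩

lemma Sol.smu (h : Sol d q c0 I v) : Sm I (fun r s => v r s ^ q) := h.sm.rpow h.pos q

lemma Sol.equ (hI : IsOpen I) (h : Sol d q c0 I v) (hr : 0 < r) (hs : s ∈ I) :
    Ds (fun r s => v r s ^ q) r s = c0 * LL d v r s := by
  rw [Ds_rpow hI h.sm h.pos q hr.le hs, h.eq r hr s hs]

lemma Sol.scale (hI : IsOpen I) (h : Sol d q c0 I v) {κ θ t0 : ℝ} (hκ : 0 < κ) :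
    Sol d q (κ ^ (1-q) * θ * c0) ((fun s => t0 + θ * s) ⁻¹' I) (fun r s => κ⁻¹ * v r (t0 + θ * s)) := by
  have hsm : Sm ((fun s => t0 + θ * s) ⁻¹' I) (fun r s => v r (t0 + θ * s)) :=
    ContDiffOn.comp (g := fun p : ℝ × ℝ => v p.1 p.2) (f := fun p : ℝ × ℝ => (p.1, t0 + θ * p.2)) h.sm
      (by fun_prop) fun p hp => ⟨hp.1, hp.2⟩
  refine ⟨(Sm.const κ⁻¹).mul hsm, fun r hr s hs => mul_pos (inv_pos.2 hκ) (h.pos r hr _ hs), fun r hr s hs => ?_⟩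
  have e1 : Ds (fun r s => κ⁻¹ * v r (t0 + θ * s)) r s = κ⁻¹ * (Ds v r (t0 + θ * s) * θ) := by
    refine Ds_eq ?_
    have h2 : HasDerivAt (fun τ => t0 + θ * τ) θ s := by
      simpa using ((hasDerivAt_id s).const_mul θ).const_add t0
    exact ((h.sm.hasDs hI hr.le hs).comp s h2).const_mul κ⁻¹
  have e2 : ∀ r, 0 ≤ r → Dr (fun r s => κ⁻¹ * v r (t0 + θ * s)) r s = κ⁻¹ * Dr v r (t0 + θ * s) := fun r hr =>
    Dr_eq hr ((h.sm.hasDr hr hs).const_mul κ⁻¹)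
  have e3 : LL d (fun r s => κ⁻¹ * v r (t0 + θ * s)) r s = κ⁻¹ * LL d v r (t0 + θ * s) := by
    unfold LL
    rw [e2 r hr.le, Dr_congr (F := fun r s => κ⁻¹ * Dr v r (t0 + θ * s)) hr.le e2,
      Dr_eq hr.le (((h.sm.dr hI).hasDr hr.le hs).const_mul κ⁻¹)]; ring
  have hv := h.pos r hr.le _ hs
  rw [e1, e3, mul_rpow (inv_pos.2 hκ).le hv.le, Real.inv_rpow hκ.le, ← Real.rpow_neg hκ.le,
    show -(q-1) = 1 - q by ring]
  linear_combination κ ^ (1-q) * κ⁻¹ * θ * h.eq r hr _ hs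

end

section
/-- smooth approximate Heaviside and its primitive -/
noncomputable def jn (n : ℕ) (x : ℝ) : ℝ := smoothTransition (n * x)
noncomputable def Jn (n : ℕ) (x : ℝ) : ℝ := ∫ y in (0:ℝ)..x, jn n y

lemma jn_smooth (n : ℕ) : ContDiff ℝ (⊤ : ℕ∞) (jn n) :=
  smoothTransition.contDiff.comp (contDiff_const.mul contDiff_id)
lemma jn_nn (n : ℕ) (x : ℝ) : 0 ≤ jn n x := smoothTransition.nonneg _
lemma jn_le (n : ℕ) (x : ℝ) : jn n x ≤ 1 := smoothTransition.le_one _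
lemma jn_zero (n : ℕ) {x : ℝ} (hx : x ≤ 0) : jn n x = 0 :=
  smoothTransition.zero_of_nonpos (mul_nonpos_of_nonneg_of_nonpos (by positivity) hx)
lemma st_mono : Monotone smoothTransition := smoothTransition.monotone
lemma jn_mono (n : ℕ) : Monotone (jn n) := fun x y h => st_mono (by gcongr)
lemma jn_one_le {n : ℕ} (hn : 1 ≤ n) (x : ℝ) : jn 1 x ≤ jn n x := by
  rcases le_total x 0 with h | h
  · rw [jn_zero 1 h]; exact jn_nn _ _
  · exact st_mono (by push_cast; gcongr; exact_mod_cast hn)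
lemma jn_tend {x : ℝ} (hx : 0 < x) : Tendsto (fun n => jn n x) atTop (𝓝 1) := by
  refine tendsto_const_nhds.congr' ?_
  obtain ⟨n0, hn0⟩ := exists_nat_ge (1/x)
  filter_upwards [eventually_ge_atTop n0] with n hn
  refine (smoothTransition.one_of_one_le ?_).symm
  have : (1/x) ≤ n := hn0.trans (by exact_mod_cast hn)
  rwa [div_le_iff₀ hx] at this
lemma Jn_deriv (n : ℕ) (x : ℝ) : HasDerivAt (Jn n) (jn n x) x :=
  intervalIntegral.integral_hasDerivAt_right ((jn_smooth n).continuous.intervalIntegrable _ _)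
    ((jn_smooth n).continuous.stronglyMeasurableAtFilter _ _) (jn_smooth n).continuous.continuousAt
lemma Jn_smooth (n : ℕ) : ContDiff ℝ (⊤ : ℕ∞) (Jn n) := by
  rw [show ((⊤:ℕ∞) : WithTop ℕ∞) = (⊤:ℕ∞) + 1 by rfl, contDiff_succ_iff_deriv]
  refine ⟨fun x => (Jn_deriv n x).differentiableAt, by simp, ?_⟩
  rw [show deriv (Jn n) = jn n from funext fun x => (Jn_deriv n x).deriv]; exact jn_smooth n
lemma Jn_zero (n : ℕ) {x : ℝ} (hx : x ≤ 0) : Jn n x = 0 := by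
  unfold Jn
  rw [intervalIntegral.integral_congr (g := fun _ => (0:ℝ))]
  · simp
  · intro y hy; rw [uIcc_of_ge hx] at hy; exact jn_zero n hy.2
lemma Jn_nn (n : ℕ) (x : ℝ) : 0 ≤ Jn n x := by
  rcases le_total x 0 with h | h
  · rw [Jn_zero n h]
  · exact intervalIntegral.integral_nonneg h fun y _ => jn_nn n y
lemma Jn_le (n : ℕ) {x : ℝ} (hx : 0 ≤ x) : Jn n x ≤ x := by
  have := intervalIntegral.integral_mono_on (μ := volume) (g := fun _ => (1:ℝ)) hx
    ((jn_smooth n).continuous.intervalIntegrable 0 x) intervalIntegrable_const (fun y _ => jn_le n y)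
  rw [intervalIntegral.integral_const] at this
  unfold Jn; simpa using this
lemma Jn_one_le {n : ℕ} (hn : 1 ≤ n) (x : ℝ) : Jn 1 x ≤ Jn n x := by
  rcases le_total x 0 with h | h
  · rw [Jn_zero 1 h]; exact Jn_nn _ _
  · exact intervalIntegral.integral_mono_on h
      ((jn_smooth 1).continuous.intervalIntegrable 0 x) ((jn_smooth n).continuous.intervalIntegrable 0 x)
      (fun y _ => jn_one_le hn y)
lemma Jn_pos {x : ℝ} (hx : 0 < x) : 0 < Jn 1 x := by
  refine intervalIntegral.intervalIntegral_pos_of_pos_on ((jn_smooth 1).continuous.intervalIntegrable 0 x) ?_ hx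
  intro y hy
  exact smoothTransition.pos_of_pos (by simpa using hy.1)
end

section
variable {I : Set ℝ} {d : ℕ} {q : ℝ} {v1 v2 : ℝ → ℝ → ℝ} {r s : ℝ}

noncomputable def Phi (d : ℕ) (R r : ℝ) : ℝ := exp (-d*r) - exp (-d*R)

lemma we_mono (d : ℕ) (hr : 0 < r) : HasDerivAt (fun ρ => sinh ρ ^ d * exp (-d*ρ))
    (sinh r ^ d * exp (-d*r) * (HH d r - d)) r := by
  have h2 : HasDerivAt (fun ρ => exp (-d*ρ)) (exp (-d*r) * (-(d:ℝ))) r := by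
    simpa using ((hasDerivAt_id r).const_mul (-(d:ℝ))).exp
  exact ((hasDeriv_w d hr).mul h2).congr_deriv (by ring)

lemma HH_ge (d : ℕ) (hr : 0 < r) : (d:ℝ) ≤ HH d r := by
  unfold HH
  have : 1 ≤ cosh r / sinh r := by
    rw [le_div_iff₀ (sinh_pos' hr), one_mul]; exact (Real.sinh_lt_cosh r).le
  nlinarith [Nat.cast_nonneg (α := ℝ) d]

lemma w_le_exp (d : ℕ) (hr : 0 ≤ r) : sinh r ^ d ≤ exp (d * r) := by
  have : sinh r ≤ exp r := by
    rw [Real.sinh_eq]; linarith [exp_pos r, exp_pos (-r)]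
  calc _ ≤ exp r ^ d := pow_le_pow_left₀ (sinh_nn hr) this d
    _ = _ := by rw [← Real.exp_nat_mul]

lemma cmp_static (hI : IsOpen I) {P z : ℝ → ℝ → ℝ} (hP : Sm I P) (hz : Sm I z) (hd : 1 ≤ d)
    (hzP : ∀ r > 0, Ds z r s = LL d P r s) (hs : s ∈ I) {R ε : ℝ} (hR : 0 < R) (hε : 0 ≤ ε)
    (hPR : P R s ≤ ε) (n : ℕ) :
    ∫ r in (0:ℝ)..R, Ds z r s * jn n (P r s) * (Phi d R r * sinh r ^ d) ≤ d * ε := by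
  set Θ := fun r => sinh r ^ d * Dr P r s * (jn n (P r s) * Phi d R r)
    + (d:ℝ) * (sinh r ^ d * exp (-d*r)) * Jn n (P r s)
  have cP := hP.contr hs
  have cDP := (hP.dr hI).contr hs
  have cPhi : Continuous (Phi d R) := by unfold Phi; fun_prop
  have cj : ContinuousOn (fun r => jn n (P r s)) (Ici 0) := (jn_smooth n).continuous.comp_continuousOn cP
  have cJ : ContinuousOn (fun r => Jn n (P r s)) (Ici 0) := (Jn_smooth n).continuous.comp_continuousOn cP
  have cw : Continuous (fun ρ => sinh ρ ^ d) := by fun_prop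
  have ce : Continuous (fun ρ => exp (-d*ρ)) := by fun_prop
  have key := intervalIntegral.integral_le_sub_of_hasDeriv_right_of_le (a := 0) (b := R) (g := Θ)
    (g' := fun r => sinh r ^ d * LL d P r s * (jn n (P r s) * Phi d R r)
      + sinh r ^ d * Dr P r s * (deriv (jn n) (P r s) * Dr P r s * Phi d R r
        + jn n (P r s) * (-d * exp (-d*r)))
      + ((d:ℝ) * (sinh r ^ d * exp (-d*r) * (HH d r - d)) * Jn n (P r s)
        + (d:ℝ) * (sinh r ^ d * exp (-d*r)) * (jn n (P r s) * Dr P r s)))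
    (φ := fun r => Ds z r s * jn n (P r s) * (Phi d R r * sinh r ^ d)) hR.le ?_ ?_ ?_ ?_
  · refine key.trans ?_
    have e1 : Θ 0 = 0 := by simp [Θ, zero_pow (show d ≠ 0 by omega)]
    have e2 : Θ R = d * (sinh R ^ d * exp (-d*R)) * Jn n (P R s) := by simp [Θ, Phi]
    have e3 : Jn n (P R s) ≤ ε := by
      rcases le_total (P R s) 0 with h | h
      · rw [Jn_zero n h]; exact hε
      · exact (Jn_le n h).trans hPR
    have e4 : sinh R ^ d * exp (-d*R) ≤ 1 := by
      calc _ ≤ exp (d * R) * exp (-d*R) := by gcongr; exact w_le_exp d hR.le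
        _ = 1 := by rw [← exp_add]; simp
    have e5 : 0 ≤ sinh R ^ d * exp (-d*R) := by have := sinh_nn hR.le; positivity
    rw [e1, e2, sub_zero, mul_assoc]
    refine mul_le_mul_of_nonneg_left ?_ (by positivity)
    nlinarith [Jn_nn n (P R s)]
  · exact (((cw.continuousOn.mul cDP).mul (cj.mul cPhi.continuousOn)).add
      ((continuousOn_const.mul (cw.mul ce).continuousOn).mul cJ)).mono fun _ hx => hx.1
  · intro x hx
    have hx0 : 0 < x := hx.1
    have dP := hP.hasDr' hx0 hs
    have djP : HasDerivAt (fun r => jn n (P r s)) (deriv (jn n) (P x s) * Dr P x s) x :=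
      HasDerivAt.comp (h₂ := jn n) (h := fun r => P r s) x
        (((jn_smooth n).differentiable (by simp) (P x s)).hasDerivAt) dP
    have dJP : HasDerivAt (fun r => Jn n (P r s)) (jn n (P x s) * Dr P x s) x := (Jn_deriv n _).comp x dP
    have dPhi : HasDerivAt (Phi d R) (-d * exp (-d*x)) x := by
      have := (((hasDerivAt_id x).const_mul (-(d:ℝ))).exp).sub_const (exp (-d*R))
      simp only [id, mul_one] at this
      exact this.congr_deriv (by ring)
    exact ((((hP.hasFlux hI hx0 hs).mul (djP.mul dPhi)).add
      (((we_mono d hx0).const_mul (d:ℝ)).mul dJP)).hasDerivWithinAt)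
  · exact (((((hz.ds hI).contr hs).mul cj).mul (cPhi.mul cw).continuousOn).mono
      fun _ hx => hx.1).integrableOn_compact isCompact_Icc
  · intro x hx
    have hx0 : 0 < x := hx.1
    rw [hzP x hx0]
    have hw := pow_pos (sinh_pos' hx0) d
    have hPh : 0 ≤ Phi d R x := by
      unfold Phi; rw [sub_nonneg, exp_le_exp]
      nlinarith [hx.2, Nat.cast_nonneg (α := ℝ) d]
    have hdj : 0 ≤ deriv (jn n) (P x s) := (jn_mono n).deriv_nonneg
    have t1 : 0 ≤ sinh x ^ d * (deriv (jn n) (P x s) * Dr P x s ^ 2 * Phi d R x) := by positivity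
    have t2 : 0 ≤ (d:ℝ) * (sinh x ^ d * exp (-d*x) * (HH d x - d)) * Jn n (P x s) := by
      have := HH_ge d hx0
      have := Jn_nn n (P x s)
      have : 0 ≤ HH d x - d := by linarith
      positivity
    linarith

theorem comparison (hI : IsOpen I) (hq : 1 < q) (hd : 1 ≤ d) (h1 : Sol d q 1 I v1) (h2 : Sol d q 1 I v2)
    {t0 t1 : ℝ} (ht : t0 ≤ t1) (hsub : Icc t0 t1 ⊆ I) (h0 : ∀ r, 0 ≤ r → v1 r t0 ≤ v2 r t0)
    (hinf : ∀ ε > 0, ∃ R0, ∀ R ≥ R0, ∀ t ∈ Icc t0 t1, v1 R t ≤ ε) :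
    ∀ r, 0 ≤ r → v1 r t1 ≤ v2 r t1 := by
  set z : ℝ → ℝ → ℝ := fun r s => v1 r s ^ q - v2 r s ^ q
  set P : ℝ → ℝ → ℝ := fun r s => v1 r s - v2 r s
  have hz : Sm I z := h1.smu.sub h2.smu
  have hP : Sm I P := h1.sm.sub h2.sm
  have hzP : ∀ r > 0, ∀ s ∈ I, Ds z r s = LL d P r s := by
    intro r hr s hs
    rw [Ds_sub hI h1.smu h2.smu hr.le hs, LL_sub hI h1.sm h2.sm hr.le hs, h1.equ hI hr hs, h2.equ hI hr hs]; ring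
  have sgn : ∀ r, 0 ≤ r → ∀ s ∈ I, (0 < z r s ↔ 0 < P r s) := by
    intro r hr s hs
    simp only [z, P, sub_pos]
    exact Real.rpow_lt_rpow_iff (h2.pos r hr s hs).le (h1.pos r hr s hs).le (by linarith)
  have ht1 : t1 ∈ I := hsub (right_mem_Icc.2 ht)
  intro r0 hr0
  by_contra! hlt
  have cw : Continuous (fun ρ => sinh ρ ^ d) := by fun_prop
  have cPhi : ∀ R, Continuous (Phi d R) := fun R => by unfold Phi; fun_prop
  have Phi_nn : ∀ R r, r ≤ R → 0 ≤ Phi d R r := fun R r h => by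
    unfold Phi; rw [sub_nonneg, exp_le_exp]; nlinarith [Nat.cast_nonneg (α := ℝ) d]
  have cJz : ∀ n, ContinuousOn (fun r => Jn n (z r t1)) (Ici 0) := fun n =>
    (Jn_smooth n).continuous.comp_continuousOn (hz.contr ht1)
  -- positive quantity
  set R1 := r0 + 1
  set Y := ∫ r in (0:ℝ)..R1, Jn 1 (z r t1) * (Phi d R1 r * sinh r ^ d)
  have hYpos : 0 < Y := by
    have hzr : 0 < z r0 t1 := (sgn r0 hr0 t1 ht1).2 (sub_pos.2 hlt)
    have : ∀ᶠ x in 𝓝[>] r0, 0 < z x t1 :=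
      (((hz.contr ht1) r0 hr0).mono_left (nhdsWithin_mono _ fun x hx => hr0.trans (le_of_lt hx))).eventually
        (lt_mem_nhds hzr)
    obtain ⟨x, hx, hx2⟩ := (this.and (Ioo_mem_nhdsGT (show r0 < R1 by simp [R1]))).exists
    have hx0 : 0 < x := hr0.trans_lt hx2.1
    refine intervalIntegral.integral_pos (by simp [R1]; linarith) (((cJz 1).mul
      ((cPhi R1).mul cw).continuousOn).mono fun _ hx => hx.1) ?_ ⟨x, ⟨hx0.le, hx2.2.le⟩, ?_⟩
    · intro y hy
      have := Jn_nn 1 (z y t1); have := Phi_nn R1 y hy.2; have := sinh_nn hy.1.le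
      positivity
    · have a1 := Jn_pos hx; have a2 := pow_pos (sinh_pos' hx0) d
      have a3 : 0 < Phi d R1 x := by
        unfold Phi; rw [sub_pos, Real.exp_lt_exp]
        have : (0:ℝ) < d := by exact_mod_cast hd
        nlinarith [hx2.2]
      positivity
  have hdp : (0:ℝ) < d := by exact_mod_cast hd
  set ε := Y / (2 * d * (t1 - t0 + 1))
  have hεp : 0 < ε := by have : 0 < t1 - t0 + 1 := by linarith
                         positivity
  obtain ⟨R0, hR0⟩ := hinf ε hεp
  set R := max R0 R1
  have hRR1 : R1 ≤ R := le_max_right _ _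
  have hRp : 0 < R := by have : 0 < R1 := by simp [R1]; linarith
                         linarith
  set e : ℕ → ℝ → ℝ := fun n s => ∫ r in (0:ℝ)..R, Ds z r s * (jn n (z r s) - jn n (P r s)) * (Phi d R r * sinh r ^ d)
  have smj : ∀ {G : ℝ → ℝ → ℝ} n, Sm I G → Sm I (fun r s => jn n (G r s)) := fun n hG =>
    (jn_smooth n).comp_contDiffOn hG
  have smPw : Sm I (fun r _ => Phi d R r * sinh r ^ d) := by
    refine Sm.of ?_; unfold Phi; fun_prop
  have hesm : ∀ n, Sm I (fun r s => Ds z r s * (jn n (z r s) - jn n (P r s)) * (Phi d R r * sinh r ^ d)) :=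
    fun n => ((hz.ds hI).mul ((smj n hz).sub (smj n hP))).mul smPw
  obtain ⟨C, hC⟩ := (hz.ds hI).bdd (b := R) le_rfl hsub
  have hC0 : 0 ≤ C := (abs_nonneg _).trans (hC 0 ⟨le_rfl, hRp.le⟩ t0 ⟨le_rfl, ht⟩)
  obtain ⟨C', hC'⟩ := smPw.bdd (b := R) le_rfl hsub
  have hbd : ∀ n, ∀ s ∈ Icc t0 t1, ∀ r ∈ Icc 0 R,
      ‖Ds z r s * (jn n (z r s) - jn n (P r s)) * (Phi d R r * sinh r ^ d)‖ ≤ C * 1 * C' := by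
    intro n s hs r hr
    rw [norm_mul, norm_mul]
    have : |jn n (z r s) - jn n (P r s)| ≤ 1 := by
      rw [abs_le]; constructor <;> linarith [jn_nn n (z r s), jn_le n (z r s), jn_nn n (P r s), jn_le n (P r s)]
    exact mul_le_mul (mul_le_mul (hC r hr s hs) this (abs_nonneg _) hC0) (hC' r hr s hs) (abs_nonneg _) (by positivity)
  have hlim1 : ∀ s ∈ Icc t0 t1, Tendsto (fun n => e n s) atTop (𝓝 0) := by
    intro s hs
    have : (0:ℝ) = ∫ r in (0:ℝ)..R, (0:ℝ) := by simp
    rw [this]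
    refine intervalIntegral.tendsto_integral_filter_of_dominated_convergence (fun _ => C * 1 * C')
      (Eventually.of_forall fun n => ((hesm n).ii le_rfl hRp.le (hsub hs)).def'.aestronglyMeasurable)
      (Eventually.of_forall fun n => Eventually.of_forall fun r hr => ?_) intervalIntegrable_const
      (Eventually.of_forall fun r hr => ?_)
    · rw [uIoc_of_le hRp.le] at hr; exact hbd n s hs r ⟨hr.1.le, hr.2⟩
    · rw [uIoc_of_le hRp.le] at hr
      rcases le_or_gt (z r s) 0 with hz0 | hz0
      · have hP0 : P r s ≤ 0 := not_lt.1 fun h => not_lt.2 hz0 ((sgn r hr.1.le s (hsub hs)).2 h)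
        simp [jn_zero _ hz0, jn_zero _ hP0]
      · have hP0 := (sgn r hr.1.le s (hsub hs)).1 hz0
        simpa using (((jn_tend hz0).sub (jn_tend hP0)).const_mul (Ds z r s)).mul_const (Phi d R r * sinh r ^ d)
  have hlim2 : Tendsto (fun n => ∫ s in t0..t1, e n s) atTop (𝓝 0) := by
    have : (0:ℝ) = ∫ r in t0..t1, (0:ℝ) := by simp
    rw [this]
    refine intervalIntegral.tendsto_integral_filter_of_dominated_convergence (fun _ => C * 1 * C' * |R - 0|)
      (Eventually.of_forall fun n => ((((hesm n).contInt hI le_rfl hRp.le).mono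
        (by rwa [uIcc_of_le ht])).intervalIntegrable).def'.aestronglyMeasurable)
      (Eventually.of_forall fun n => Eventually.of_forall fun s hs => ?_) intervalIntegrable_const
      (Eventually.of_forall fun s hs => ?_)
    · rw [uIoc_of_le ht] at hs
      refine intervalIntegral.norm_integral_le_of_norm_le_const fun r hr => ?_
      rw [uIoc_of_le hRp.le] at hr
      exact hbd n s ⟨hs.1.le, hs.2⟩ r ⟨hr.1.le, hr.2⟩
    · rw [uIoc_of_le ht] at hs; exact hlim1 s ⟨hs.1.le, hs.2⟩
  have hsmJ : ∀ n, Sm I (fun r s => Jn n (z r s) * (Phi d R r * sinh r ^ d)) := fun n =>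
    Sm.mul ((Jn_smooth n).comp_contDiffOn hz) smPw
  have main : ∀ n, 1 ≤ n → Y ≤ d * ε * (t1 - t0) + ∫ s in t0..t1, e n s := by
    intro n hn
    set y : ℝ → ℝ := fun s => ∫ r in (0:ℝ)..R, Jn n (z r s) * (Phi d R r * sinh r ^ d)
    have hy0 : y t0 = 0 := by
      simp only [y]
      rw [intervalIntegral.integral_congr (g := fun _ => (0:ℝ))]
      · simp
      · intro r hr; rw [uIcc_of_le hRp.le] at hr
        have : z r t0 ≤ 0 := sub_nonpos.2 (rpow_le_rpow (h1.pos r hr.1 _ (hsub ⟨le_rfl, ht⟩)).le (h0 r hr.1) (by linarith))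
        simp [Jn_zero n this]
    have hyY : Y ≤ y t1 := by
      have i1 : IntervalIntegrable (fun r => Jn n (z r t1) * (Phi d R r * sinh r ^ d)) volume 0 R1 :=
        (hsmJ n).ii le_rfl (by simp [R1]; linarith) ht1
      have i2 : IntervalIntegrable (fun r => Jn n (z r t1) * (Phi d R r * sinh r ^ d)) volume R1 R :=
        (hsmJ n).ii (by simp [R1]; linarith) hRp.le ht1
      simp only [y]
      rw [← intervalIntegral.integral_add_adjacent_intervals i1 i2]
      have a1 : 0 ≤ ∫ r in R1..R, Jn n (z r t1) * (Phi d R r * sinh r ^ d) := by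
        refine intervalIntegral.integral_nonneg hRR1 fun r hr => ?_
        have := Jn_nn n (z r t1); have := Phi_nn R r hr.2
        have := sinh_nn (show 0 ≤ r by have := hr.1; simp [R1] at this; linarith)
        positivity
      have a2 : Y ≤ ∫ r in (0:ℝ)..R1, Jn n (z r t1) * (Phi d R r * sinh r ^ d) := by
        refine intervalIntegral.integral_mono_on (by simp [R1]; linarith)
          (((cJz 1).mul ((cPhi R1).mul cw).continuousOn).mono
            (by rw [uIcc_of_le (by simp [R1]; linarith)]; exact fun _ hx => hx.1)).intervalIntegrable i1 fun r hr => ?_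
        have b1 := Jn_one_le hn (z r t1)
        have b2 : Phi d R1 r ≤ Phi d R r := by
          unfold Phi; have : exp (-d*R) ≤ exp (-d*R1) := by
            rw [exp_le_exp]; nlinarith
          linarith
        have := Jn_nn 1 (z r t1); have := Phi_nn R1 r hr.2; have := sinh_nn hr.1
        gcongr
        exact Jn_nn _ _
      linarith
    have hyd : ∀ s ∈ Icc t0 t1, HasDerivAt y (∫ r in (0:ℝ)..R, Ds z r s * jn n (z r s) * (Phi d R r * sinh r ^ d)) s := by
      intro s hs
      refine ((hsmJ n).hasInt hI le_rfl hRp.le (hsub hs)).congr_deriv ?_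
      refine intervalIntegral.integral_congr fun r hr => ?_
      rw [uIcc_of_le hRp.le] at hr
      refine Ds_eq ?_
      exact (((Jn_deriv n _).comp s (hz.hasDs hI hr.1 (hsub hs))).mul_const _).congr_deriv (by ring)
    have hle := image_le_of_deriv_right_le_deriv_boundary (f := y) (a := t0) (b := t1)
      (f' := fun s => ∫ r in (0:ℝ)..R, Ds z r s * jn n (z r s) * (Phi d R r * sinh r ^ d))
      (B := fun s => d * ε * (s - t0) + ∫ τ in t0..s, e n τ) (B' := fun s => d * ε + e n s)
      (fun s hs => (hyd s hs).continuousAt.continuousWithinAt)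
      (fun s hs => (hyd s (Ico_subset_Icc_self hs)).hasDerivWithinAt)
      (by simp [hy0]) ?_ ?_ ?_ (right_mem_Icc.2 ht)
    · exact hyY.trans hle
    · have := (((hesm n).contInt hI le_rfl hRp.le).mono hsub)
      have c := intervalIntegral.continuousOn_primitive_interval (μ := volume)
        (this.integrableOn_compact isCompact_Icc |>.mono_set (by rw [uIcc_of_le ht]))
      rw [uIcc_of_le ht] at c
      exact (by fun_prop : Continuous fun s => d * ε * (s - t0)).continuousOn.add c
    · intro s hs
      have hc := ((hesm n).contInt hI le_rfl hRp.le)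
      have hsI := hsub (Ico_subset_Icc_self hs)
      have b1 : HasDerivAt (fun s => ∫ τ in t0..s, e n τ) (e n s) s :=
        intervalIntegral.integral_hasDerivAt_right
          ((hc.mono (by rw [uIcc_of_le hs.1]; exact fun x hx => hsub ⟨hx.1, hx.2.trans hs.2.le⟩)).intervalIntegrable)
          (hc.stronglyMeasurableAtFilter hI s hsI) (hc.continuousAt (hI.mem_nhds hsI))
      have b2 : HasDerivAt (fun s => d * ε * (s - t0)) (d * ε) s := by
        simpa using ((hasDerivAt_id s).sub_const t0).const_mul (d * ε)
      exact (b2.add b1).hasDerivWithinAt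
    · intro s hs
      have hsI := hsub (Ico_subset_Icc_self hs)
      have k1 := cmp_static hI hP hz hd (fun r hr => hzP r hr s hsI) hsI hRp hεp.le
        (by have := hR0 R (le_max_left _ _) s (Ico_subset_Icc_self hs)
            have := h2.pos R hRp.le s hsI
            simp only [P]; linarith) n
      have k2 : (∫ r in (0:ℝ)..R, Ds z r s * jn n (z r s) * (Phi d R r * sinh r ^ d)) =
          (∫ r in (0:ℝ)..R, Ds z r s * jn n (P r s) * (Phi d R r * sinh r ^ d)) + e n s := by
        simp only [e]
        rw [← intervalIntegral.integral_add
          ((((hz.ds hI).mul (smj n hP)).mul smPw).ii le_rfl hRp.le hsI) ((hesm n).ii le_rfl hRp.le hsI)]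
        congr 1; ext r; ring
      rw [k2]; linarith
  have fin : Y ≤ d * ε * (t1 - t0) + 0 :=
    ge_of_tendsto (hlim2.const_add _) (by filter_upwards [eventually_ge_atTop 1] with n hn using main n hn)
  have : d * ε * (t1 - t0) ≤ Y / 2 := by
    have hden : 0 < t1 - t0 + 1 := by linarith
    have : d * ε * (t1 - t0 + 1) = Y / 2 := by simp only [ε]; field_simp
    nlinarith
  linarith
end

section
variable {I : Set ℝ} {F : ℝ → ℝ → ℝ} {r s a b : ℝ} {d : ℕ}

lemma Sm.hasIntr (hI : IsOpen I) (h : Sm I F) (hr : 0 < r) (hs : Icc a b ⊆ I) (hab : a ≤ b) :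
    HasDerivAt (fun r => ∫ s in a..b, F r s) (∫ s in a..b, Dr F r s) r := by
  obtain ⟨C, hC⟩ := (h.dr hI).bdd (a := 0) (b := 2 * r) le_rfl hs
  have hnh : Ioo 0 (2 * r) ∈ 𝓝 r := Ioo_mem_nhds hr (by linarith)
  have hu : uIcc a b ⊆ I := by rwa [uIcc_of_le hab]
  have key := intervalIntegral.hasDerivAt_integral_of_dominated_loc_of_deriv_le (μ := volume)
    (F := fun r s => F r s) (F' := fun r s => Dr F r s) (x₀ := r) (a := a) (b := b) (bound := fun _ => C) hnh
    (by filter_upwards [hnh] with x hx using (h.iis hx.1.le hu).def'.aestronglyMeasurable)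
    (h.iis hr.le hu) ((h.dr hI).iis hr.le hu).def'.aestronglyMeasurable
    (by
      refine Eventually.of_forall fun x hx y hy => ?_
      rw [uIoc_of_le hab] at hx
      exact hC y (Ioo_subset_Icc_self hy) x ⟨hx.1.le, hx.2⟩)
    intervalIntegrable_const
    (by
      refine Eventually.of_forall fun x hx y hy => ?_
      rw [uIoc_of_le hab] at hx
      exact h.hasDr' hy.1 (hs ⟨hx.1.le, hx.2⟩))
  exact key.2

lemma sinh_lower (hs : 0 < s) : s / (1 + 2 * s) * exp s ≤ sinh s := by
  have h1 : sinh s = exp s * (1 - exp (-(2*s))) / 2 := by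
    rw [Real.sinh_eq, mul_sub, ← exp_add]; ring_nf
  have h2 : exp (-(2*s)) ≤ 1 / (1 + 2*s) := by
    rw [Real.exp_neg, ← one_div]
    exact one_div_le_one_div_of_le (by linarith) (by linarith [Real.add_one_le_exp (2*s)])
  have h3 : s / (1 + 2*s) ≤ (1 - exp (-(2*s))) / 2 := by
    have : s / (1+2*s) = (1 - 1/(1+2*s))/2 := by field_simp; ring
    rw [this]; linarith
  rw [h1]
  nlinarith [exp_pos s]

lemma w_lower (d : ℕ) (hs : 0 < s) : (s / (1 + 2 * s)) ^ d * exp (d * s) ≤ sinh s ^ d := by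
  rw [Real.exp_nat_mul, ← mul_pow]
  exact pow_le_pow_left₀ (by positivity) (sinh_lower hs) d

lemma w_lower1 (d : ℕ) (hs : 1 ≤ s) : (1/3) ^ d * exp (d * s) ≤ sinh s ^ d := by
  refine le_trans ?_ (w_lower d (by linarith))
  have : 1/3 ≤ s / (1 + 2*s) := by rw [div_le_div_iff₀ (by norm_num) (by linarith)]; linarith
  exact mul_le_mul_of_nonneg_right (pow_le_pow_left₀ (by norm_num) this d) (exp_pos _).le

lemma winv_far (d : ℕ) (hs : 1 ≤ s) : (sinh s ^ d)⁻¹ ≤ 3 ^ d * exp (-d * s) := by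
  have := w_lower1 d hs
  have h2 := inv_anti₀ (by positivity) this
  refine h2.trans (le_of_eq ?_)
  rw [mul_inv, ← Real.exp_neg]; simp

lemma winv_near (d : ℕ) (hs : 0 < s) : (sinh s ^ d)⁻¹ ≤ (s ^ d)⁻¹ := by
  refine inv_anti₀ (by positivity) (pow_le_pow_left₀ hs.le ?_ d)
  exact (Real.self_le_sinh_iff.2 hs.le)

lemma exp_int (hb : 0 < b) {R : ℝ} (h : r ≤ R) : ∫ s in r..R, exp (-b * s) ≤ exp (-b*r) / b := by
  have := intervalIntegral.integral_eq_sub_of_hasDerivAt (a := r) (b := R) (f := fun s => - (exp (-b*s) / b))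
    (f' := fun s => exp (-b*s)) (fun x _ => by
      have := ((((hasDerivAt_id x).const_mul (-b)).exp).div_const b).neg
      simp only [id] at this
      refine this.congr_deriv (by field_simp))
    ((by fun_prop : Continuous fun s => exp (-b*s)).intervalIntegrable _ _)
  rw [this]
  have : 0 ≤ exp (-b*R)/b := by positivity
  linarith

lemma contwinv (d : ℕ) : ContinuousOn (fun s => (sinh s ^ d)⁻¹) (Ioi 0) :=
  ContinuousOn.inv₀ (by fun_prop) fun x hx => (pow_pos (sinh_pos' hx) d).ne'

lemma iiwinv (d : ℕ) (hr : 0 < r) {R : ℝ} (h : r ≤ R) :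
    IntervalIntegrable (fun s => (sinh s ^ d)⁻¹) volume r R :=
  ((contwinv d).mono (by rw [uIcc_of_le h]; exact fun x hx => hr.trans_le hx.1)).intervalIntegrable

lemma G2far (hd : 1 ≤ d) (hr : 1 ≤ r) {R : ℝ} (h : r ≤ R) :
    ∫ s in r..R, (sinh s ^ d)⁻¹ ≤ 3 ^ d * exp (-d * r) := by
  have hd' : (1:ℝ) ≤ d := by exact_mod_cast hd
  calc _ ≤ ∫ s in r..R, 3 ^ d * exp (-d * s) :=
        intervalIntegral.integral_mono_on h (iiwinv d (by linarith) h)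
          ((by fun_prop : Continuous fun s => 3 ^ d * exp (-d*s)).intervalIntegrable _ _)
          fun x hx => winv_far d (hr.trans hx.1)
    _ ≤ _ := by
        rw [intervalIntegral.integral_const_mul]
        gcongr
        refine (exp_int (by linarith) h).trans (div_le_self (exp_pos _).le hd')

lemma G2near (hd : 1 ≤ d) {η : ℝ} (hη : 0 < η) : ∃ C > 0, ∀ r, 0 < r → r ≤ 1 → ∀ R, r ≤ R →
    ∫ s in r..R, (sinh s ^ d)⁻¹ ≤ C * r ^ (-((d:ℝ)-1) - η) := by
  have hd' : (1:ℝ) ≤ d := by exact_mod_cast hd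
  set e := ((d:ℝ)-1) + η
  have he : 0 < e := by simp only [e]; linarith
  refine ⟨1/e + 3 ^ d, by positivity, fun r hr hr1 R hR => ?_⟩
  have hpow : ∀ x : ℝ, 0 < x → x ≤ 1 → 1 ≤ x ^ (-((d:ℝ)-1) - η) := fun x hx hx1 =>
    Real.one_le_rpow_of_pos_of_le_one_of_nonpos hx hx1 (by linarith)
  have near : ∀ ρ, r ≤ ρ → ρ ≤ 1 → ∫ s in r..ρ, (sinh s ^ d)⁻¹ ≤ 1/e * r ^ (-((d:ℝ)-1) - η) := by
    intro ρ h1 h2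
    have := intervalIntegral.integral_le_sub_of_hasDeriv_right_of_le (a := r) (b := ρ)
      (g := fun s => -(1/e * s ^ (-e))) (g' := fun s => s ^ (-e - 1)) (φ := fun s => (sinh s ^ d)⁻¹) h1
      (ContinuousOn.neg (continuousOn_const.mul (continuousOn_id.rpow_const fun x hx => Or.inl (hr.trans_le hx.1).ne')))
      (fun x hx => by
        have hx0 : x ≠ 0 := (hr.trans hx.1).ne'
        refine (((Real.hasDerivAt_rpow_const (p := -e) (Or.inl hx0)).const_mul (1/e)).neg.congr_deriv ?_).hasDerivWithinAt
        field_simp)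
      (((contwinv d).mono fun x hx => hr.trans_le hx.1).integrableOn_compact isCompact_Icc)
      (fun x hx => by
        have hx0 : 0 < x := hr.trans hx.1
        refine (winv_near d hx0).trans ?_
        rw [← rpow_natCast, ← Real.rpow_neg hx0.le]
        exact Real.rpow_le_rpow_of_exponent_ge hx0 (hx.2.le.trans h2) (by simp only [e]; linarith))
    refine this.trans ?_
    have h3 : 0 ≤ 1/e * ρ ^ (-e) := by have : 0 < ρ := hr.trans_le h1; positivity
    have h4 : -((d:ℝ)-1) - η = -e := by simp only [e]; ring
    rw [h4]; linarith
  have hpos : 0 < r ^ (-((d:ℝ)-1) - η) := by positivity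
  rcases le_total R 1 with h | h
  · refine (near R hR h).trans ?_
    gcongr; have : (0:ℝ) < 3 ^ d := by positivity
    linarith
  · rw [← intervalIntegral.integral_add_adjacent_intervals (iiwinv d hr hr1) (iiwinv d one_pos h), add_mul]
    refine add_le_add (near 1 hr1 le_rfl) ?_
    refine (G2far hd le_rfl h).trans ?_
    have : exp (-d * 1) ≤ 1 := exp_le_one_iff.2 (by linarith)
    calc (3:ℝ) ^ d * exp (-d * 1) ≤ 3 ^ d * 1 := by gcongr
      _ ≤ _ := by gcongr; exact hpow r hr hr1

/-- radial (Strauss type) bound -/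
lemma radial_bound (hI : IsOpen I) (h : Sm I F) (hs : s ∈ I) {E G : ℝ} (hE : 0 < E) (hG : 0 < G) (hr : 0 < r)
    (hE' : ∀ R, 0 ≤ R → ∫ x in (0:ℝ)..R, Dr F x s ^ 2 * sinh x ^ d ≤ E)
    (hG' : ∀ R, r ≤ R → ∫ x in r..R, (sinh x ^ d)⁻¹ ≤ G)
    (hv : ∀ ε > 0, ∀ R, ∃ x ≥ R, F x s ≤ ε) : F r s ≤ √(E * G) := by
  refine le_of_forall_pos_le_add fun ε hε => ?_
  obtain ⟨R, hR, hFR⟩ := hv ε hε r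
  set μ := √(G / E)
  have hμ : 0 < μ := Real.sqrt_pos.2 (by positivity)
  have sm2 : Sm I (fun x s => Dr F x s ^ 2 * sinh x ^ d) := ((h.dr hI).pow 2).mul (Sm.of (by fun_prop))
  have h1 := h.ftcr hI hr.le hR hs
  have i2 : IntervalIntegrable (fun x => μ/2 * (Dr F x s ^ 2 * sinh x ^ d) + 1/(2*μ) * (sinh x ^ d)⁻¹) volume r R :=
    ((sm2.ii hr.le (hr.le.trans hR) hs).const_mul _).add ((iiwinv d hr hR).const_mul _)
  have h2 : ∫ x in r..R, - Dr F x s ≤ ∫ x in r..R, (μ/2 * (Dr F x s ^ 2 * sinh x ^ d) + 1/(2*μ) * (sinh x ^ d)⁻¹) := by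
    refine intervalIntegral.integral_mono_on hR ((h.dr hI).ii hr.le (hr.le.trans hR) hs).neg i2 fun x hx => ?_
    have hw := pow_pos (sinh_pos' (hr.trans_le hx.1)) d
    set W := sinh x ^ d
    have : 0 ≤ (μ * W * Dr F x s + 1) ^ 2 / (2 * μ * W) := by positivity
    have e : (μ * W * Dr F x s + 1) ^ 2 / (2 * μ * W) =
      μ/2 * (Dr F x s ^ 2 * W) + 1/(2*μ) * W⁻¹ + Dr F x s := by field_simp; ring
    linarith
  have h3 : ∫ x in r..R, (Dr F x s ^ 2 * sinh x ^ d) ≤ E := by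
    refine le_trans ?_ (hE' R (hr.le.trans hR))
    rw [← intervalIntegral.integral_add_adjacent_intervals (sm2.ii le_rfl hr.le hs) (sm2.ii hr.le (hr.le.trans hR) hs)]
    have : 0 ≤ ∫ x in (0:ℝ)..r, (Dr F x s ^ 2 * sinh x ^ d) :=
      intervalIntegral.integral_nonneg hr.le fun x hx => by have := sinh_nn hx.1; positivity
    linarith
  rw [intervalIntegral.integral_neg, h1, intervalIntegral.integral_add ((sm2.ii hr.le (hr.le.trans hR) hs).const_mul _)
    ((iiwinv d hr hR).const_mul _), intervalIntegral.integral_const_mul, intervalIntegral.integral_const_mul] at h2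
  have h4 := hG' R hR
  have e1 : μ/2 * E + 1/(2*μ) * G = √(E*G) := by
    have e2 : μ = √(E*G) / E := by
      simp only [μ]
      rw [eq_div_iff hE.ne', show E * G = G / E * E^2 by field_simp, Real.sqrt_mul (by positivity), Real.sqrt_sq hE.le]
    have e3 : √(E*G) ^ 2 = E * G := Real.sq_sqrt (by positivity)
    have e4 : 0 < √(E*G) := Real.sqrt_pos.2 (by positivity)
    rw [e2]; field_simp; rw [e3]; ring
  have h5 : μ/2 * ∫ x in r..R, (Dr F x s ^ 2 * sinh x ^ d) ≤ μ/2 * E := by gcongr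
  have h6 : 1/(2*μ) * ∫ x in r..R, (sinh x ^ d)⁻¹ ≤ 1/(2*μ) * G := by gcongr
  linarith
end

structure GS (d : ℕ) (q T : ℝ) (v : ℝ → ℝ → ℝ) : Prop where
  hd : 1 ≤ d
  hq : 1 < q
  hsub : ((d:ℝ) - 1) * q < d + 3
  hT : 0 < T
  sol : Sol d q 1 (Ioo 0 T) v
  en : ∀ ε ∈ Ioo 0 T, ∃ E > 0, ∀ t ∈ Ico ε T, ∀ R, 0 ≤ R →
    ∫ x in (0:ℝ)..R, Dr v x t ^ 2 * sinh x ^ d ≤ E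
  van : ∀ t ∈ Ioo 0 T, ∀ ε > 0, ∀ R, ∃ x ≥ R, v x t ≤ ε
  ext : ∀ R, ∀ ε > 0, ∃ t1 < T, ∀ t ∈ Ioo t1 T, 0 < t → ∀ r ∈ Icc 0 R, v r t ≤ ε

namespace GS
variable {d : ℕ} {q T : ℝ} {v : ℝ → ℝ → ℝ} {r s t ε : ℝ}

lemma hd' (h : GS d q T v) : (1:ℝ) ≤ d := by exact_mod_cast h.hd

/-- decay with rate -/
def Dec (d : ℕ) (T : ℝ) (v : ℝ → ℝ → ℝ) (Λ : ℝ → ℝ) (a : ℝ) : Prop :=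
  ∀ ε ∈ Ioo 0 T, ∃ C > 0, ∀ t ∈ Ico ε T, ∀ r, 0 ≤ r → v r t ≤ C * Λ t * exp (-a * r)

lemma dec0 (h : GS d q T v) : Dec d T v (fun _ => 1) ((d:ℝ)/2) := by
  intro ε hε
  obtain ⟨E, hE, hE'⟩ := h.en ε hε
  obtain ⟨t1, ht1, h1⟩ := h.ext 1 1 one_pos
  set t2 := max t1 ((ε + T)/2)
  have hεT : ε < T := hε.2
  have ht2 : t2 < T := max_lt ht1 (by linarith)
  have ht2' : ε < t2 := lt_of_lt_of_le (by linarith) (le_max_right _ _)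
  obtain ⟨C, hC⟩ := h.sol.sm.bdd (a := 0) (b := 1) (s0 := ε) (s1 := t2) le_rfl
    (fun x hx => ⟨hε.1.trans_le hx.1, hx.2.trans_lt ht2⟩)
  set C1 := (|C| + 1) * exp ((d:ℝ)/2)
  set C2 := √(E * 3 ^ d)
  refine ⟨C1 + C2, by positivity, fun t ht r hr => ?_⟩
  have htI : t ∈ Ioo 0 T := ⟨hε.1.trans_le ht.1, ht.2⟩
  have hC1 : 0 ≤ C1 := by positivity
  have hC2 : 0 ≤ C2 := by positivity
  have hex := exp_pos (-((d:ℝ)/2) * r)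
  rcases le_total r 1 with hr1 | hr1
  · have hv : v r t ≤ |C| + 1 := by
      rcases le_or_gt t t2 with h2 | h2
      · have := (le_abs_self _).trans (hC r ⟨hr, hr1⟩ t ⟨ht.1, h2⟩)
        linarith [le_abs_self C]
      · have := h1 t ⟨(le_max_left _ _).trans_lt h2, ht.2⟩ htI.1 r ⟨hr, hr1⟩
        linarith [abs_nonneg C]
    have : 1 ≤ exp ((d:ℝ)/2) * exp (-(d/2) * r) := by
      rw [← exp_add]; refine Real.one_le_exp ?_
      have := h.hd'
      nlinarith
    calc v r t ≤ (|C| + 1) * 1 := by linarith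
      _ ≤ (|C| + 1) * (exp ((d:ℝ)/2) * exp (-(d/2) * r)) := by gcongr
      _ = C1 * exp (-(d/2) * r) := by simp only [C1]; ring
      _ ≤ _ := by rw [mul_one]; gcongr; linarith
  · have := radial_bound isOpen_Ioo h.sol.sm htI hE (G := 3 ^ d * exp (-d * r)) (by positivity)
      (by linarith) (hE' t ht) (fun R hR => G2far h.hd hr1 hR) (h.van t htI)
    refine this.trans ?_
    rw [← mul_assoc, Real.sqrt_mul (by positivity), Real.sqrt_eq_rpow (exp _), ← exp_mul,
      show -(d:ℝ) * r * (1/2) = -((d:ℝ)/2) * r by ring, mul_one]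
    gcongr
    exact le_add_of_nonneg_left hC1

lemma unif (h : GS d q T v) {t0 : ℝ} (ht0 : t0 ∈ Ioo 0 T) (hε : 0 < ε) :
    ∃ R0, 0 < R0 ∧ ∀ R ≥ R0, ∀ t ∈ Ico t0 T, v R t ≤ ε := by
  obtain ⟨C, hC, hC'⟩ := h.dec0 t0 ht0
  have hdp : 0 < (d:ℝ)/2 := by linarith [h.hd']
  have : Tendsto (fun r => C * 1 * exp (-(d/2) * r)) atTop (𝓝 (C * 1 * 0)) := by
    refine Tendsto.const_mul _ (Real.tendsto_exp_atBot.comp ?_)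
    exact tendsto_id.const_mul_atTop_of_neg (by linarith)
  rw [mul_zero] at this
  obtain ⟨R0, hR0⟩ := eventually_atTop.1 (this.eventually (gt_mem_nhds hε))
  refine ⟨max R0 1, by positivity, fun R hR t ht => ?_⟩
  exact (hC' t ht R (by linarith [le_max_right R0 1])).trans (hR0 R ((le_max_left _ _).trans hR)).le

/-- Benilan--Crandall -/
lemma bc (h : GS d q T v) {t0 : ℝ} (h0 : 0 < t0) (h1 : t0 < s) (h2 : s ≤ t) (h3 : t < T) (hr : 0 ≤ r) :
    v r t ≤ ((t - t0) / (s - t0)) ^ (1/(q-1)) * v r s := by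
  set μ := (t - t0) / (s - t0)
  have hst : 0 < s - t0 := by linarith
  have hμ : 1 ≤ μ := by rw [le_div_iff₀ hst]; linarith
  have hμ0 : 0 < μ := by linarith
  have hq := h.hq
  set κ := μ ^ (1/(q-1))
  have hκ : 0 < κ := by positivity
  have hκ1 : 1 ≤ κ := Real.one_le_rpow hμ (by have : 0 < q - 1 := by linarith
                                              positivity)
  have hsc := h.sol.scale isOpen_Ioo (κ := κ) (θ := μ) (t0 := t0 - μ * t0) hκ
  have hc : κ ^ (1-q) * μ * 1 = 1 := by
    have : κ ^ (1-q) = μ⁻¹ := by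
      simp only [κ]
      rw [← rpow_mul hμ0.le, ← Real.rpow_neg_one]
      congr 1; have : q - 1 ≠ 0 := by linarith
      field_simp; ring
    rw [this]; field_simp
  rw [hc] at hsc
  set J : Set ℝ := Ioo 0 T ∩ ((fun s => t0 - μ * t0 + μ * s) ⁻¹' Ioo 0 T)
  have hJ : IsOpen J := isOpen_Ioo.inter (isOpen_Ioo.preimage (by fun_prop))
  have e : t0 - μ * t0 + μ * s = t := by
    have : μ * (s - t0) = t - t0 := by simp only [μ]; field_simp
    linarith
  have hrange : ∀ x ∈ Icc t0 s, t0 ≤ t0 - μ * t0 + μ * x ∧ t0 - μ * t0 + μ * x ≤ t := fun x hx =>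
    ⟨by nlinarith [hx.1], by nlinarith [hx.2]⟩
  have key := comparison hJ hq h.hd (hsc.mono inter_subset_right) (h.sol.mono inter_subset_left) h1.le
    (fun x hx => ⟨⟨by linarith [hx.1], by linarith [hx.2]⟩, ⟨by linarith [(hrange x hx).1], by linarith [(hrange x hx).2]⟩⟩)
    (fun r hr => by
      have hp := h.sol.pos r hr t0 ⟨h0, by linarith⟩
      have : t0 - μ * t0 + μ * t0 = t0 := by ring
      rw [this]
      exact mul_le_of_le_one_left hp.le (inv_le_one_of_one_le₀ hκ1))
    (fun ε hε => by
      obtain ⟨R0, hR0, hR⟩ := h.unif ⟨h0, by linarith⟩ hε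
      refine ⟨R0, fun R hRR t ht => ?_⟩
      have hh := hrange t ht
      have hp := h.sol.pos R (hR0.le.trans hRR) (t0 - μ * t0 + μ * t) ⟨by linarith, by linarith⟩
      refine (mul_le_of_le_one_left hp.le (inv_le_one_of_one_le₀ hκ1)).trans (hR R hRR _ ⟨hh.1, by linarith⟩)) r hr
  rw [e] at key
  rwa [inv_mul_le_iff₀ hκ] at key

/-- simplified version with uniform constant -/
lemma bc' (h : GS d q T v) (hε : 0 < ε) (h1 : ε ≤ s) (h2 : s ≤ t) (h3 : t < T) (hr : 0 ≤ r) :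
    v r t ≤ (2 * T / ε) ^ (1/(q-1)) * v r s := by
  have hq := h.hq
  refine (h.bc (t0 := ε/2) (by linarith) (by linarith) h2 h3 hr).trans ?_
  have := h.sol.pos r hr s ⟨by linarith, by linarith⟩
  have hs : 0 < s - ε/2 := by linarith
  have : 0 ≤ 1/(q-1) := by have : 0 < q - 1 := by linarith
                           positivity
  have h5 : (t - ε/2) / (s - ε/2) ≤ 2 * T / ε := by
    rw [div_le_div_iff₀ hs hε]; nlinarith
  exact mul_le_mul_of_nonneg_right (rpow_le_rpow (div_nonneg (by linarith) hs.le) h5 this)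
    (h.sol.pos r hr s ⟨by linarith, by linarith⟩).le

/-- upper bound for the time derivative -/
lemma dsle (h : GS d q T v) (hε : 0 < ε) (h1 : ε ≤ t) (h3 : t < T) (hr : 0 ≤ r) :
    Ds v r t ≤ 2 / ((q-1) * ε) * v r t := by
  have hq := h.hq
  have hq1 : 0 < q - 1 := by linarith
  set t0 := ε/2
  have htI : t ∈ Ioo 0 T := ⟨by linarith, h3⟩
  have hp := h.sol.pos r hr t htI
  have htt : 0 < t - t0 := by simp only [t0]; linarith
  have d1 := (h.sol.sm.hasDs isOpen_Ioo hr htI)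
  have d2 : HasDerivAt (fun τ => ((τ - t0)/(t - t0)) ^ (1/(q-1)) * v r t) (1/(q-1) * (1/(t-t0)) * v r t) t := by
    have := ((((hasDerivAt_id t).sub_const t0).div_const (t-t0)).rpow_const (p := 1/(q-1))
      (Or.inl (by simp; exact htt.ne'))).mul_const (v r t)
    refine this.congr_deriv ?_
    simp only [id, div_self htt.ne', Real.one_rpow]; ring
  have d3 := (d2.sub d1).hasDerivWithinAt (s := Ioi t)
  rw [hasDerivWithinAt_iff_tendsto_slope' (by simp)] at d3
  have : 0 ≤ 1/(q-1) * (1/(t-t0)) * v r t - Ds v r t := by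
    refine ge_of_tendsto d3 ?_
    filter_upwards [Ioo_mem_nhdsGT h3] with τ hτ
    rw [slope_def_field]
    refine div_nonneg ?_ (by linarith [hτ.1])
    have := h.bc (t0 := t0) (by simp only [t0]; linarith) (by linarith) hτ.1.le hτ.2 hr
    simp only [Pi.sub_apply, div_self htt.ne', Real.one_rpow]
    linarith
  refine (sub_nonneg.1 this).trans ?_
  refine mul_le_mul_of_nonneg_right ?_ hp.le
  have h5 : ε ≤ 2 * (t - t0) := by simp only [t0]; linarith
  rw [show 1/(q-1) * (1/(t-t0)) = 1 / ((q-1) * (t-t0)) by field_simp,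
    div_le_div_iff₀ (by positivity) (by positivity)]
  nlinarith
end GS

namespace GS
variable {d : ℕ} {q T : ℝ} {v : ℝ → ℝ → ℝ} {r s t ε : ℝ}

lemma fluxu (h : GS d q T v) (hr : 0 ≤ r) (ht : t ∈ Ioo 0 T) :
    ∫ x in (0:ℝ)..r, sinh x ^ d * Ds (fun r s => v r s ^ q) x t = sinh r ^ d * Dr v r t :=
  h.sol.sm.flux isOpen_Ioo h.hd (h.sol.smu.ds isOpen_Ioo)
    (fun r hr s hs => by rw [h.sol.equ isOpen_Ioo hr hs, one_mul]) hr ht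

/-- pair lemma -/
lemma pair0 (h : GS d q T v) {t' b R : ℝ} (h0 : 0 < t') (h1 : t' < t) (h2 : t < T) (hr : 0 < r) {B : ℝ → ℝ}
    (hB : ContinuousOn B (Ioi 0))
    (hrR : r ≤ R) (hU : ∀ ρ, r ≤ ρ → ρ ≤ R → ∫ x in (0:ℝ)..ρ, sinh x ^ d * v x t' ^ q ≤ sinh ρ ^ d * B ρ)
    (hb : ∫ x in r..R, B x ≤ b) :
    ∫ s in t'..t, v r s ≤ (∫ s in t'..t, v R s) + b := by
  have hI : IsOpen (Ioo 0 T) := isOpen_Ioo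
  have hsub : Icc t' t ⊆ Ioo 0 T := fun x hx => ⟨h0.trans_le hx.1, hx.2.trans_lt h2⟩
  have hsub' : uIcc t' t ⊆ Ioo 0 T := by rwa [uIcc_of_le h1.le]
  set V : ℝ → ℝ := fun r => ∫ s in t'..t, v r s
  have hV : ∀ ρ > 0, HasDerivAt V (∫ s in t'..t, Dr v ρ s) ρ := fun ρ hρ =>
    h.sol.sm.hasIntr hI hρ hsub h1.le
  have smw : Sm (Ioo 0 T) (fun x s => sinh x ^ d * v x s ^ q) := (Sm.of (by fun_prop)).mul h.sol.smu
  have key : ∀ ρ, r ≤ ρ → ρ ≤ R → -B ρ ≤ ∫ s in t'..t, Dr v ρ s := by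
    intro ρ hρ hρR
    have hρ0 := hr.trans_le hρ
    have hw := pow_pos (sinh_pos' hρ0) d
    have e1 : ∀ s ∈ uIcc t' t, HasDerivAt (fun s => ∫ x in (0:ℝ)..ρ, sinh x ^ d * v x s ^ q)
        (sinh ρ ^ d * Dr v ρ s) s := by
      intro s hs
      refine (smw.hasInt hI le_rfl hρ0.le (hsub' hs)).congr_deriv ?_
      rw [← h.fluxu hρ0.le (hsub' hs)]
      refine intervalIntegral.integral_congr fun x hx => ?_
      rw [uIcc_of_le hρ0.le] at hx
      refine Ds_eq ?_
      exact (h.sol.smu.hasDs hI hx.1 (hsub' hs)).const_mul _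
    have e2 := intervalIntegral.integral_eq_sub_of_hasDerivAt e1
      (((h.sol.sm.dr hI).iis hρ0.le hsub').const_mul _)
    rw [intervalIntegral.integral_const_mul] at e2
    have e3 : 0 ≤ ∫ x in (0:ℝ)..ρ, sinh x ^ d * v x t ^ q :=
      intervalIntegral.integral_nonneg hρ0.le fun x hx => by
        have := sinh_nn hx.1
        have := h.sol.pos x hx.1 t ⟨h0.trans h1, h2⟩
        positivity
    have e4 := hU ρ hρ hρR
    nlinarith
  have hc : ∀ x ∈ uIcc r R, 0 < x := fun x hx => by rw [uIcc_of_le hrR] at hx; exact hr.trans_le hx.1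
  have hcont : ContinuousOn (fun ρ => ∫ s in t'..t, Dr v ρ s) (uIcc r R) := fun x hx =>
    ((h.sol.sm.dr hI).hasIntr hI (hc x hx) hsub h1.le).continuousAt.continuousWithinAt
  have e1 := intervalIntegral.integral_eq_sub_of_hasDerivAt (fun x hx => hV x (hc x hx)) hcont.intervalIntegrable
  have e2 : ∫ x in r..R, -B x ≤ ∫ x in r..R, ∫ s in t'..t, Dr v x s :=
    intervalIntegral.integral_mono_on hrR ((hB.mono (fun x hx => hc x hx)).intervalIntegrable).neg hcont.intervalIntegrable
      fun x hx => key x hx.1 hx.2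
  rw [intervalIntegral.integral_neg] at e2
  linarith
lemma pair (h : GS d q T v) {t' b : ℝ} (h0 : 0 < t') (h1 : t' < t) (h2 : t < T) (hr : 0 < r) {B : ℝ → ℝ}
    (hB : ContinuousOn B (Ioi 0))
    (hU : ∀ ρ, r ≤ ρ → ∫ x in (0:ℝ)..ρ, sinh x ^ d * v x t' ^ q ≤ sinh ρ ^ d * B ρ)
    (hb : ∀ R, r ≤ R → ∫ x in r..R, B x ≤ b) :
    ∫ s in t'..t, v r s ≤ b := by
  have hsub' : uIcc t' t ⊆ Ioo 0 T := by
    rw [uIcc_of_le h1.le]; exact fun x hx => ⟨h0.trans_le hx.1, hx.2.trans_lt h2⟩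
  refine le_of_forall_pos_le_add fun δ hδ => ?_
  obtain ⟨R0, hR0, hR⟩ := h.unif ⟨h0, h1.trans h2⟩ (ε := δ / (t - t')) (div_pos hδ (by linarith))
  set R := max R0 r
  have e1 := h.pair0 h0 h1 h2 hr hB (le_max_right R0 r) (fun ρ hρ _ => hU ρ hρ) (hb R (le_max_right _ _))
  have e2 : ∫ s in t'..t, v R s ≤ ∫ s in t'..t, δ / (t - t') :=
    intervalIntegral.integral_mono_on h1.le (h.sol.sm.iis (hR0.le.trans (le_max_left _ _)) hsub')
      intervalIntegrable_const fun x hx => hR R (le_max_left _ _) x ⟨hx.1, hx.2.trans_lt h2⟩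
  rw [intervalIntegral.integral_const, smul_eq_mul, mul_div_cancel₀ _ (by linarith : t - t' ≠ 0)] at e2
  linarith

lemma pair' (h : GS d q T v) {t' b : ℝ} (hε : 0 < ε) (h0 : ε ≤ t') (h1 : t' < t) (h2 : t < T) (hr : 0 < r) {B : ℝ → ℝ}
    (hB : ContinuousOn B (Ioi 0))
    (hU : ∀ ρ, r ≤ ρ → ∫ x in (0:ℝ)..ρ, sinh x ^ d * v x t' ^ q ≤ sinh ρ ^ d * B ρ)
    (hb : ∀ R, r ≤ R → ∫ x in r..R, B x ≤ b) :
    (t - t') * v r t ≤ (2 * T / ε) ^ (1/(q-1)) * b := by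
  have hT := h.hT
  have hsub' : uIcc t' t ⊆ Ioo 0 T := by
    rw [uIcc_of_le h1.le]; exact fun x hx => ⟨by linarith [hx.1], hx.2.trans_lt h2⟩
  have e1 := h.pair (by linarith) h1 h2 hr hB hU hb
  have e2 : ∫ s in t'..t, v r t ≤ ∫ s in t'..t, (2 * T / ε) ^ (1/(q-1)) * v r s :=
    intervalIntegral.integral_mono_on h1.le intervalIntegrable_const ((h.sol.sm.iis hr.le hsub').const_mul _)
      fun x hx => h.bc' hε (h0.trans hx.1) hx.2 h2 hr.le
  rw [intervalIntegral.integral_const, smul_eq_mul, intervalIntegral.integral_const_mul] at e2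
  refine e2.trans ?_
  have : 0 ≤ (2 * T / ε) ^ (1/(q-1)) := by positivity
  gcongr

def Adm (q T : ℝ) (Λ : ℝ → ℝ) : Prop :=
  (∀ t ∈ Ioo 0 T, 0 < Λ t) ∧ ∀ ε ∈ Ioo 0 T, ∃ C > 0, ∀ t ∈ Ico ε T, ∃ τ > 0, ε / 2 ≤ t - τ ∧
    Λ (t - τ) ≤ C * Λ t ∧ Λ t ^ (q-1) ≤ C * τ

lemma adm_one (h : GS d q T v) : Adm q T (fun _ => 1) := by
  refine ⟨fun _ _ => one_pos, fun ε hε => ⟨1 + 2/ε, by have := hε.1; positivity, fun t ht => ⟨ε/2, by linarith [hε.1], by linarith [ht.1], ?_, ?_⟩⟩⟩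
  · have := hε.1
    have : 0 ≤ 2/ε := by positivity
    linarith
  · have := hε.1
    rw [Real.one_rpow, add_mul]; field_simp; linarith

lemma adm_rate (h : GS d q T v) : Adm q T (fun t => (T - t) ^ (1/(q-1))) := by
  have hq : 0 < q - 1 := by linarith [h.hq]
  refine ⟨fun t ht => rpow_pos_of_pos (by linarith [ht.2]) _, fun ε hε => ?_⟩
  have hT := h.hT
  have hε0 := hε.1
  set κ := ε / (2 * T)
  have hκ : 0 < κ := by positivity
  have hκ1 : κ ≤ 1 := by
    rw [div_le_one (by positivity)]; linarith [hε.2]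
  have h2 : 0 < (2:ℝ) ^ (1/(q-1)) := by positivity
  refine ⟨2 ^ (1/(q-1)) + 1/κ, by positivity, fun t ht => ⟨κ * (T - t), by have := ht.2; exact mul_pos hκ (by linarith), ?_, ?_, ?_⟩⟩
  · have : κ * (T - t) ≤ ε / 2 := by
      have : κ * T = ε / 2 := by simp only [κ]; field_simp
      nlinarith [ht.1]
    linarith [ht.1]
  · have hl : 0 < T - t := by linarith [ht.2]
    have : (T - (t - κ * (T - t))) ^ (1/(q-1)) ≤ (2 * (T - t)) ^ (1/(q-1)) := by
      refine rpow_le_rpow (by nlinarith) (by nlinarith) (by positivity)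
    refine this.trans ?_
    rw [mul_rpow (by norm_num) hl.le]
    gcongr
    have : 0 < 1/κ := by positivity
    linarith
  · have hl : 0 < T - t := by linarith [ht.2]
    simp only
    rw [← rpow_mul hl.le, one_div_mul_cancel hq.ne', rpow_one, add_mul]
    have : 1/κ * (κ * (T - t)) = T - t := by field_simp
    rw [this]
    have : 0 ≤ 2 ^ (1/(q-1)) * (κ * (T-t)) := by positivity
    linarith

lemma dec_step (h : GS d q T v) {Λ : ℝ → ℝ} {a a' : ℝ} (hΛ : Adm q T Λ) (hD : Dec d T v Λ a)
    (ha' : 0 < a') (had : a' ≤ d) (haa : a' < q * a) : Dec d T v Λ a' := by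
  intro ε hε
  have hT := h.hT
  have hq := h.hq
  have hε0 := hε.1
  obtain ⟨C, hC, hC'⟩ := hΛ.2 ε hε
  obtain ⟨C0, hC0, hC0'⟩ := hD (ε/2) ⟨by linarith, by linarith [hε.2]⟩
  set D := (2 * T / (ε/2)) ^ (1/(q-1))
  have hDp : 0 < D := by positivity
  set γ := q * a - a'
  have hγ : 0 < γ := by simp only [γ]; linarith
  set C1 := D * (3 ^ d * ((C0 * C) ^ q * C) / (γ * a'))
  set C2 := C0 * exp |a' - a|
  refine ⟨C1 + C2, by positivity, fun t ht r hr => ?_⟩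
  have htI : t ∈ Ioo 0 T := ⟨by linarith [ht.1], ht.2⟩
  have hL := hΛ.1 t htI
  have hC1 : 0 < C1 := by positivity
  have hC2 : 0 < C2 := by positivity
  rcases le_total r 1 with hr1 | hr1
  · have := hC0' t ⟨by linarith [ht.1], ht.2⟩ r hr
    refine this.trans ?_
    have e : exp (-a * r) ≤ exp |a' - a| * exp (-a' * r) := by
      rw [← exp_add]; gcongr
      nlinarith [le_abs_self (a' - a), abs_nonneg (a' - a)]
    calc C0 * Λ t * exp (-a * r) ≤ C0 * Λ t * (exp |a' - a| * exp (-a' * r)) := by gcongr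
      _ = C2 * Λ t * exp (-a' * r) := by simp only [C2]; ring
      _ ≤ _ := by gcongr; linarith
  · obtain ⟨τ, hτ, hτ1, hτ2, hτ3⟩ := hC' t ht
    set t' := t - τ
    have ht'I : t' ∈ Ioo 0 T := ⟨by linarith, by simp only [t']; linarith [ht.2]⟩
    have hL' := hΛ.1 t' ht'I
    set K := C0 * Λ t'
    have hK : 0 < K := by positivity
    have hKq : K ^ q ≤ (C0 * C) ^ q * C * τ * Λ t := by
      calc K ^ q ≤ (C0 * C * Λ t) ^ q := by
            refine rpow_le_rpow hK.le ?_ (by linarith)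
            simp only [K]; nlinarith
        _ = (C0 * C) ^ q * (Λ t ^ (q-1) * Λ t) := by
            rw [mul_rpow (by positivity) hL.le, ← rpow_add_one hL.ne']; ring_nf
        _ ≤ (C0 * C) ^ q * ((C * τ) * Λ t) := by gcongr
        _ = _ := by ring
    have hU : ∀ ρ, r ≤ ρ → ∫ x in (0:ℝ)..ρ, sinh x ^ d * v x t' ^ q ≤
        sinh ρ ^ d * (3 ^ d * K ^ q / γ * exp (-a' * ρ)) := by
      intro ρ hρ
      have hρ0 : 0 ≤ ρ := by linarith
      have e1 : ∫ x in (0:ℝ)..ρ, sinh x ^ d * v x t' ^ q ≤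
          ∫ x in (0:ℝ)..ρ, K ^ q * exp ((d - a') * ρ) * exp (-γ * x) := by
        refine intervalIntegral.integral_mono_on hρ0
          (((Sm.of (F := fun x _ => sinh x ^ d) (by fun_prop)).mul h.sol.smu).ii le_rfl hρ0 ht'I)
          ((by fun_prop : Continuous fun x : ℝ => K ^ q * exp ((d - a') * ρ) * exp (-γ * x)).intervalIntegrable _ _) fun x hx => ?_
        have hp := h.sol.pos x hx.1 t' ht'I
        have h1 := hC0' t' ⟨hτ1, ht'I.2⟩ x hx.1
        have h2 : v x t' ^ q ≤ K ^ q * exp (-a * x * q) := by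
          rw [exp_mul, ← mul_rpow hK.le (exp_pos _).le]
          exact rpow_le_rpow hp.le h1 (by linarith)
        calc sinh x ^ d * v x t' ^ q ≤ exp (d * x) * (K ^ q * exp (-a * x * q)) := by
              have := sinh_nn hx.1
              exact mul_le_mul (w_le_exp d hx.1) h2 (by positivity) (by positivity)
          _ = K ^ q * (exp ((d - a') * x) * exp (-γ * x)) := by
              rw [← exp_add, mul_left_comm, ← exp_add]; simp only [γ]; ring_nf
          _ ≤ K ^ q * (exp ((d - a') * ρ) * exp (-γ * x)) := by
              have : ((d:ℝ) - a') * x ≤ (d - a') * ρ := mul_le_mul_of_nonneg_left hx.2 (by linarith)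
              gcongr
          _ = _ := by ring
      rw [intervalIntegral.integral_const_mul] at e1
      have e2 := exp_int hγ hρ0
      rw [mul_zero, Real.exp_zero] at e2
      have e3 := w_lower1 d (hr1.trans hρ)
      have e4 : exp (d * ρ) ≤ 3 ^ d * sinh ρ ^ d := by
        rw [one_div, inv_pow] at e3
        rwa [inv_mul_le_iff₀ (by positivity)] at e3
      calc _ ≤ K ^ q * exp ((d - a') * ρ) * (1/γ) := e1.trans (by gcongr)
        _ = K ^ q / γ * exp (-a' * ρ) * exp (d * ρ) := by
            rw [mul_assoc (K ^ q / γ), ← exp_add, show (d - a') * ρ = -a' * ρ + d * ρ by ring]; ring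
        _ ≤ K ^ q / γ * exp (-a' * ρ) * (3 ^ d * sinh ρ ^ d) := by gcongr
        _ = _ := by ring
    have hb : ∀ R, r ≤ R → ∫ x in r..R, 3 ^ d * K ^ q / γ * exp (-a' * x) ≤
        3 ^ d * K ^ q / γ * (exp (-a' * r) / a') := by
      intro R hR
      rw [intervalIntegral.integral_const_mul]
      gcongr; exact exp_int ha' hR
    have key := h.pair' (ε := ε/2) (by linarith) hτ1 (by simp only [t']; linarith) ht.2 (by linarith) (by fun_prop) hU hb
    rw [show t - t' = τ by simp only [t']; ring] at key
    have k2 : τ * v r t ≤ τ * (C1 * Λ t * exp (-a' * r)) := by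
      calc τ * v r t ≤ _ := key
        _ ≤ D * (3 ^ d * ((C0 * C) ^ q * C * τ * Λ t) / γ * (exp (-a' * r) / a')) := by
            simp only [D]; gcongr
        _ = _ := by simp only [C1]; field_simp
    have k3 := le_of_mul_le_mul_left k2 hτ
    refine k3.trans ?_
    gcongr; linarith

lemma dec_full (h : GS d q T v) {Λ : ℝ → ℝ} (hΛ : Adm q T Λ) (hD : Dec d T v Λ ((d:ℝ)/2)) : Dec d T v Λ d := by
  have hd := h.hd'
  have hq := h.hq
  set μ := 1 + (q-1)/2
  have hμ : 1 < μ := by simp only [μ]; linarith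
  have hμq : μ < q := by simp only [μ]; linarith
  have key : ∀ n : ℕ, Dec d T v Λ (min d (μ ^ n * ((d:ℝ)/2))) := by
    intro n
    induction n with
    | zero => rw [pow_zero, one_mul, min_eq_right (by linarith)]; exact hD
    | succ n ih =>
      have hp : 0 < μ ^ n * ((d:ℝ)/2) := by positivity
      refine h.dec_step hΛ ih (lt_min (by linarith) (by positivity)) (min_le_left _ _) ?_
      rcases le_total (d:ℝ) (μ ^ n * ((d:ℝ)/2)) with h1 | h1
      · rw [min_eq_left h1]
        exact (min_le_left _ _).trans_lt (by nlinarith)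
      · rw [min_eq_right h1]
        refine (min_le_right _ _).trans_lt ?_
        rw [pow_succ]; nlinarith
  obtain ⟨n, hn⟩ := pow_unbounded_of_one_lt 2 hμ
  have := key n
  rwa [min_eq_left (by nlinarith)] at this

lemma dec1 (h : GS d q T v) : Dec d T v (fun _ => 1) d := h.dec_full h.adm_one h.dec0

end GS

namespace GS
variable {d : ℕ} {q T : ℝ} {v : ℝ → ℝ → ℝ} {r s t ε : ℝ}

lemma dsu (h : GS d q T v) (hr : 0 ≤ r) (ht : t ∈ Ioo 0 T) :
    Ds (fun r s => v r s ^ q) r t = q * v r t ^ (q-1) * Ds v r t := by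
  rw [Ds_rpow isOpen_Ioo h.sol.sm h.sol.pos q hr ht]

lemma dsu_le (h : GS d q T v) (hε : 0 < ε) (h1 : ε ≤ t) (h3 : t < T) (hr : 0 ≤ r) :
    Ds (fun r s => v r s ^ q) r t ≤ q * (2 / ((q-1) * ε)) * v r t ^ q := by
  have htI : t ∈ Ioo 0 T := ⟨by linarith, h3⟩
  have hp := h.sol.pos r hr t htI
  have := h.dsle hε h1 h3 hr
  have hq := h.hq
  rw [h.dsu hr htI]
  calc q * v r t ^ (q-1) * Ds v r t ≤ q * v r t ^ (q-1) * (2 / ((q-1) * ε) * v r t) := by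
        have : 0 < q := by linarith
        gcongr
    _ = q * (2 / ((q-1) * ε)) * (v r t ^ (q-1) * v r t) := by ring
    _ = _ := by rw [← rpow_add_one hp.ne']; ring_nf

lemma fluxu' (h : GS d q T v) {x y : ℝ} (hx : 0 ≤ x) (hxy : x ≤ y) (ht : t ∈ Ioo 0 T) :
    ∫ z in x..y, sinh z ^ d * Ds (fun r s => v r s ^ q) z t =
      sinh y ^ d * Dr v y t - sinh x ^ d * Dr v x t := by
  rw [← h.fluxu (hx.trans hxy) ht, ← h.fluxu hx ht, eq_sub_iff_add_eq', intervalIntegral.integral_add_adjacent_intervals]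
  all_goals
    refine ((Sm.of (F := fun x _ => sinh x ^ d) (by fun_prop)).mul (h.sol.smu.ds isOpen_Ioo)).ii ?_ ?_ ht <;> linarith

lemma flux_bd (h : GS d q T v) {Λ : ℝ → ℝ} (hΛ : ∀ t ∈ Ioo 0 T, 0 < Λ t) {M : ℝ} (hM : 0 < M)
    (hΛq : ∀ t ∈ Ioo 0 T, Λ t ^ q ≤ M * Λ t) (hD : Dec d T v Λ d) :
    ∀ ε ∈ Ioo 0 T, ∃ C > 0, ∀ t ∈ Ico ε T, ∀ r, 0 ≤ r → |sinh r ^ d * Dr v r t| ≤ C * Λ t := by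
  intro ε hε
  obtain ⟨C0, hC0, hC0'⟩ := hD ε hε
  have hd := h.hd'
  have hq := h.hq
  have hε0 := hε.1
  set γ := (q-1) * d
  have hγ : 0 < γ := mul_pos (by linarith) (by linarith)
  have hq1 : 0 < q - 1 := by linarith
  set K := q * (2 / ((q-1) * ε)) * C0 ^ q * M / γ
  have hK : 0 < K := by positivity
  refine ⟨K + C0 * exp d, by positivity, fun t ht r hr => ?_⟩
  have htI : t ∈ Ioo 0 T := ⟨by linarith [ht.1], ht.2⟩
  have hL := hΛ t htI
  have key : ∀ x y, 0 ≤ x → x ≤ y → sinh y ^ d * Dr v y t - sinh x ^ d * Dr v x t ≤ K * Λ t := by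
    intro x y hx hxy
    rw [← h.fluxu' hx hxy htI]
    have e1 : ∫ z in x..y, sinh z ^ d * Ds (fun r s => v r s ^ q) z t ≤
        ∫ z in x..y, (q * (2 / ((q-1) * ε)) * C0 ^ q * (M * Λ t)) * exp (-γ * z) := by
      refine intervalIntegral.integral_mono_on hxy
        (((Sm.of (F := fun x _ => sinh x ^ d) (by fun_prop)).mul (h.sol.smu.ds isOpen_Ioo)).ii hx (hx.trans hxy) htI)
        ((by fun_prop : Continuous fun z : ℝ => (q * (2 / ((q-1) * ε)) * C0 ^ q * (M * Λ t)) * exp (-γ * z)).intervalIntegrable _ _) fun z hz => ?_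
      have hz0 := hx.trans hz.1
      have hp := h.sol.pos z hz0 t htI
      have h2 : v z t ^ q ≤ C0 ^ q * (M * Λ t) * exp (-d * z * q) := by
        calc v z t ^ q ≤ (C0 * Λ t * exp (-d * z)) ^ q := rpow_le_rpow hp.le (hC0' t ht z hz0) (by linarith)
          _ = C0 ^ q * Λ t ^ q * exp (-d * z * q) := by
            rw [mul_rpow (by positivity) (by positivity), mul_rpow hC0.le hL.le, exp_mul (-d * z) q]
          _ ≤ _ := by have := hΛq t htI; gcongr
      have h3 := h.dsu_le hε0 ht.1 ht.2 hz0
      have hs := sinh_nn hz0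
      calc _ ≤ sinh z ^ d * (q * (2 / ((q-1) * ε)) * (C0 ^ q * (M * Λ t) * exp (-d * z * q))) := by
            gcongr; exact h3.trans (by gcongr)
        _ ≤ exp (d * z) * (q * (2 / ((q-1) * ε)) * (C0 ^ q * (M * Λ t) * exp (-d * z * q))) := by
            gcongr; exact w_le_exp d hz0
        _ = (q * (2 / ((q-1) * ε)) * C0 ^ q * (M * Λ t)) * (exp (d * z) * exp (-d * z * q)) := by ring
        _ = _ := by rw [← exp_add]; simp only [γ]; ring_nf
    refine e1.trans ?_
    rw [intervalIntegral.integral_const_mul]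
    have e2 := exp_int hγ hxy
    calc _ ≤ (q * (2 / ((q-1) * ε)) * C0 ^ q * (M * Λ t)) * (1/γ) := by
          gcongr
          refine e2.trans ?_
          gcongr
          exact exp_le_one_iff.2 (by nlinarith)
      _ = _ := by simp only [K]; ring
  have hKL : 0 < K * Λ t := by positivity
  have hCL : 0 < C0 * exp d * Λ t := by positivity
  rw [abs_le, add_mul]
  constructor
  · by_contra hcon
    push Not at hcon
    set Fr := sinh r ^ d * Dr v r t
    have e1 := h.sol.sm.ftcr isOpen_Ioo hr (by linarith : r ≤ r + 1) htI
    have hp := h.sol.pos (r+1) (by linarith) t htI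
    have hb := hC0' t ht r hr
    set g := C0 * Λ t * exp (-d * r)
    have hg : 0 < g := by positivity
    have e2 : ∫ z in r..(r+1), Dr v z t ≤ ∫ z in r..(r+1), -g := by
      refine intervalIntegral.integral_mono_on_of_le_Ioo (by linarith) ((h.sol.sm.dr isOpen_Ioo).ii hr (by linarith) htI)
        intervalIntegrable_const fun z hz => ?_
      have h1 := key r z hr hz.1.le
      have hz0 : 0 < z := hr.trans_lt hz.1
      have hw := pow_pos (sinh_pos' hz0) d
      have hw2 : sinh z ^ d ≤ exp (d * (r+1)) :=
        (w_le_exp d hz0.le).trans (exp_le_exp.2 (by nlinarith [hz.2]))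
      have h2 : sinh z ^ d * Dr v z t ≤ - (C0 * exp d * Λ t) := by linarith
      have h3 : sinh z ^ d * g ≤ C0 * exp d * Λ t := by
        calc sinh z ^ d * g ≤ exp (d * (r+1)) * g := by gcongr
          _ = C0 * Λ t * (exp (d * (r+1)) * exp (-d * r)) := by simp only [g]; ring
          _ = _ := by rw [← exp_add]; ring_nf
      have h4 : sinh z ^ d * Dr v z t ≤ sinh z ^ d * (-g) := by linarith
      exact le_of_mul_le_mul_left h4 hw
    rw [intervalIntegral.integral_const, smul_eq_mul] at e2
    linarith
  · have := key 0 r le_rfl hr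
    rw [sinh_zero, zero_pow (by have := h.hd; omega), zero_mul] at this
    linarith

end GS

lemma le_of_der {g g' : ℝ → ℝ} {a b c : ℝ} (hab : a ≤ b) (h : ∀ s ∈ Icc a b, HasDerivAt g (g' s) s)
    (hc : ∀ s ∈ Icc a b, g' s ≤ c) : g b ≤ g a + c * (b - a) := by
  have := Convex.image_sub_le_mul_sub_of_deriv_le (convex_Icc a b)
    (fun x hx => (h x hx).continuousAt.continuousWithinAt)
    (fun x hx => (h x (interior_subset hx)).differentiableAt.differentiableWithinAt)
    (C := c) (fun x hx => by rw [(h x (interior_subset hx)).deriv]; exact hc x (interior_subset hx))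
    a ⟨le_rfl, hab⟩ b ⟨hab, le_rfl⟩ hab
  linarith

lemma Ds_c {f : ℝ → ℝ} {r s : ℝ} : Ds (fun x _ => f x) r s = 0 := Ds_eq (hasDerivAt_const _ _)

namespace GS
variable {d : ℕ} {q T : ℝ} {v : ℝ → ℝ → ℝ} {r s t ε R : ℝ}

noncomputable def AR (d : ℕ) (q : ℝ) (v : ℝ → ℝ → ℝ) (R t : ℝ) : ℝ := ∫ x in (0:ℝ)..R, v x t ^ (q+1) * sinh x ^ d
noncomputable def ER (d : ℕ) (v : ℝ → ℝ → ℝ) (R t : ℝ) : ℝ := ∫ x in (0:ℝ)..R, Dr v x t ^ 2 * sinh x ^ d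
noncomputable def XR (d : ℕ) (q : ℝ) (v : ℝ → ℝ → ℝ) (R t : ℝ) : ℝ :=
  ∫ x in (0:ℝ)..R, sinh x ^ d * Ds (fun r s => v r s ^ q) x t * v x t
noncomputable def DR (d : ℕ) (q : ℝ) (v : ℝ → ℝ → ℝ) (R t : ℝ) : ℝ :=
  ∫ x in (0:ℝ)..R, sinh x ^ d * Ds (fun r s => v r s ^ q) x t * Ds v x t

lemma smw (I : Set ℝ) (d : ℕ) : Sm I (fun x _ => sinh x ^ d) := Sm.of (by fun_prop)

lemma ibp (h : GS d q T v) {g : ℝ → ℝ → ℝ} (hg : Sm (Ioo 0 T) g) (hR : 0 ≤ R) (ht : t ∈ Ioo 0 T) :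
    (∫ x in (0:ℝ)..R, sinh x ^ d * Ds (fun r s => v r s ^ q) x t * g x t) +
    (∫ x in (0:ℝ)..R, sinh x ^ d * Dr v x t * Dr g x t) = sinh R ^ d * Dr v R t * g R t := by
  have hI : IsOpen (Ioo 0 T) := isOpen_Ioo
  have s1 := ((smw (Ioo 0 T) d).mul (h.sol.smu.ds hI)).mul hg
  have s2 := ((smw (Ioo 0 T) d).mul (h.sol.sm.dr hI)).mul (hg.dr hI)
  have s3 := ((smw (Ioo 0 T) d).mul (h.sol.sm.dr hI)).mul hg
  rw [← intervalIntegral.integral_add (s1.ii le_rfl hR ht) (s2.ii le_rfl hR ht)]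
  have := intervalIntegral.integral_eq_sub_of_hasDerivAt_of_le hR ((s3.contr ht).mono fun _ hx => hx.1)
    (f' := fun x => sinh x ^ d * Ds (fun r s => v r s ^ q) x t * g x t + sinh x ^ d * Dr v x t * Dr g x t)
    (fun x hx => ((h.sol.sm.hasFlux hI hx.1 ht).mul (hg.hasDr' hx.1 ht)).congr_deriv (by
      rw [h.sol.equ hI hx.1 ht, one_mul]))
    ((s1.ii le_rfl hR ht).add (s2.ii le_rfl hR ht))
  rw [this]
  have hd := h.hd
  simp [zero_pow (show d ≠ 0 by omega)]

lemma hasA (h : GS d q T v) (hR : 0 ≤ R) (ht : t ∈ Ioo 0 T) :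
    HasDerivAt (AR d q v R) ((q+1)/q * XR d q v R t) t := by
  have hI : IsOpen (Ioo 0 T) := isOpen_Ioo
  have sm1 := (h.sol.sm.rpow h.sol.pos (q+1))
  refine ((sm1.mul (smw _ d)).hasInt hI le_rfl hR ht).congr_deriv ?_
  rw [XR, ← intervalIntegral.integral_const_mul]
  refine intervalIntegral.integral_congr fun x hx => ?_
  rw [uIcc_of_le hR] at hx
  have hq := h.hq
  have hp := h.sol.pos x hx.1 t ht
  rw [Ds_mul hI sm1 (smw _ d) hx.1 ht, Ds_rpow hI h.sol.sm h.sol.pos _ hx.1 ht, h.dsu hx.1 ht, Ds_c]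
  have : v x t ^ (q + 1 - 1) = v x t ^ (q-1) * v x t := by rw [← rpow_add_one hp.ne']; ring_nf
  rw [this]; field_simp; ring

lemma hasE (h : GS d q T v) (hR : 0 ≤ R) (ht : t ∈ Ioo 0 T) :
    HasDerivAt (ER d v R) (2 * (sinh R ^ d * Dr v R t * Ds v R t) - 2 * DR d q v R t) t := by
  have hI : IsOpen (Ioo 0 T) := isOpen_Ioo
  have sm1 := ((h.sol.sm.dr hI).pow 2)
  refine ((sm1.mul (smw _ d)).hasInt hI le_rfl hR ht).congr_deriv ?_
  rw [← h.ibp (h.sol.sm.ds hI) hR ht, DR, mul_add, add_sub_cancel_left, ← intervalIntegral.integral_const_mul]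
  refine intervalIntegral.integral_congr fun x hx => ?_
  rw [uIcc_of_le hR] at hx
  rw [Ds_mul hI sm1 (smw _ d) hx.1 ht, Ds_pow hI (h.sol.sm.dr hI) 2 hx.1 ht, Ds_c, h.sol.sm.comm hI hx.1 ht]
  push_cast; ring

lemma XE (h : GS d q T v) (hR : 0 ≤ R) (ht : t ∈ Ioo 0 T) :
    XR d q v R t = sinh R ^ d * Dr v R t * v R t - ER d v R t := by
  rw [← h.ibp h.sol.sm hR ht, XR, ER, eq_sub_iff_add_eq]
  congr 1
  refine intervalIntegral.integral_congr fun x hx => ?_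
  ring

lemma A_pos (h : GS d q T v) (hR : 0 < R) (ht : t ∈ Ioo 0 T) : 0 < AR d q v R t := by
  refine intervalIntegral.intervalIntegral_pos_of_pos_on
    (((h.sol.sm.rpow h.sol.pos (q+1)).mul (smw _ d)).ii le_rfl hR.le ht) (fun x hx => ?_) hR
  have := h.sol.pos x hx.1.le t ht
  have := sinh_pos' hx.1
  positivity

lemma mono_aux {f : ℝ → ℝ} {a b : ℝ} (ha : 0 ≤ a) (hab : a ≤ b) (hf : ContinuousOn f (Ici 0)) (h0 : ∀ x, 0 ≤ x → 0 ≤ f x) :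
    ∫ x in (0:ℝ)..a, f x ≤ ∫ x in (0:ℝ)..b, f x := by
  have ii : ∀ x y, 0 ≤ x → x ≤ y → IntervalIntegrable f volume x y := fun x y hx hy =>
    (hf.mono (by rw [uIcc_of_le hy]; exact fun z hz => hx.trans hz.1)).intervalIntegrable
  rw [← intervalIntegral.integral_add_adjacent_intervals (ii 0 a le_rfl ha) (ii a b ha hab)]
  have := intervalIntegral.integral_nonneg (μ := volume) (f := f) hab fun x hx => h0 x (ha.trans hx.1)
  linarith

lemma A_mono (h : GS d q T v) {R' : ℝ} (hR : 0 ≤ R) (hR' : R ≤ R') (ht : t ∈ Ioo 0 T) : AR d q v R t ≤ AR d q v R' t :=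
  mono_aux hR hR' (((h.sol.sm.rpow h.sol.pos (q+1)).mul (smw _ d)).contr ht) fun x hx => by
    have := h.sol.pos x hx t ht
    have := sinh_nn hx
    positivity

lemma E_mono (h : GS d q T v) {R' : ℝ} (hR : 0 ≤ R) (hR' : R ≤ R') (ht : t ∈ Ioo 0 T) : ER d v R t ≤ ER d v R' t :=
  mono_aux hR hR' ((((h.sol.sm.dr isOpen_Ioo).pow 2).mul (smw _ d)).contr ht) fun x hx => by
    have := sinh_nn hx
    positivity

lemma E_nn (hR : 0 ≤ R) : 0 ≤ ER d v R t :=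
  intervalIntegral.integral_nonneg hR fun x hx => by
    have := sinh_nn hx.1
    positivity

lemma CS (h : GS d q T v) (hR : 0 < R) (ht : t ∈ Ioo 0 T) :
    XR d q v R t ^ 2 ≤ q * AR d q v R t * DR d q v R t := by
  have hI : IsOpen (Ioo 0 T) := isOpen_Ioo
  have hA := h.A_pos hR ht
  have hq := h.hq
  have hq0 : 0 < q := by linarith
  set X := XR d q v R t with hX
  set A := AR d q v R t with hA'
  set D := DR d q v R t with hD
  set μ := X / (q * A)
  have s1 := ((smw (Ioo 0 T) d).mul (h.sol.smu.ds hI)).mul (h.sol.sm.ds hI)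
  have s2 := ((smw (Ioo 0 T) d).mul (h.sol.smu.ds hI)).mul h.sol.sm
  have s3 := (h.sol.sm.rpow h.sol.pos (q+1)).mul (smw (Ioo 0 T) d)
  have e : 0 ≤ ∫ x in (0:ℝ)..R, (sinh x ^ d * Ds (fun r s => v r s ^ q) x t * Ds v x t
      - 2 * μ * (sinh x ^ d * Ds (fun r s => v r s ^ q) x t * v x t)
      + μ ^ 2 * q * (v x t ^ (q+1) * sinh x ^ d)) := by
    refine intervalIntegral.integral_nonneg hR.le fun x hx => ?_
    have hp := h.sol.pos x hx.1 t ht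
    have hs := sinh_nn hx.1
    rw [h.dsu hx.1 ht]
    have : v x t ^ (q + 1) = v x t ^ (q-1) * v x t ^ 2 := by
      rw [← Real.rpow_add_natCast hp.ne']; congr 1; push_cast; ring
    rw [this, show sinh x ^ d * (q * v x t ^ (q-1) * Ds v x t) * Ds v x t - 2 * μ * (sinh x ^ d * (q * v x t ^ (q-1) * Ds v x t) * v x t)
      + μ ^ 2 * q * (v x t ^ (q-1) * v x t ^ 2 * sinh x ^ d) = q * v x t ^ (q-1) * sinh x ^ d * (Ds v x t - μ * v x t)^2 by ring]
    positivity
  rw [intervalIntegral.integral_add (((s1.ii le_rfl hR.le ht)).sub ((s2.ii le_rfl hR.le ht).const_mul _)) ((s3.ii le_rfl hR.le ht).const_mul _),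
    intervalIntegral.integral_sub (s1.ii le_rfl hR.le ht) ((s2.ii le_rfl hR.le ht).const_mul _),
    intervalIntegral.integral_const_mul, intervalIntegral.integral_const_mul] at e
  change 0 ≤ D - 2 * μ * X + μ ^ 2 * q * A at e
  have e2 : D - 2 * μ * X + μ ^ 2 * q * A = D - X ^ 2 / (q * A) := by
    simp only [μ]; field_simp; ring
  rw [e2, sub_nonneg, div_le_iff₀ (by positivity)] at e
  linarith

/-- almost monotonicity of the quotient -/
lemma quot (h : GS d q T v) (hε : ε ∈ Ioo 0 T) {t2 : ℝ} (h2 : t2 ∈ Ico ε T) {δ : ℝ} (hδ : 0 < δ) :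
    ∃ R0 ≥ 1, ∀ R ≥ R0, (∀ t ∈ Icc ε t2, ER d v R t * AR d q v R t ^ (-(2/(q+1))) ≤
        ER d v R ε * AR d q v R ε ^ (-(2/(q+1))) + δ) ∧
      ∀ t ∈ Icc ε t2, |sinh R ^ d * Dr v R t * v R t| * AR d q v R t ^ (-(2/(q+1))) ≤ δ := by
  have hI : IsOpen (Ioo 0 T) := isOpen_Ioo
  have hq := h.hq
  have hq0 : 0 < q := by linarith
  have hε0 := hε.1
  have hT := h.hT
  have hsub : Icc ε t2 ⊆ Ioo 0 T := fun x hx => ⟨hε.1.trans_le hx.1, hx.2.trans_lt h2.2⟩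
  obtain ⟨CF, hCF, hCF'⟩ := h.flux_bd (Λ := fun _ => 1) (M := 1) (fun _ _ => one_pos) one_pos (by simp) h.dec1 ε hε
  obtain ⟨E0, hE0, hE0'⟩ := h.en ε hε
  set K := 2 / ((q-1) * ε)
  have hK : 0 < K := by have : 0 < q - 1 := by linarith
                        positivity
  set θ := 2/(q+1) with hθ
  have hθ0 : 0 < θ := by positivity
  obtain ⟨a0, ha0, ha0'⟩ : ∃ a0 > 0, ∀ t ∈ Icc ε t2, a0 ≤ AR d q v 1 t := by
    obtain ⟨x, hx, hx'⟩ := isCompact_Icc.exists_isMinOn (nonempty_Icc.2 h2.1)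
      (f := AR d q v 1) (fun s hs => (h.hasA zero_le_one (hsub hs)).continuousAt.continuousWithinAt)
    exact ⟨_, h.A_pos one_pos (hsub hx), fun t ht => hx' ht⟩
  set c1 := 2/q * a0 ^ (-θ-1) * E0
  set c2 := 2 * CF * a0 ^ (-θ)
  have hc1 : 0 < c1 := by positivity
  have hc2 : 0 < c2 := by positivity
  set L := (c1 * CF + 2 * c2 * K) * T + c2 + CF * a0 ^ (-θ)
  have hL : 0 < L := by positivity
  obtain ⟨R0, hR0, hR0'⟩ := h.unif hε (ε := δ / L) (by positivity)
  set η := δ / L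
  have hη : 0 < η := by positivity
  refine ⟨max R0 1, le_max_right _ _, fun R hR => ?_⟩
  have hR1 : 1 ≤ R := (le_max_right _ _).trans hR
  have hRp : 0 < R := by linarith
  have hvR : ∀ t ∈ Icc ε t2, v R t ≤ η := fun t ht => hR0' R ((le_max_left _ _).trans hR) t ⟨ht.1, ht.2.trans_lt h2.2⟩
  have hA : ∀ t ∈ Icc ε t2, a0 ≤ AR d q v R t := fun t ht =>
    (ha0' t ht).trans (h.A_mono zero_le_one hR1 (hsub ht))
  have hF : ∀ t ∈ Icc ε t2, |sinh R ^ d * Dr v R t| ≤ CF := fun t ht => by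
    have := hCF' t ⟨ht.1, ht.2.trans_lt h2.2⟩ R hRp.le
    rwa [mul_one] at this
  have hb : ∀ t ∈ Icc ε t2, |sinh R ^ d * Dr v R t * v R t| ≤ CF * η := fun t ht => by
    have hp := h.sol.pos R hRp.le t (hsub ht)
    rw [abs_mul, abs_of_pos hp]
    have := hF t ht; have := hvR t ht
    gcongr
  have hAt : ∀ t ∈ Icc ε t2, AR d q v R t ^ (-θ) ≤ a0 ^ (-θ) := fun t ht =>
    rpow_le_rpow_of_nonpos ha0 (hA t ht) (by linarith)
  have hAt1 : ∀ t ∈ Icc ε t2, AR d q v R t ^ (-θ-1) ≤ a0 ^ (-θ-1) := fun t ht =>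
    rpow_le_rpow_of_nonpos ha0 (hA t ht) (by linarith)
  have hηL : η * L = δ := by simp only [η]; field_simp
  constructor
  · intro t ht
    have hsub2 : Icc ε t ⊆ Icc ε t2 := Icc_subset_Icc_right ht.2
    have key := le_of_der (g := fun t => ER d v R t * AR d q v R t ^ (-θ) + c2 * v R t)
      (c := c1 * CF * η + 2 * c2 * K * η) ht.1 (fun s hs =>
        ((h.hasE hRp.le (hsub (hsub2 hs))).mul ((h.hasA hRp.le (hsub (hsub2 hs))).rpow_const (p := -θ)
          (Or.inl (h.A_pos hRp (hsub (hsub2 hs))).ne'))).add ((h.sol.sm.hasDs hI hRp.le (hsub (hsub2 hs))).const_mul c2))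
      (fun s hs => by
        have hs2 := hsub2 hs
        have hsI := hsub hs2
        have hAp := h.A_pos hRp hsI
        have hp := h.sol.pos R hRp.le s hsI
        have cs := h.CS hRp hsI
        have hEE := hE0' s ⟨hs.1, hsI.2⟩ R hRp.le
        change ER d v R s ≤ E0 at hEE
        have hEn : 0 ≤ ER d v R s := E_nn hRp.le
        have hx := h.XE hRp.le hsI
        rw [hx] at cs
        rw [hx]
        have hbs := hb s hs2
        have hFs := hF s hs2
        set A := AR d q v R s
        set E := ER d v R s
        set b := sinh R ^ d * Dr v R s * v R s
        set F := sinh R ^ d * Dr v R s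
        set D := DR d q v R s
        set P := A ^ (-θ-1)
        have hP : 0 < P := by positivity
        have e1 : A ^ (-θ) = P * A := by simp only [P]; rw [← rpow_add_one hAp.ne']; ring_nf
        have hP1 : P ≤ a0 ^ (-θ-1) := hAt1 s hs2
        have hPA : P * A ≤ a0 ^ (-θ) := e1 ▸ hAt s hs2
        have hve : Ds v R s ≤ K * v R s := h.dsle hε0 hs.1 hsI.2 hRp.le
        have habs : |Ds v R s| ≤ 2 * K * v R s - Ds v R s := by
          have := mul_pos hK hp
          rw [abs_le]; constructor <;> linarith
        have h1 : 2 * (F * Ds v R s) * (P * A) ≤ c2 * (2 * K * η - Ds v R s) := by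
          have := hvR s hs2
          calc 2 * (F * Ds v R s) * (P * A) ≤ 2 * (|F| * |Ds v R s|) * (P * A) := by
                have : F * Ds v R s ≤ |F| * |Ds v R s| := by rw [← abs_mul]; exact le_abs_self _
                gcongr 2 * ?_ * _
            _ ≤ 2 * (CF * |Ds v R s|) * a0 ^ (-θ) := by gcongr
            _ = c2 * |Ds v R s| := by simp only [c2]; ring
            _ ≤ c2 * (2 * K * η - Ds v R s) := by
                gcongr; refine habs.trans ?_; gcongr
        have h2 : 2/q * P * (b * (E - b)) ≤ c1 * CF * η := by
          have : b * (E - b) ≤ CF * η * E0 := by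
            calc b * (E - b) ≤ b * E := by linarith [sq_nonneg b]
              _ ≤ |b| * E := by gcongr; exact le_abs_self _
              _ ≤ _ := by gcongr
          calc 2/q * P * (b * (E - b)) ≤ 2/q * P * (CF * η * E0) := by gcongr
            _ ≤ 2/q * a0 ^ (-θ-1) * (CF * η * E0) := by gcongr
            _ = _ := by simp only [c1]; ring
        have h3 : (E - b)^2 / q ≤ A * D := by
          rw [div_le_iff₀ hq0]; nlinarith
        have hθq : θ * ((q+1)/q) = 2/q := by simp only [hθ]; field_simp
        have e2 : (2 * (F * Ds v R s) - 2 * D) * A ^ (-θ) + E * ((q+1)/q * (b - E) * (-θ) * P) + c2 * Ds v R s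
          = 2 * (F * Ds v R s) * (P * A) - 2 * P * (A * D) + θ * ((q+1)/q) * P * (E * (E - b)) + c2 * Ds v R s := by
          rw [e1]; ring
        have h4 : 2 * P * ((E - b)^2 / q) ≤ 2 * P * (A * D) := by gcongr
        have e3 : 2/q * P * (b * (E - b)) = 2/q * P * (E * (E - b)) - 2 * P * ((E - b)^2 / q) := by ring
        calc _ = _ := e2
          _ ≤ _ := by rw [hθq]; linarith)
    have hp := h.sol.pos R hRp.le t (hsub ht)
    have h1 := hvR ε ⟨le_rfl, h2.1⟩
    have h3 : t - ε ≤ T := by linarith [(hsub ht).2]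
    have h4 : (c1 * CF * η + 2 * c2 * K * η) * (t - ε) ≤ (c1 * CF * η + 2 * c2 * K * η) * T := by gcongr
    have h5 : δ = (c1 * CF * η + 2 * c2 * K * η) * T + c2 * η + CF * η * a0 ^ (-θ) := by
      rw [← hηL]; simp only [L]; ring
    have h6 : 0 ≤ CF * η * a0 ^ (-θ) := by positivity
    have h7 : c2 * v R ε ≤ c2 * η := by gcongr
    have h8 : 0 < c2 * v R t := by positivity
    linarith
  · intro t ht
    have hAp := h.A_pos hRp (hsub ht)
    calc _ ≤ CF * η * a0 ^ (-θ) := by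
          have := hb t ht; have := hAt t ht
          gcongr
      _ = η * (CF * a0 ^ (-θ)) := by ring
      _ ≤ η * L := by
        gcongr; simp only [L]
        have : 0 < (c1 * CF + 2 * c2 * K) * T + c2 := by positivity
        linarith
      _ = δ := hηL

end GS

lemma sinh_le_lin {x : ℝ} (h0 : 0 ≤ x) (h1 : x ≤ 1) : sinh x ≤ cosh 1 * x := by
  have := le_of_der (g := sinh) (c := cosh 1) h0 (fun s _ => Real.hasDerivAt_sinh s) (fun s hs => by
    rw [Real.cosh_le_cosh, abs_of_nonneg hs.1, abs_one]; linarith [hs.2])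
  simpa using this

namespace GS
variable {d : ℕ} {q T : ℝ} {v : ℝ → ℝ → ℝ} {r s t ε R : ℝ}

lemma sup_small (h : GS d q T v) (hε : 0 < ε) : ∃ t1 < T, 0 < t1 ∧ ∀ t ∈ Ioo t1 T, ∀ r, 0 ≤ r → v r t ≤ ε := by
  have hT := h.hT
  obtain ⟨R0, hR0, hR⟩ := h.unif (t0 := T/2) ⟨by linarith, by linarith⟩ hε
  obtain ⟨t1, ht1, h1⟩ := h.ext R0 ε hε
  refine ⟨max t1 (T/2), max_lt ht1 (by linarith), by positivity, fun t ht r hr => ?_⟩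
  have h2 : t1 < t := (le_max_left _ _).trans_lt ht.1
  have h3 : T/2 < t := (le_max_right _ _).trans_lt ht.1
  rcases le_total r R0 with h4 | h4
  · exact h1 t ⟨h2, ht.2⟩ (by linarith) r ⟨hr, h4⟩
  · exact hR r h4 t ⟨h3.le, ht.2⟩

lemma A_small (h : GS d q T v) (hε : 0 < ε) : ∃ t1 < T, ∀ t ∈ Ioo t1 T, 0 < t → ∀ R, 0 ≤ R → AR d q v R t ≤ ε := by
  have hT := h.hT
  have hq := h.hq
  have hd := h.hd'
  have hq1 : 0 < q - 1 := by linarith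
  obtain ⟨C, hC, hC'⟩ := h.dec1 (T/2) ⟨by linarith, by linarith⟩
  set η := (ε * d / C ^ 2) ^ (1/(q-1))
  have hη : 0 < η := by positivity
  obtain ⟨t1, ht1, ht10, h1⟩ := h.sup_small hη
  refine ⟨max t1 (T/2), max_lt ht1 (by linarith), fun t ht h0 R hR => ?_⟩
  have htI : t ∈ Ioo 0 T := ⟨h0, ht.2⟩
  have e1 : AR d q v R t ≤ ∫ x in (0:ℝ)..R, η ^ (q-1) * C ^ 2 * exp (-d * x) := by
    refine intervalIntegral.integral_mono_on hR (((h.sol.sm.rpow h.sol.pos (q+1)).mul (smw _ d)).ii le_rfl hR htI)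
      ((by fun_prop : Continuous fun x : ℝ => η ^ (q-1) * C ^ 2 * exp (-d * x)).intervalIntegrable _ _) fun x hx => ?_
    have hp := h.sol.pos x hx.1 t htI
    have a1 := hC' t ⟨((le_max_right _ _).trans_lt ht.1).le, ht.2⟩ x hx.1
    have a2 := h1 t ⟨(le_max_left _ _).trans_lt ht.1, ht.2⟩ x hx.1
    have a3 : v x t ^ (q-1) ≤ η ^ (q-1) := rpow_le_rpow hp.le a2 hq1.le
    have hs := sinh_nn hx.1
    have : v x t ^ (q + 1) = v x t ^ (q-1) * v x t ^ 2 := by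
      rw [← Real.rpow_add_natCast hp.ne']; congr 1; push_cast; ring
    rw [this]
    calc v x t ^ (q-1) * v x t ^ 2 * sinh x ^ d ≤ η ^ (q-1) * (C * 1 * exp (-d * x)) ^ 2 * exp (d * x) := by
          gcongr; exact w_le_exp d hx.1
      _ = η ^ (q-1) * C ^ 2 * (exp (-d * x) * exp (-d * x) * exp (d * x)) := by ring
      _ = _ := by rw [← exp_add, ← exp_add]; ring_nf
  rw [intervalIntegral.integral_const_mul] at e1
  have e2 := exp_int (b := d) (by linarith) hR
  rw [mul_zero, Real.exp_zero] at e2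
  refine e1.trans ?_
  have e3 : η ^ (q-1) = ε * d / C ^ 2 := by
    simp only [η]; rw [← rpow_mul (by positivity), one_div_mul_cancel hq1.ne', rpow_one]
  calc _ ≤ η ^ (q-1) * C ^ 2 * (1/d) := by gcongr
    _ = ε := by rw [e3]; field_simp

lemma hasf (h : GS d q T v) (hR : 0 < R) (ht : t ∈ Ioo 0 T) :
    HasDerivAt (fun t => AR d q v R t ^ ((q-1)/(q+1)))
      ((q-1)/q * (AR d q v R t ^ (-(2/(q+1))) * (sinh R ^ d * Dr v R t * v R t - ER d v R t))) t := by
  have hA := h.A_pos hR ht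
  have hq := h.hq
  refine ((h.hasA hR.le ht).rpow_const (p := (q-1)/(q+1)) (Or.inl hA.ne')).congr_deriv ?_
  rw [h.XE hR.le ht, show (q-1)/(q+1) - 1 = -(2/(q+1)) by field_simp; ring]
  field_simp

lemma E_rate (h : GS d q T v) (hε : ε ∈ Ioo 0 T) :
    ∃ C > 0, ∀ t ∈ Ico ε T, ∀ R, 0 ≤ R → ER d v R t ≤ C * (T - t) ^ (2/(q-1)) := by
  have hq := h.hq
  have hq1 : 0 < q - 1 := by linarith
  obtain ⟨E0, hE0, hE0'⟩ := h.en ε hε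
  set θ := 2/(q+1) with hθ
  have hA1 := h.A_pos one_pos hε
  set ρ := E0 * AR d q v 1 ε ^ (-θ)
  have hρ : 0 < ρ := by positivity
  have hρR : ∀ R ≥ 1, ER d v R ε * AR d q v R ε ^ (-θ) ≤ ρ := fun R hR => by
    have a1 := hE0' ε ⟨le_rfl, hε.2⟩ R (by linarith)
    have a2 : AR d q v R ε ^ (-θ) ≤ AR d q v 1 ε ^ (-θ) :=
      rpow_le_rpow_of_nonpos hA1 (h.A_mono zero_le_one hR hε) (by simp only [hθ]; linarith [show 0 < 2/(q+1) by positivity])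
    have := h.A_pos (by linarith : 0 < R) hε
    exact mul_le_mul a1 a2 (by positivity) hE0.le
  set C := (q-1)/q * (ρ + 2) + 1
  have hC : 0 < C := by positivity
  refine ⟨(ρ + 1) * C ^ (2/(q-1)), by positivity, fun t ht R' hR' => ?_⟩
  have hl : 0 < T - t := by linarith [ht.2]
  obtain ⟨t1, ht1, h1⟩ := h.A_small (ε := (T - t) ^ ((q+1)/(q-1))) (by positivity)
  set t2 := (max t1 t + T)/2
  have hm : max t1 t < T := max_lt ht1 ht.2
  have hm1 := le_max_left t1 t
  have hm2 := le_max_right t1 t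
  have ht2 : t2 ∈ Ico ε T := ⟨by simp only [t2]; linarith [ht.1], by simp only [t2]; linarith⟩
  have ht2' : t ≤ t2 := by simp only [t2]; linarith
  have hsub : Icc ε t2 ⊆ Ioo 0 T := fun x hx => ⟨hε.1.trans_le hx.1, hx.2.trans_lt ht2.2⟩
  obtain ⟨R0, hR0, hR0'⟩ := h.quot hε ht2 one_pos
  set R := max R0 R'
  have hR1 : 1 ≤ R := hR0.le.trans (le_max_left _ _)
  have hRp : 0 < R := by linarith
  obtain ⟨k1, k2⟩ := hR0' R (le_max_left _ _)
  have htI : t ∈ Ioo 0 T := hsub ⟨ht.1, ht2'⟩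
  have hAp := h.A_pos hRp htI
  have h3 : AR d q v R t ^ ((q-1)/(q+1)) ≤ C * (T - t) := by
    have hsub2 : Icc t t2 ⊆ Icc ε t2 := Icc_subset_Icc_left ht.1
    have := le_of_der (g := fun t => - AR d q v R t ^ ((q-1)/(q+1))) (c := (q-1)/q * (ρ + 2)) ht2'
      (fun s hs => (h.hasf hRp (hsub (hsub2 hs))).neg) (fun s hs => by
        have a1 := k1 s (hsub2 hs)
        have a2 := k2 s (hsub2 hs)
        have a3 := hρR R hR1
        have hA := h.A_pos hRp (hsub (hsub2 hs))
        have a4 : -(sinh R ^ d * Dr v R s * v R s) * AR d q v R s ^ (-θ) ≤ 1 :=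
          (mul_le_mul_of_nonneg_right (neg_le_abs _) (by positivity)).trans a2
        rw [← mul_neg]
        refine mul_le_mul_of_nonneg_left ?_ (by positivity)
        linarith)
    have a5 : AR d q v R t2 ^ ((q-1)/(q+1)) ≤ T - t := by
      have a6 := h1 t2 ⟨by simp only [t2]; linarith, ht2.2⟩ (by linarith [ht2.1, hε.1]) R hRp.le
      have hA2 := h.A_pos hRp (hsub ⟨ht2.1, le_rfl⟩)
      calc _ ≤ ((T - t) ^ ((q+1)/(q-1))) ^ ((q-1)/(q+1)) := rpow_le_rpow hA2.le a6 (by positivity)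
        _ = T - t := by
          rw [← rpow_mul hl.le, show (q+1)/(q-1) * ((q-1)/(q+1)) = 1 by field_simp, rpow_one]
    have a7 : (q-1)/q * (ρ + 2) * (t2 - t) ≤ (q-1)/q * (ρ + 2) * (T - t) := by
      have := ht2.2
      gcongr
    simp only [C]; linarith
  have h4 : ER d v R t ≤ (ρ + 1) * AR d q v R t ^ θ := by
    have a1 := (k1 t ⟨ht.1, ht2'⟩).trans (add_le_add_left (hρR R hR1) 1)
    rw [Real.rpow_neg hAp.le, ← div_eq_mul_inv, div_le_iff₀ (by positivity)] at a1
    exact a1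
  have h5 : AR d q v R t ^ θ ≤ (C * (T - t)) ^ (2/(q-1)) := by
    calc AR d q v R t ^ θ = (AR d q v R t ^ ((q-1)/(q+1))) ^ (2/(q-1)) := by
          rw [← rpow_mul hAp.le]; congr 1; simp only [hθ]; field_simp
      _ ≤ _ := rpow_le_rpow (by positivity) h3 (by positivity)
  calc ER d v R' t ≤ ER d v R t := h.E_mono hR' (le_max_right _ _) htI
    _ ≤ (ρ + 1) * (C * (T - t)) ^ (2/(q-1)) := h4.trans (by gcongr)
    _ = _ := by rw [mul_rpow hC.le hl.le]; ring

lemma G2near' (h : GS d q T v) : ∃ η > 0, ((d:ℝ) - 1 + η) * ((q+1)/2) < d + 1 := by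
  have hq := h.hq
  have := h.hsub
  refine ⟨(((d:ℝ)+1) * (2/(q+1)) - (d-1))/2, ?_, ?_⟩
  · have : (d:ℝ) - 1 < (d+1) * (2/(q+1)) := by
      rw [← mul_div_assoc, lt_div_iff₀ (by linarith)]; linarith
    linarith
  · have : ((d:ℝ) - 1 + (((d:ℝ)+1) * (2/(q+1)) - (d-1))/2) * ((q+1)/2) = ((d-1) * (q+1)/2 + (d+1))/2 := by
      field_simp; ring
    rw [this]; linarith

lemma v_near (h : GS d q T v) {η : ℝ} (hη : 0 < η) : ∃ C > 0, ∀ t ∈ Ioo 0 T, ∀ E > 0, (∀ R, 0 ≤ R → ER d v R t ≤ E) →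
    ∀ r, 0 < r → r ≤ 1 → v r t ≤ √E * C * r ^ (-((d:ℝ) - 1 + η)/2) := by
  obtain ⟨C, hC, hC'⟩ := G2near h.hd hη
  refine ⟨√C, Real.sqrt_pos.2 hC, fun t ht E hE hE' r hr hr1 => ?_⟩
  have := radial_bound isOpen_Ioo h.sol.sm ht hE (by positivity) hr hE' (fun R hR => hC' r hr hr1 R hR) (h.van t ht)
  refine this.trans (le_of_eq ?_)
  rw [Real.sqrt_mul hE.le, Real.sqrt_mul hC.le, Real.sqrt_eq_rpow (r ^ _), ← rpow_mul hr.le, ← mul_assoc]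
  congr 2; ring

lemma v_far (h : GS d q T v) (ht : t ∈ Ioo 0 T) {E : ℝ} (hE : 0 < E) (hE' : ∀ R, 0 ≤ R → ER d v R t ≤ E) (hr1 : 1 ≤ r) :
    v r t ≤ √E * √(3 ^ d) * exp (-(d/2) * r) := by
  have := radial_bound isOpen_Ioo h.sol.sm ht hE (G := 3 ^ d * exp (-d * r)) (by positivity)
      (by linarith) hE' (fun R hR => G2far h.hd hr1 hR) (h.van t ht)
  refine this.trans (le_of_eq ?_)
  rw [Real.sqrt_mul hE.le, Real.sqrt_mul (by positivity), Real.sqrt_eq_rpow (exp _), ← exp_mul, ← mul_assoc]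
  congr 2; ring

lemma sobolev (h : GS d q T v) : ∃ S > 0, ∀ t ∈ Ioo 0 T, ∀ E > 0, (∀ R, 0 ≤ R → ER d v R t ≤ E) →
    ∀ R, 1 ≤ R → AR d q v R t ≤ S * E ^ ((q+1)/2) := by
  obtain ⟨η, hη, hη'⟩ := h.G2near'
  obtain ⟨C, hC, hC'⟩ := h.v_near hη
  have hq := h.hq
  have hd := h.hd'
  set e := (d:ℝ) - ((d:ℝ) - 1 + η) * ((q+1)/2)
  have he : -1 < e := by simp only [e]; linarith
  set γ := (d:ℝ) * ((q-1)/2)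
  have hγ : 0 < γ := mul_pos (by linarith) (by linarith)
  have hc1 := cosh_pos 1
  set S1 := C ^ (q+1) * cosh 1 ^ d / (e + 1)
  set S2 := √(3 ^ d) ^ (q+1) / γ
  have hS1 : 0 < S1 := by have : 0 < e + 1 := by linarith
                          positivity
  have hS2 : 0 < S2 := by positivity
  refine ⟨S1 + S2, by positivity, fun t ht E hE hE' R hR => ?_⟩
  have sm1 := (h.sol.sm.rpow h.sol.pos (q+1)).mul (smw (Ioo 0 T) d)
  have hsE : √E ^ (q+1) = E ^ ((q+1)/2) := by
    rw [Real.sqrt_eq_rpow, ← rpow_mul hE.le]; congr 1; ring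
  rw [AR, ← intervalIntegral.integral_add_adjacent_intervals (sm1.ii le_rfl zero_le_one ht) (sm1.ii zero_le_one (by linarith) ht), add_mul]
  refine add_le_add ?_ ?_
  · have e1 : ∫ x in (0:ℝ)..1, v x t ^ (q+1) * sinh x ^ d ≤
        ∫ x in (0:ℝ)..1, (E ^ ((q+1)/2) * C ^ (q+1) * cosh 1 ^ d) * x ^ e := by
      refine intervalIntegral.integral_mono_on_of_le_Ioo zero_le_one (sm1.ii le_rfl zero_le_one ht)
        ((intervalIntegral.intervalIntegrable_rpow' he).const_mul _) fun x hx => ?_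
      have hp := h.sol.pos x hx.1.le t ht
      have hs := sinh_nn hx.1.le
      have hx0 := hx.1
      have a1 := hC' t ht E hE hE' x hx.1 hx.2.le
      have a2 : v x t ^ (q+1) ≤ E ^ ((q+1)/2) * C ^ (q+1) * x ^ (-(((d:ℝ) - 1 + η) * ((q+1)/2))) := by
        calc v x t ^ (q+1) ≤ (√E * C * x ^ (-((d:ℝ) - 1 + η)/2)) ^ (q+1) := rpow_le_rpow hp.le a1 (by linarith)
          _ = _ := by
            rw [mul_rpow (by positivity) (by positivity), mul_rpow (by positivity) hC.le, hsE, ← rpow_mul hx0.le]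
            congr 2; ring
      calc v x t ^ (q+1) * sinh x ^ d ≤ (E ^ ((q+1)/2) * C ^ (q+1) * x ^ (-(((d:ℝ) - 1 + η) * ((q+1)/2)))) * (cosh 1 * x) ^ d := by
            gcongr; exact sinh_le_lin hx0.le hx.2.le
        _ = (E ^ ((q+1)/2) * C ^ (q+1) * cosh 1 ^ d) * (x ^ (-(((d:ℝ) - 1 + η) * ((q+1)/2))) * x ^ d) := by
            rw [mul_pow]; ring
        _ = _ := by
            rw [← Real.rpow_add_natCast hx0.ne']; congr 2; simp only [e]; ring
    rw [intervalIntegral.integral_const_mul, integral_rpow (Or.inl he), Real.one_rpow, Real.zero_rpow (by linarith)] at e1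
    refine e1.trans (le_of_eq ?_)
    simp only [S1]; ring
  · have e1 : ∫ x in (1:ℝ)..R, v x t ^ (q+1) * sinh x ^ d ≤
        ∫ x in (1:ℝ)..R, (E ^ ((q+1)/2) * √(3^d) ^ (q+1)) * exp (-γ * x) := by
      refine intervalIntegral.integral_mono_on hR (sm1.ii zero_le_one (by linarith) ht)
        ((by fun_prop : Continuous fun x : ℝ => (E ^ ((q+1)/2) * √(3^d) ^ (q+1)) * exp (-γ * x)).intervalIntegrable _ _) fun x hx => ?_
      have hx0 : 0 ≤ x := by linarith [hx.1]
      have hp := h.sol.pos x hx0 t ht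
      have hs := sinh_nn hx0
      have a1 := h.v_far ht hE hE' hx.1
      have a2 : v x t ^ (q+1) ≤ E ^ ((q+1)/2) * √(3^d) ^ (q+1) * exp (-(d/2) * x * (q+1)) := by
        calc v x t ^ (q+1) ≤ (√E * √(3 ^ d) * exp (-(d/2) * x)) ^ (q+1) := rpow_le_rpow hp.le a1 (by linarith)
          _ = _ := by
            rw [mul_rpow (by positivity) (by positivity), mul_rpow (by positivity) (by positivity), hsE, exp_mul _ (q+1)]
      calc v x t ^ (q+1) * sinh x ^ d ≤ E ^ ((q+1)/2) * √(3^d) ^ (q+1) * exp (-(d/2) * x * (q+1)) * exp (d * x) := by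
            gcongr; exact w_le_exp d hx0
        _ = _ := by rw [mul_assoc, ← exp_add]; congr 2; simp only [γ]; ring
    rw [intervalIntegral.integral_const_mul] at e1
    refine e1.trans ?_
    have e2 := exp_int hγ hR
    calc _ ≤ E ^ ((q+1)/2) * √(3^d) ^ (q+1) * (1/γ) := by
          gcongr
          refine e2.trans ?_
          gcongr
          exact exp_le_one_iff.2 (by nlinarith)
      _ = _ := by simp only [S2]; ring

lemma E_tail (h : GS d q T v) (hε : ε ∈ Ioo 0 T) : ∃ C > 0, ∀ t ∈ Ico ε T, ∀ R ≥ 1, ∀ R', 0 ≤ R' →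
    ER d v R' t ≤ ER d v R t + C * exp (-d * R) := by
  obtain ⟨CF, hCF, hCF'⟩ := h.flux_bd (Λ := fun _ => 1) (M := 1) (fun _ _ => one_pos) one_pos (by simp) h.dec1 ε hε
  have hd := h.hd'
  refine ⟨CF ^ 2 * 3 ^ d / d, by positivity, fun t ht R hR R' hR' => ?_⟩
  have htI : t ∈ Ioo 0 T := ⟨hε.1.trans_le ht.1, ht.2⟩
  have hC : 0 < CF ^ 2 * 3 ^ d / d * exp (-d * R) := by positivity
  rcases le_total R' R with h1 | h1
  · linarith [h.E_mono hR' h1 htI]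
  have sm1 := ((h.sol.sm.dr isOpen_Ioo).pow 2).mul (smw (Ioo 0 T) d)
  rw [ER, ER, ← intervalIntegral.integral_add_adjacent_intervals (sm1.ii le_rfl (by linarith : 0 ≤ R) htI) (sm1.ii (by linarith) hR' htI)]
  gcongr
  have e1 : ∫ x in R..R', Dr v x t ^ 2 * sinh x ^ d ≤ ∫ x in R..R', CF ^ 2 * 3 ^ d * exp (-d * x) := by
    refine intervalIntegral.integral_mono_on h1 (sm1.ii (by linarith) hR' htI)
      ((by fun_prop : Continuous fun x : ℝ => CF ^ 2 * 3 ^ d * exp (-d * x)).intervalIntegrable _ _) fun x hx => ?_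
    have hx0 : 0 < x := by linarith [hx.1]
    have a1 := hCF' t ht x hx0.le
    rw [mul_one] at a1
    have a2 := winv_far d (hR.le.trans hx.1)
    have hw := pow_pos (sinh_pos' hx0) d
    have a3 : (sinh x ^ d * Dr v x t) ^ 2 ≤ CF ^ 2 := sq_le_sq' (abs_le.1 a1).1 (abs_le.1 a1).2
    calc Dr v x t ^ 2 * sinh x ^ d = (sinh x ^ d * Dr v x t) ^ 2 * (sinh x ^ d)⁻¹ := by field_simp
      _ ≤ CF ^ 2 * (3 ^ d * exp (-d * x)) := by gcongr
      _ = _ := by ring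
  rw [intervalIntegral.integral_const_mul] at e1
  refine e1.trans ?_
  have e2 := exp_int (b := d) (by linarith) h1
  calc _ ≤ CF ^ 2 * 3 ^ d * (exp (-d * R) / d) := by gcongr
    _ = _ := by ring

lemma A_lower (h : GS d q T v) (hε : ε ∈ Ioo 0 T) :
    ∃ c > 0, ∀ t ∈ Ico ε T, ∃ R ≥ 1, c * (T - t) ^ ((q+1)/(q-1)) ≤ AR d q v R t := by
  have hq := h.hq
  have hq1 : 0 < q - 1 := by linarith
  have hd := h.hd'
  obtain ⟨S, hS, hS'⟩ := h.sobolev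
  obtain ⟨C, hC, hC'⟩ := h.E_tail hε
  set θ := 2/(q+1) with hθ
  have hθ0 : 0 < θ := by positivity
  set σ := S ^ (-θ)
  have hσ : 0 < σ := by positivity
  set c := (q-1)/q * (σ / 2)
  have hc : 0 < c := by positivity
  refine ⟨(c/2) ^ ((q+1)/(q-1)), by positivity, fun t ht => ?_⟩
  have hl : 0 < T - t := by linarith [ht.2]
  set t2 := (t + T)/2
  have ht2 : t2 ∈ Ico ε T := ⟨by simp only [t2]; linarith [ht.1], by simp only [t2]; linarith⟩
  have ht2' : t ≤ t2 := by simp only [t2]; linarith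
  have hsub : Icc ε t2 ⊆ Ioo 0 T := fun x hx => ⟨hε.1.trans_le hx.1, hx.2.trans_lt ht2.2⟩
  obtain ⟨a0, ha0, ha0'⟩ : ∃ a0 > 0, ∀ t ∈ Icc ε t2, a0 ≤ AR d q v 1 t := by
    obtain ⟨x, hx, hx'⟩ := isCompact_Icc.exists_isMinOn (nonempty_Icc.2 ht2.1)
      (f := AR d q v 1) (fun s hs => (h.hasA zero_le_one (hsub hs)).continuousAt.continuousWithinAt)
    exact ⟨_, h.A_pos one_pos (hsub hx), fun t ht => hx' ht⟩
  obtain ⟨R0, hR0, hR0'⟩ := h.quot hε ht2 (δ := σ/4) (by positivity)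
  have htend : Tendsto (fun R => C * exp (-d * R) * a0 ^ (-θ)) atTop (𝓝 (C * 0 * a0 ^ (-θ))) := by
    refine Tendsto.mul_const _ (Tendsto.const_mul _ (Real.tendsto_exp_atBot.comp ?_))
    exact tendsto_id.const_mul_atTop_of_neg (by linarith)
  rw [mul_zero, zero_mul] at htend
  obtain ⟨R1, hR1⟩ := eventually_atTop.1 (htend.eventually (gt_mem_nhds (show 0 < σ/4 by positivity)))
  set R := max R0 R1
  have hRR : 1 ≤ R := hR0.le.trans (le_max_left _ _)
  have hRp : 0 < R := by linarith
  refine ⟨R, hRR, ?_⟩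
  obtain ⟨-, k2⟩ := hR0' R (le_max_left _ _)
  have hsub2 : Icc t t2 ⊆ Icc ε t2 := Icc_subset_Icc_left ht.1
  have key := le_of_der (g := fun t => AR d q v R t ^ ((q-1)/(q+1))) (c := -c) ht2'
    (fun s hs => h.hasf hRp (hsub (hsub2 hs))) (fun s hs => by
      have hsI := hsub (hsub2 hs)
      have a2 := k2 s (hsub2 hs)
      have hA := h.A_pos hRp hsI
      have hE : 0 ≤ ER d v R s := E_nn hRp.le
      have a4 : (sinh R ^ d * Dr v R s * v R s) * AR d q v R s ^ (-θ) ≤ σ/4 :=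
        (mul_le_mul_of_nonneg_right (le_abs_self _) (by positivity)).trans a2
      set δ := C * exp (-d * R)
      have hδ : 0 < δ := by positivity
      have b1 := hS' s hsI (ER d v R s + δ) (by positivity)
        (fun R' hR' => hC' s ⟨(hsub2 hs).1, hsI.2⟩ R hRR R' hR') R hRR
      have b2 : AR d q v R s ^ θ ≤ S ^ θ * (ER d v R s + δ) := by
        calc AR d q v R s ^ θ ≤ (S * (ER d v R s + δ) ^ ((q+1)/2)) ^ θ := rpow_le_rpow hA.le b1 hθ0.le
          _ = _ := by
            rw [mul_rpow hS.le (by positivity), ← rpow_mul (by positivity),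
              show (q+1)/2 * θ = 1 by simp only [hθ]; field_simp, rpow_one]
      have b3 : AR d q v R s ^ (-θ) ≤ a0 ^ (-θ) :=
        rpow_le_rpow_of_nonpos ha0 ((ha0' s (hsub2 hs)).trans (h.A_mono zero_le_one hRR hsI)) (by linarith)
      have b4 : δ * AR d q v R s ^ (-θ) ≤ σ/4 := by
        have := hR1 R (le_max_right _ _)
        exact (mul_le_mul_of_nonneg_left b3 hδ.le).trans this.le
      have b5 : σ ≤ (ER d v R s + δ) * AR d q v R s ^ (-θ) := by
        simp only [σ]
        rw [Real.rpow_neg hS.le, Real.rpow_neg hA.le, ← div_eq_mul_inv, ← one_div, div_le_div_iff₀ (by positivity) (by positivity)]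
        linarith
      rw [← mul_neg]
      refine mul_le_mul_of_nonneg_left ?_ (by positivity)
      linarith)
  have hA2 := h.A_pos hRp (hsub ⟨ht2.1, le_rfl⟩)
  have hA := h.A_pos hRp (hsub (hsub2 ⟨le_rfl, ht2'⟩))
  have e1 : c/2 * (T - t) ≤ AR d q v R t ^ ((q-1)/(q+1)) := by
    have : 0 < AR d q v R t2 ^ ((q-1)/(q+1)) := by positivity
    have e2 : t2 - t = (T - t)/2 := by simp only [t2]; ring
    rw [e2] at key
    linarith
  calc (c/2) ^ ((q+1)/(q-1)) * (T - t) ^ ((q+1)/(q-1)) = (c/2 * (T - t)) ^ ((q+1)/(q-1)) := by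
        rw [mul_rpow (by positivity) hl.le]
    _ ≤ (AR d q v R t ^ ((q-1)/(q+1))) ^ ((q+1)/(q-1)) := rpow_le_rpow (by positivity) e1 (by positivity)
    _ = _ := by rw [← rpow_mul hA.le, show (q-1)/(q+1) * ((q+1)/(q-1)) = 1 by field_simp, rpow_one]

end GS

namespace GS
variable {d : ℕ} {q T : ℝ} {v : ℝ → ℝ → ℝ} {r s t ε : ℝ}

def DecN (T : ℝ) (v : ℝ → ℝ → ℝ) (Λ : ℝ → ℝ) (β : ℝ) : Prop :=
  ∀ ε ∈ Ioo 0 T, ∃ C > 0, ∀ t ∈ Ico ε T, ∀ r, 0 < r → r ≤ 1 → v r t ≤ C * Λ t * r ^ (-β)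

lemma near_step (h : GS d q T v) {Λ : ℝ → ℝ} {β β' : ℝ} (hΛ : Adm q T Λ) (hD : DecN T v Λ β)
    (hβ1 : β * q < d + 1) (hβ' : β' ≠ 0) (hββ : β * q - 2 ≤ β') : DecN T v Λ (max β' 0) := by
  intro ε hε
  have hT := h.hT
  have hq := h.hq
  have hε0 := hε.1
  obtain ⟨C, hC, hC'⟩ := hΛ.2 ε hε
  obtain ⟨C0, hC0, hC0'⟩ := hD (ε/2) ⟨by linarith, by linarith [hε.2]⟩
  set D := (2 * T / (ε/2)) ^ (1/(q-1))
  have hDp : 0 < D := by positivity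
  set γ := d + 1 - β * q
  have hγ : 0 < γ := by simp only [γ]; linarith
  have hab : 0 < |β'| := abs_pos.2 hβ'
  have hch := cosh_pos 1
  set C1 := D * (D * C0 * C) + D * (cosh 1 ^ d / γ * ((C0 * C) ^ q * C) / |β'|)
  refine ⟨C1, by positivity, fun t ht r hr hr1 => ?_⟩
  have htI : t ∈ Ioo 0 T := ⟨by linarith [ht.1], ht.2⟩
  have hL := hΛ.1 t htI
  obtain ⟨τ, hτ, hτ1, hτ2, hτ3⟩ := hC' t ht
  set t' := t - τ
  have ht'I : t' ∈ Ioo 0 T := ⟨by linarith, by simp only [t']; linarith [ht.2]⟩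
  have hL' := hΛ.1 t' ht'I
  set K := C0 * Λ t'
  have hK : 0 < K := by positivity
  have hKq : K ^ q ≤ (C0 * C) ^ q * C * τ * Λ t := by
    calc K ^ q ≤ (C0 * C * Λ t) ^ q := by
          refine rpow_le_rpow hK.le ?_ (by linarith)
          simp only [K]; nlinarith
      _ = (C0 * C) ^ q * (Λ t ^ (q-1) * Λ t) := by
          rw [mul_rpow (by positivity) hL.le, ← rpow_add_one hL.ne']; ring_nf
      _ ≤ (C0 * C) ^ q * ((C * τ) * Λ t) := by gcongr
      _ = _ := by ring
  set K1 := cosh 1 ^ d / γ * K ^ q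
  have hU : ∀ ρ, r ≤ ρ → ρ ≤ 1 → ∫ x in (0:ℝ)..ρ, sinh x ^ d * v x t' ^ q ≤
      sinh ρ ^ d * (K1 * ρ ^ (-1 - β')) := by
    intro ρ hρ hρ1
    have hρ0 : 0 < ρ := by linarith
    have e1 : ∫ x in (0:ℝ)..ρ, sinh x ^ d * v x t' ^ q ≤
        ∫ x in (0:ℝ)..ρ, cosh 1 ^ d * K ^ q * x ^ (d - β * q) := by
      refine intervalIntegral.integral_mono_on hρ0.le
        (((Sm.of (F := fun x _ => sinh x ^ d) (by fun_prop)).mul h.sol.smu).ii le_rfl hρ0.le ht'I)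
        ((intervalIntegral.intervalIntegrable_rpow' (by linarith)).const_mul _) fun x hx => ?_
      rcases hx.1.eq_or_lt with hx0 | hx0
      · rw [← hx0, sinh_zero, zero_pow (by have := h.hd; omega), zero_mul]; positivity
      have hp := h.sol.pos x hx.1 t' ht'I
      have h1 := hC0' t' ⟨hτ1, ht'I.2⟩ x hx0 (hx.2.trans hρ1)
      have h2 : v x t' ^ q ≤ K ^ q * x ^ (-β * q) := by
        rw [rpow_mul hx0.le, ← mul_rpow hK.le (by positivity)]
        exact rpow_le_rpow hp.le h1 (by linarith)
      have := sinh_nn hx.1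
      calc sinh x ^ d * v x t' ^ q ≤ (cosh 1 * x) ^ d * (K ^ q * x ^ (-β * q)) := by
            gcongr; exact sinh_le_lin hx.1 (hx.2.trans hρ1)
        _ = _ := by
            rw [mul_pow, ← rpow_natCast x d, show (d:ℝ) - β * q = d + -β * q by ring, rpow_add hx0]; ring
    rw [intervalIntegral.integral_const_mul, integral_rpow (Or.inl (by linarith)),
      Real.zero_rpow (by simp only [γ] at hγ; linarith), sub_zero] at e1
    have e3 : ρ ^ (d - β * q + 1) ≤ sinh ρ ^ d * ρ ^ (-1 - β') := by
      calc ρ ^ (d - β * q + 1) = ρ ^ d * ρ ^ (1 - β * q) := by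
            rw [← rpow_natCast ρ d, ← rpow_add hρ0]; ring_nf
        _ ≤ _ := by
            have : ρ ≤ sinh ρ := (Real.self_le_sinh_iff).2 hρ0.le
            refine mul_le_mul (by gcongr) (Real.rpow_le_rpow_of_exponent_ge hρ0 hρ1 (by linarith)) (by positivity) (by have := sinh_nn hρ0.le; positivity)
    calc _ ≤ _ := e1
      _ = K1 * ρ ^ (d - β * q + 1) := by
          rw [show (d:ℝ) - β * q + 1 = γ by simp only [γ]; ring]; simp only [K1]; ring
      _ ≤ K1 * (sinh ρ ^ d * ρ ^ (-1 - β')) := by gcongr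
      _ = _ := by ring
  have hb : ∫ x in r..1, K1 * x ^ (-1 - β') ≤ K1 * (r ^ (-max β' 0) / |β'|) := by
    rw [intervalIntegral.integral_const_mul, integral_rpow (Or.inr ⟨fun hh => hβ' (by linarith), by
      rw [uIcc_of_le hr1]; exact fun hh => by linarith [hh.1]⟩)]
    refine mul_le_mul_of_nonneg_left ?_ (by positivity)
    rw [show -1 - β' + 1 = -β' by ring, Real.one_rpow]
    have hrp : 0 < r ^ (-β') := by positivity
    rcases lt_or_gt_of_ne hβ' with hn | hn
    · rw [max_eq_right hn.le, abs_of_neg hn, neg_zero, Real.rpow_zero]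
      have : 0 < -β' := by linarith
      gcongr; linarith
    · rw [max_eq_left hn.le, abs_of_pos hn, div_neg, ← neg_div]
      gcongr; linarith
  have hB : ContinuousOn (fun x : ℝ => K1 * x ^ (-1 - β')) (Ioi 0) :=
    continuousOn_const.mul (continuousOn_id.rpow_const fun x hx => Or.inl (ne_of_gt hx))
  have htt : t' < t := by simp only [t']; linarith
  have key := h.pair0 (by linarith) htt ht.2 hr hB hr1 hU hb
  have hsub' : uIcc t' t ⊆ Ioo 0 T := by
    rw [uIcc_of_le htt.le]; exact fun x hx => ⟨by linarith [hx.1], hx.2.trans_lt ht.2⟩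
  have hε2 : 0 < ε/2 := by linarith
  have e2 : ∫ s in t'..t, v r t ≤ ∫ s in t'..t, D * v r s :=
    intervalIntegral.integral_mono_on htt.le intervalIntegrable_const ((h.sol.sm.iis hr.le hsub').const_mul _)
      fun x hx => h.bc' hε2 (hτ1.trans hx.1) hx.2 ht.2 hr.le
  have e3 : ∫ s in t'..t, v 1 s ≤ ∫ s in t'..t, D * C0 * C * Λ t := by
    refine intervalIntegral.integral_mono_on htt.le (h.sol.sm.iis zero_le_one hsub') intervalIntegrable_const
      fun x hx => (h.bc' hε2 hτ1 hx.1 (hx.2.trans_lt ht.2) zero_le_one).trans ?_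
    have := hC0' t' ⟨hτ1, ht'I.2⟩ 1 one_pos le_rfl
    rw [Real.one_rpow, mul_one] at this
    calc _ ≤ D * (C0 * (C * Λ t)) := by
          simp only [D]; gcongr; exact this.trans (by gcongr)
      _ = _ := by ring
  rw [intervalIntegral.integral_const, smul_eq_mul] at e2 e3
  rw [intervalIntegral.integral_const_mul] at e2
  rw [show t - t' = τ by simp only [t']; ring] at e2 e3
  have hrm : 1 ≤ r ^ (-max β' 0) := Real.one_le_rpow_of_pos_of_le_one_of_nonpos hr hr1 (by simp)
  have k2 : τ * v r t ≤ τ * (C1 * Λ t * r ^ (-max β' 0)) := by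
    calc τ * v r t ≤ D * (τ * (D * C0 * C * Λ t) + K1 * (r ^ (-max β' 0) / |β'|)) := by
          refine e2.trans ?_
          gcongr; linarith
      _ ≤ D * (τ * (D * C0 * C * Λ t) * r ^ (-max β' 0) + cosh 1 ^ d / γ * ((C0 * C) ^ q * C * τ * Λ t) * (r ^ (-max β' 0) / |β'|)) := by
          simp only [K1]; gcongr ?_ * (?_ + ?_ * ?_ * ?_)
          exact le_mul_of_one_le_right (by positivity) hrm
      _ = _ := by simp only [C1]; ring
  exact le_of_mul_le_mul_left k2 hτ

/-- the rate -/
noncomputable def La (q T t : ℝ) : ℝ := (T - t) ^ (1/(q-1))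

lemma La_pos (ht : t < T) : 0 < La q T t := rpow_pos_of_pos (by linarith) _

lemma sqrt_rate (h : GS d q T v) (ht : t < T) {C : ℝ} (hC : 0 < C) : √(C * (T - t) ^ (2/(q-1))) = √C * La q T t := by
  rw [Real.sqrt_mul hC.le, Real.sqrt_eq_rpow (_ ^ _), ← rpow_mul (by linarith), La]
  congr 2; ring

lemma near0 (h : GS d q T v) : DecN T v (La q T) 0 := by
  have hq := h.hq
  have hd := h.hd'
  have hΛ : Adm q T (La q T) := h.adm_rate
  obtain ⟨β0, hβ0, hb1, hb2, hD0⟩ : ∃ β0 > 0, β0 * (q-1) < 2 ∧ β0 * q < d + 1 ∧ DecN T v (La q T) β0 := by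
    have hs := h.hsub
    set η := (d + 3 - (d-1) * q) / (2 * q)
    have hη : 0 < η := div_pos (by linarith) (by linarith)
    have hηq : η * q = (d + 3 - (d-1) * q) / 2 := by simp only [η]; field_simp
    refine ⟨((d:ℝ)-1+η)/2, by linarith, by nlinarith, by nlinarith, fun ε hε => ?_⟩
    obtain ⟨C, hC, hC'⟩ := h.E_rate hε
    obtain ⟨C1, hC1, hC1'⟩ := h.v_near hη
    refine ⟨√C * C1, by positivity, fun t ht r hr hr1 => ?_⟩
    have := hC1' t ⟨hε.1.trans_le ht.1, ht.2⟩ _ (mul_pos hC (rpow_pos_of_pos (by linarith [ht.2]) _)) (hC' t ht) r hr hr1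
    rw [h.sqrt_rate ht.2 hC, neg_div] at this
    exact this.trans (le_of_eq (by ring))
  set δ := 2 - β0 * (q-1)
  have hδ : 0 < δ := by simp only [δ]; linarith
  have P : ∀ n : ℕ, ∃ β, 0 ≤ β ∧ β ≤ max 0 (β0 - n * (δ/2)) ∧ DecN T v (La q T) β := by
    intro n
    induction n with
    | zero => exact ⟨β0, hβ0.le, by simp, hD0⟩
    | succ n ih =>
      obtain ⟨β, h0, h1, h2⟩ := ih
      have hβ : β ≤ β0 := h1.trans (max_le hβ0.le (sub_le_self _ (by positivity)))
      have hb : β * q - 2 ≤ β - δ := by simp only [δ]; nlinarith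
      have hbq : β * q < d + 1 := by nlinarith
      obtain ⟨β', hn, hl, hu⟩ : ∃ β', β' ≠ 0 ∧ β - δ ≤ β' ∧ β' ≤ β - δ/2 := by
        by_cases hc : β - δ = 0
        · exact ⟨β - δ/2, by intro; linarith, by linarith, le_rfl⟩
        · exact ⟨β - δ, hc, le_rfl, by linarith⟩
      refine ⟨max β' 0, le_max_right _ _, ?_, h.near_step hΛ h2 hbq hn (by linarith)⟩
      push_cast
      rcases le_max_iff.1 h1 with h1 | h1
      · exact max_le ((by linarith : β' ≤ 0).trans (le_max_left _ _)) (le_max_left _ _)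
      · exact max_le ((by linarith : β' ≤ β0 - (n+1) * (δ/2)).trans (le_max_right _ _)) (le_max_left _ _)
  obtain ⟨n, hn⟩ := exists_nat_gt (β0 / (δ/2))
  rw [div_lt_iff₀ (by linarith)] at hn
  obtain ⟨β, h0, h1, h2⟩ := P n
  rw [max_eq_left (by linarith)] at h1
  rwa [le_antisymm h1 h0] at h2

lemma decR (h : GS d q T v) : Dec d T v (La q T) d := by
  refine h.dec_full h.adm_rate fun ε hε => ?_
  have hd := h.hd'
  obtain ⟨C, hC, hC'⟩ := h.E_rate hε
  obtain ⟨C1, hC1, hC1'⟩ := h.near0 ε hε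
  refine ⟨C1 * exp ((d:ℝ)/2) + √C * √(3 ^ d), by positivity, fun t ht => ?_⟩
  have htI : t ∈ Ioo 0 T := ⟨hε.1.trans_le ht.1, ht.2⟩
  have hL := La_pos (q := q) ht.2
  suffices H : ∀ r, 0 < r → v r t ≤ (C1 * exp ((d:ℝ)/2) + √C * √(3 ^ d)) * La q T t * exp (-(d/2) * r) by
    intro r hr
    have hc : ContinuousOn (fun r => (C1 * exp ((d:ℝ)/2) + √C * √(3 ^ d)) * La q T t * exp (-(d/2) * r) - v r t) (Ici 0) :=
      (by fun_prop : Continuous fun r : ℝ => (C1 * exp ((d:ℝ)/2) + √C * √(3 ^ d)) * La q T t * exp (-(d/2) * r)).continuousOn.sub (h.sol.sm.contr htI)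
    have : r ∈ closure (Ioi (0:ℝ)) := by rw [closure_Ioi]; exact hr
    have h3 := (hc r hr).mono_left (nhdsWithin_mono r Ioi_subset_Ici_self)
    haveI := mem_closure_iff_nhdsWithin_neBot.1 ‹r ∈ closure (Ioi (0:ℝ))›
    exact sub_nonneg.1 (ge_of_tendsto h3 (eventually_mem_nhdsWithin.mono fun x hx => sub_nonneg.2 (H x hx)))
  intro r hr
  rcases le_total r 1 with hr1 | hr1
  · have := hC1' t ht r hr hr1
    rw [neg_zero, Real.rpow_zero, mul_one] at this
    refine this.trans ?_
    have : 1 ≤ exp ((d:ℝ)/2) * exp (-(d/2) * r) := by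
      rw [← exp_add]; refine Real.one_le_exp ?_
      nlinarith
    calc C1 * La q T t ≤ C1 * La q T t * (exp ((d:ℝ)/2) * exp (-(d/2) * r)) := le_mul_of_one_le_right (by positivity) this
      _ = (C1 * exp ((d:ℝ)/2)) * La q T t * exp (-(d/2) * r) := by ring
      _ ≤ _ := by gcongr; exact le_add_of_nonneg_right (by positivity)
  · have := h.v_far htI (mul_pos hC (rpow_pos_of_pos (by linarith [ht.2]) _)) (hC' t ht) hr1
    rw [h.sqrt_rate ht.2 hC] at this
    refine this.trans ?_
    calc _ = (√C * √(3 ^ d)) * La q T t * exp (-(d/2) * r) := by ring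
      _ ≤ _ := by gcongr; exact le_add_of_nonneg_left (by positivity)

lemma La_q (h : GS d q T v) (ht : t < T) : La q T t ^ (q-1) = T - t := by
  have := h.hq
  rw [La, ← rpow_mul (by linarith), one_div_mul_cancel (by linarith), rpow_one]

lemma fluxR (h : GS d q T v) : ∀ ε ∈ Ioo 0 T, ∃ C > 0, ∀ t ∈ Ico ε T, ∀ r, 0 ≤ r →
    |sinh r ^ d * Dr v r t| ≤ C * La q T t :=
  h.flux_bd (fun t ht => La_pos ht.2) h.hT (fun t ht => by
    have := La_pos (q := q) ht.2
    have e : La q T t ^ q = La q T t ^ (q - 1) * La q T t := by rw [← rpow_add_one this.ne']; ring_nf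
    rw [e, h.La_q ht.2]
    gcongr; linarith [ht.1]) h.decR

end GS

lemma HH_le (d : ℕ) {r r1 : ℝ} (h1 : 0 < r1) (hr : r1 ≤ r) : HH d r ≤ d + d * (1/r1 + 2) * exp (-(2*r)) := by
  have hr0 : 0 < r := by linarith
  have hs := sinh_pos' hr0
  have hl := sinh_lower hr0
  have : cosh r / sinh r ≤ 1 + (1/r1+2) * exp (-(2*r)) := by
    rw [div_le_iff₀ hs]
    have e1 : cosh r = sinh r + exp (-r) := by rw [Real.cosh_eq, Real.sinh_eq]; ring
    have e2 : exp (-r) = (1/r+2) * exp (-(2*r)) * (r/(1+2*r) * exp r) := by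
      rw [show -r = -(2*r) + r by ring, exp_add]; field_simp
    have e3 : (1/r+2) * exp (-(2*r)) * (r/(1+2*r) * exp r) ≤ (1/r1+2) * exp (-(2*r)) * sinh r := by
      gcongr
    rw [e1, e2]; linarith
  unfold HH
  calc _ ≤ (d:ℝ) * (1 + (1/r1+2) * exp (-(2*r))) := by gcongr
    _ = _ := by ring

/-- backward lower bound -/
lemma low_back {d : ℕ} {f f1 f2 : ℝ → ℝ} {K R : ℝ} (hd : 1 ≤ d) (hK : 0 ≤ K) (hR : 0 ≤ R)
    (h1 : ∀ x > 0, HasDerivAt f (f1 x) x) (h2 : ∀ x > 0, HasDerivAt f1 (f2 x) x)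
    (c0 : ContinuousOn f (Ici 0)) (c1 : ContinuousOn f1 (Ici 0)) (hf : ∀ x, 0 ≤ x → 0 < f x)
    (hL : ∀ x > 0, f2 x + HH d x * f1 x ≤ K * f x) : ∀ x ∈ Icc 0 R, f R * exp (-(K * R^2/2)) ≤ f x := by
  have cs : ∀ R, Icc (0:ℝ) R ⊆ Ici 0 := fun R x hx => hx.1
  have key : ∀ x > 0, f1 x ≤ K * x * f x := by
    intro x hx
    have hc : ContinuousOn (fun y => sinh y ^ d * f1 y / f y - K * y * sinh y ^ d) (Icc 0 x) :=
      (((Real.continuous_sinh.pow d).continuousOn.mul (c1.mono (cs x))).div (c0.mono (cs x)) fun y hy => (hf y hy.1).ne').sub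
        ((continuous_const.mul continuous_id).mul (Real.continuous_sinh.pow d)).continuousOn
    have hder : ∀ y ∈ interior (Icc 0 x), HasDerivAt (fun y => sinh y ^ d * f1 y / f y - K * y * sinh y ^ d)
        (sinh y ^ d * ((f2 y + HH d y * f1 y) / f y - (f1 y / f y) ^ 2 - K - K * y * HH d y)) y := by
      intro y hy
      rw [interior_Icc] at hy
      have := ((((hasDeriv_w d hy.1).mul (h2 y hy.1)).div (h1 y hy.1) (hf y hy.1.le).ne')).sub
        (((hasDerivAt_id y).const_mul K).mul (hasDeriv_w d hy.1))
      refine this.congr_deriv ?_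
      have := (hf y hy.1.le).ne'
      simp only [id]
      simp only [Pi.mul_apply]
      field_simp; ring
    have := (antitoneOn_of_hasDerivWithinAt_nonpos (convex_Icc 0 x) hc (fun y hy => (hder y hy).hasDerivWithinAt) fun y hy => by
      rw [interior_Icc] at hy
      have hw := pow_pos (sinh_pos' hy.1) d
      have hH := HH_ge d hy.1
      have e : (f2 y + HH d y * f1 y) / f y ≤ K := by rw [div_le_iff₀ (hf y hy.1.le)]; exact hL y hy.1
      have : 0 ≤ K * y * HH d y := by have : (0:ℝ) ≤ d := by positivity
                                      have := hy.1.le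
                                      have : 0 ≤ HH d y := by linarith
                                      positivity
      refine mul_nonpos_of_nonneg_of_nonpos hw.le ?_
      nlinarith [sq_nonneg (f1 y / f y)]) ⟨le_rfl, hx.le⟩ ⟨hx.le, le_rfl⟩ hx.le
    simp only [sinh_zero, zero_pow (by omega : d ≠ 0)] at this
    have hw := pow_pos (sinh_pos' hx) d
    have hfx := hf x hx.le
    rw [show sinh x ^ d * f1 x / f x - K * x * sinh x ^ d = sinh x ^ d * (f1 x - K * x * f x) / f x by field_simp] at this
    simp only [zero_mul, zero_div, mul_zero, sub_zero] at this
    by_contra hc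
    push Not at hc
    have : 0 < sinh x ^ d * (f1 x - K * x * f x) / f x := div_pos (mul_pos hw (by linarith)) hfx
    linarith
  intro x hx
  have hc : ContinuousOn (fun y => f y * exp (-(K * y^2/2))) (Icc 0 R) := (c0.mono (cs R)).mul (by fun_prop)
  have hder : ∀ y ∈ interior (Icc 0 R), HasDerivWithinAt (fun y => f y * exp (-(K * y^2/2))) ((f1 y - K * y * f y) * exp (-(K * y^2/2))) (interior (Icc 0 R)) y := by
    intro y hy
    rw [interior_Icc] at hy
    have e := ((((hasDerivAt_pow 2 y).const_mul K).div_const 2).neg).exp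
    refine (((h1 y hy.1).mul e).congr_deriv ?_).hasDerivWithinAt
    simp only [Nat.cast_ofNat, Pi.neg_apply]; ring
  have := antitoneOn_of_hasDerivWithinAt_nonpos (convex_Icc 0 R) hc hder (fun y hy => by
    rw [interior_Icc] at hy
    exact mul_nonpos_of_nonpos_of_nonneg (by linarith [key y hy.1]) (exp_pos _).le) hx ⟨hR, le_rfl⟩ hx.2
  refine this.trans ?_
  exact mul_le_of_le_one_right (hf x hx.1).le (exp_le_one_iff.2 (by have := sq_nonneg x; simp only [Left.neg_nonpos_iff]; positivity))

/-- forward lower bound -/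
lemma low_fwd {d : ℕ} {K γ r1 : ℝ} (hd : 1 ≤ d) (hK : 0 < K) (hγ : 0 < γ) (hr1 : 0 < r1) : ∃ c > 0, ∀ f f1 f2 : ℝ → ℝ,
    (∀ x > 0, HasDerivAt f (f1 x) x) → (∀ x > 0, HasDerivAt f1 (f2 x) x) → (∀ x, 0 ≤ x → 0 < f x) →
    (∀ x > 0, f2 x + HH d x * f1 x ≤ K * exp (-γ * x) * f x) →
    ∀ R, r1 ≤ R → ∀ x, R ≤ x → c * f R * exp (-d * x) ≤ f x := by
  have hd' : (1:ℝ) ≤ d := by exact_mod_cast hd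
  set g := min γ 2
  have hg : 0 < g := lt_min hγ two_pos
  set C1 := (d:ℝ) * (1/r1 + 2)
  have hC1 : 0 < C1 := by positivity
  set B := C1/g + K/g^2
  have hB : 0 < B := by positivity
  have hB1 : C1 ≤ B * g := by
    have : B * g = C1 + K/g := by simp only [B]; field_simp
    rw [this]; have : 0 < K/g := by positivity
    linarith
  have hB2 : K ≤ B * g^2 := by
    have : B * g^2 = C1 * g + K := by simp only [B]; field_simp
    rw [this]; nlinarith
  refine ⟨exp (-B), exp_pos _, fun f f1 f2 h1 h2 hf hL R hR => ?_⟩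
  set φ : ℝ → ℝ := fun x => exp (-d * x + B * exp (-g * x))
  set ψ : ℝ → ℝ := fun x => -(d:ℝ) - B * g * exp (-g * x)
  have hex : ∀ x, HasDerivAt (fun x => exp (-g * x)) (-g * exp (-g * x)) x := fun x => by
    have := ((hasDerivAt_id x).const_mul (-g)).exp
    simp only [id] at this; exact this.congr_deriv (by ring)
  have hφ : ∀ x, HasDerivAt φ (φ x * ψ x) x := fun x => by
    have := (((hasDerivAt_id x).const_mul (-(d:ℝ))).add ((hex x).const_mul B)).exp
    simp only [id] at this; refine this.congr_deriv ?_
    simp only [φ, ψ, Pi.add_apply, id]; ring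
  have hψ : ∀ x, HasDerivAt ψ (B * g^2 * exp (-g * x)) x := fun x =>
    (((hex x).const_mul (B*g)).const_sub (-(d:ℝ))).congr_deriv (by ring)
  have hφp : ∀ x, 0 < φ x := fun x => exp_pos _
  set G : ℝ → ℝ := fun x => sinh x ^ d * (f1 x * φ x - f x * (φ x * ψ x))
  have hG : ∀ x > 0, HasDerivAt G (sinh x ^ d * φ x * ((f2 x + HH d x * f1 x) - f x * (ψ x * (ψ x + HH d x) + B * g^2 * exp (-g * x)))) x := by
    intro x hx
    refine ((hasDeriv_w d hx).mul (((h2 x hx).mul (hφ x)).sub ((h1 x hx).mul ((hφ x).mul (hψ x))))).congr_deriv ?_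
    simp only [Pi.mul_apply, Pi.sub_apply]; ring
  have hGle : ∀ x ≥ r1, sinh x ^ d * φ x * ((f2 x + HH d x * f1 x) - f x * (ψ x * (ψ x + HH d x) + B * g^2 * exp (-g * x))) ≤ 0 := by
    intro x hx
    have hx0 : 0 < x := by linarith
    have hw := pow_pos (sinh_pos' hx0) d
    refine mul_nonpos_of_nonneg_of_nonpos (mul_pos hw (hφp x)).le ?_
    have e1 := hL x hx0
    have e2 := HH_le d hr1 hx
    have e3 : exp (-(2*x)) ≤ exp (-g * x) := by gcongr; nlinarith [min_le_right γ 2]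
    have e4 : exp (-γ * x) ≤ exp (-g * x) := by gcongr; exact min_le_left γ 2
    have ep := exp_pos (-g * x)
    have e5 : ψ x + HH d x ≤ 0 := by
      simp only [ψ]
      have : C1 * exp (-(2*x)) ≤ B * g * exp (-g * x) := by gcongr
      linarith
    have e6 : ψ x ≤ 0 := by
      simp only [ψ]; have : 0 < B * g * exp (-g * x) := by positivity
      linarith
    have e7 : 0 ≤ ψ x * (ψ x + HH d x) := mul_nonneg_of_nonpos_of_nonpos e6 e5
    have e8 : K * exp (-γ * x) ≤ B * g^2 * exp (-g * x) := by gcongr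
    have := hf x hx0.le
    nlinarith
  have hGanti : AntitoneOn G (Ici r1) :=
    antitoneOn_of_hasDerivWithinAt_nonpos (convex_Ici r1) (fun x hx => (hG x (hr1.trans_le hx)).continuousAt.continuousWithinAt)
      (fun x hx => (hG x (hr1.trans_le (interior_subset hx))).hasDerivWithinAt) fun x hx => hGle x (interior_subset hx)
  have hz : ∀ x > 0, HasDerivAt (fun x => f x / φ x) (G x / (sinh x ^ d * φ x ^ 2)) x := by
    intro x hx
    refine ((h1 x hx).div (hφ x) (hφp x).ne').congr_deriv ?_
    have := (pow_pos (sinh_pos' hx) d).ne'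
    have := (hφp x).ne'
    simp only [G]; field_simp
  have hG0 : ∀ x ≥ r1, 0 ≤ G x := by
    intro x hx
    by_contra hneg
    push Not at hneg
    set c := -G x * exp (-(2*B))
    have hc : 0 < c := mul_pos (by linarith) (exp_pos _)
    have hx0 : 0 < x := by linarith
    have hd1 : ∀ y ≥ x, G y / (sinh y ^ d * φ y ^ 2) ≤ -c := by
      intro y hy
      have hy0 : 0 < y := by linarith
      have hw := pow_pos (sinh_pos' hy0) d
      have hp := pow_pos (hφp y) 2
      rw [div_le_iff₀ (by positivity)]
      have e1 : G y ≤ G x := hGanti hx (hx.trans hy) hy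
      have e2 : sinh y ^ d * φ y ^ 2 ≤ exp (2*B) := by
        calc _ ≤ exp (d * y) * φ y ^ 2 := by gcongr; exact w_le_exp d hy0.le
          _ = exp (-(d*y) + 2 * B * exp (-g * y)) := by
              simp only [φ]; rw [← Real.exp_nat_mul, ← exp_add]; push_cast; ring_nf
          _ ≤ _ := by
              gcongr
              have : exp (-g * y) ≤ 1 := exp_le_one_iff.2 (by nlinarith)
              nlinarith
      have e3 : c * (sinh y ^ d * φ y ^ 2) ≤ c * exp (2*B) := by gcongr
      have e4 : c * exp (2*B) = -G x := by simp only [c]; rw [mul_assoc, ← exp_add]; simp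
      nlinarith
    set y := x + (f x / φ x) / c + 1
    have hzx : 0 < f x / φ x := div_pos (hf x hx0.le) (hφp x)
    have hxy : x ≤ y := by simp only [y]; have : 0 < (f x / φ x)/c := by positivity
                           linarith
    have := le_of_der hxy (fun s hs => hz s (hx0.trans_le hs.1)) (fun s hs => hd1 s hs.1)
    have hzy : 0 < f y / φ y := div_pos (hf y (by linarith)) (hφp y)
    have : -c * (y - x) = -(f x / φ x) - c := by simp only [y]; field_simp; ring
    linarith
  intro x hx
  have hm : MonotoneOn (fun x => f x / φ x) (Ici r1) :=
    monotoneOn_of_hasDerivWithinAt_nonneg (convex_Ici r1) (fun x hx => (hz x (hr1.trans_le hx)).continuousAt.continuousWithinAt)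
      (fun x hx => (hz x (hr1.trans_le (interior_subset hx))).hasDerivWithinAt) fun x hx => by
        have := hG0 x (interior_subset hx)
        have := pow_pos (sinh_pos' (hr1.trans_le (interior_subset hx))) d
        positivity
  have e := hm hR (hR.trans hx) hx
  simp only at e
  rw [div_le_div_iff₀ (hφp R) (hφp x)] at e
  have hx0 : 0 < x := by linarith
  have e1 : exp (-d * x) ≤ φ x := by simp only [φ]; gcongr; have := exp_pos (-g * x); nlinarith
  have e2 : φ R ≤ exp B := by
    simp only [φ]; gcongr
    have : exp (-g * R) ≤ 1 := exp_le_one_iff.2 (by nlinarith)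
    nlinarith
  have hfR := hf R (by linarith)
  have hfx := hf x hx0.le
  have e3 : f R * exp (-d * x) ≤ f x * exp B := by
    calc _ ≤ f R * φ x := by gcongr
      _ ≤ f x * φ R := e
      _ ≤ _ := by gcongr
  calc _ = exp (-B) * (f R * exp (-d * x)) := by ring
    _ ≤ exp (-B) * (f x * exp B) := by gcongr
    _ = f x := by rw [mul_left_comm, ← exp_add]; simp

namespace GS
variable {d : ℕ} {q T : ℝ} {v : ℝ → ℝ → ℝ} {r s t ε : ℝ}

lemma pt (h : GS d q T v) (hε : ε ∈ Ioo 0 T) : ∃ r1 > 0, ∃ R0, ∃ c > 0, ∀ t ∈ Ico ε T, ∃ x, r1 ≤ x ∧ x ≤ R0 ∧ c * La q T t ≤ v x t := by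
  have hq := h.hq
  have hd := h.hd'
  have hdq : 0 < d * q - 1 := by nlinarith
  obtain ⟨c, hc, hc'⟩ := h.A_lower hε
  obtain ⟨C, hC, hC'⟩ := h.decR ε hε
  set R0 := Real.log (C ^ (q+1) / c) / (d * q - 1)
  set c1 := c * exp (-R0) / C ^ (q+1)
  have hc1 : 0 < c1 := by positivity
  obtain ⟨r1, hr1, hr1'⟩ : ∃ r1 > 0, ∀ x, 0 ≤ x → x < r1 → sinh x ^ d < c1 := by
    have hcont : Tendsto (fun x => sinh x ^ d) (𝓝 0) (𝓝 (sinh 0 ^ d)) := (by fun_prop : Continuous fun x => sinh x ^ d).tendsto 0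
    rw [sinh_zero, zero_pow (by have := h.hd; omega)] at hcont
    obtain ⟨δ, hδ, h1⟩ := Metric.eventually_nhds_iff.1 (hcont.eventually (gt_mem_nhds hc1))
    exact ⟨δ, hδ, fun x h0 hx => h1 (by rw [Real.dist_eq, sub_zero, abs_of_nonneg h0]; exact hx)⟩
  set c2 := (c * exp (-R0) * exp (-(d * R0))) ^ (1/(q+1))
  refine ⟨r1, hr1, R0, c2, by positivity, fun t ht => ?_⟩
  have htI : t ∈ Ioo 0 T := ⟨hε.1.trans_le ht.1, ht.2⟩
  have hL := La_pos (q := q) ht.2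
  obtain ⟨R, hR, hA⟩ := hc' t ht
  have hLq : (T - t) ^ ((q+1)/(q-1)) = La q T t ^ (q+1) := by
    rw [La, ← rpow_mul (by linarith [ht.2])]; ring_nf
  rw [hLq] at hA
  set M := La q T t ^ (q+1)
  have hM : 0 < M := by positivity
  obtain ⟨x, hx, hxx⟩ : ∃ x ∈ Icc 0 R, c * M * exp (-1 * x) ≤ v x t ^ (q+1) * sinh x ^ d := by
    by_contra hno
    push Not at hno
    have e1 : AR d q v R t ≤ ∫ x in (0:ℝ)..R, c * M * exp (-1 * x) :=
      intervalIntegral.integral_mono_on (by linarith) (((h.sol.sm.rpow h.sol.pos (q+1)).mul (Sm.of (F := fun x _ => sinh x ^ d) (by fun_prop))).ii le_rfl (by linarith) htI)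
        ((by fun_prop : Continuous fun x : ℝ => c * M * exp (-1 * x)).intervalIntegrable _ _) fun x hx => (hno x hx).le
    have e2 : ∫ x in (0:ℝ)..R, exp (-1 * x) = 1 - exp (-R) := by
      have : ∀ x ∈ uIcc 0 R, HasDerivAt (fun x => -exp (-1 * x)) (exp (-1 * x)) x := fun x _ => by
        have := (((hasDerivAt_id x).const_mul (-1)).exp).neg
        simp only [id] at this; exact this.congr_deriv (by ring)
      rw [intervalIntegral.integral_eq_sub_of_hasDerivAt this ((by fun_prop : Continuous fun x : ℝ => exp (-1 * x)).intervalIntegrable _ _)]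
      simp; ring
    rw [intervalIntegral.integral_const_mul, e2] at e1
    have : 0 < c * M * exp (-R) := by positivity
    linarith
  have hp := h.sol.pos x hx.1 t htI
  have hu := hC' t ht x hx.1
  have hw := sinh_nn hx.1
  have hwe := w_le_exp d hx.1
  have hvq : v x t ^ (q+1) ≤ C ^ (q+1) * M * exp (-d * x * (q+1)) := by
    rw [exp_mul, ← mul_rpow hC.le hL.le, ← mul_rpow (by positivity) (by positivity)]
    exact rpow_le_rpow hp.le hu (by linarith)
  have hxR : x ≤ R0 := by
    have e1 : c * M * exp (-1 * x) ≤ C ^ (q+1) * M * exp (-d * x * (q+1)) * exp (d * x) :=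
      hxx.trans (mul_le_mul hvq hwe (by positivity) (by positivity))
    have e2 : exp ((d * q - 1) * x) ≤ C ^ (q+1) / c := by
      rw [le_div_iff₀ hc]
      have e3 : (exp ((d * q - 1) * x) * c) * (M * exp (-(d*q)*x)) ≤ C ^ (q+1) * (M * exp (-(d*q)*x)) := by
        calc _ = c * M * exp (-1 * x) := by
              rw [show -1 * x = (d * q - 1) * x + -(d*q) * x by ring, exp_add]; ring
          _ ≤ _ := e1
          _ = _ := by rw [mul_assoc, ← exp_add, mul_assoc]; ring_nf
      exact le_of_mul_le_mul_right e3 (by positivity)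
    rw [le_div_iff₀ hdq, mul_comm, Real.le_log_iff_exp_le (by positivity)]; exact e2
  refine ⟨x, ?_, hxR, ?_⟩
  · by_contra hlt
    have h3 := hr1' x hx.1 (not_le.1 hlt)
    have e0 : v x t ^ (q+1) ≤ C ^ (q+1) * M := hvq.trans (mul_le_of_le_one_right (by positivity) (exp_le_one_iff.2 (by
      have := hx.1
      have : 0 ≤ d * x * (q+1) := by positivity
      linarith)))
    have e1 : c * M * exp (-R0) ≤ C ^ (q+1) * M * sinh x ^ d := by
      calc _ ≤ c * M * exp (-1 * x) := by gcongr; linarith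
        _ ≤ _ := hxx
        _ ≤ _ := by gcongr
    have e2 : C ^ (q+1) * M * sinh x ^ d < C ^ (q+1) * M * c1 := by gcongr
    have e3 : C ^ (q+1) * M * c1 = c * M * exp (-R0) := by simp only [c1]; field_simp
    linarith
  · have e1 : c * exp (-R0) * exp (-(d * R0)) * M ≤ v x t ^ (q+1) := by
      have : c * M * exp (-R0) ≤ v x t ^ (q+1) * exp (d * R0) := by
        calc _ ≤ c * M * exp (-1 * x) := by gcongr; linarith
          _ ≤ _ := hxx
          _ ≤ _ := by gcongr; exact hwe.trans (by gcongr)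
      calc _ = c * M * exp (-R0) * exp (-(d * R0)) := by ring
        _ ≤ v x t ^ (q+1) * exp (d * R0) * exp (-(d * R0)) := by gcongr
        _ = _ := by rw [mul_assoc, ← exp_add]; simp
    have e2 : (c2 * La q T t) ^ (q+1) ≤ v x t ^ (q+1) := by
      rw [mul_rpow (by positivity) hL.le, ← rpow_mul (by positivity), one_div_mul_cancel (by linarith), rpow_one]
      exact e1
    exact (Real.rpow_le_rpow_iff (by positivity) hp.le (by linarith)).1 e2

lemma low (h : GS d q T v) : ∀ ε ∈ Ioo 0 T, ∃ c > 0, ∀ t ∈ Ico ε T, ∀ r, 0 ≤ r →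
    c * La q T t * exp (-d * r) ≤ v r t := by
  intro ε hε
  have hq := h.hq
  have hd := h.hd'
  have hT := h.hT
  have hε0 := hε.1
  have hq1 : 0 < q - 1 := by linarith
  obtain ⟨r1, hr1, R0, c, hc, hpt⟩ := h.pt hε
  obtain ⟨C, hC, hC'⟩ := h.decR ε hε
  set K := q * (2 / ((q-1) * ε)) * (C ^ (q-1) * T)
  have hK : 0 < K := by positivity
  obtain ⟨c1, hc1, hF⟩ := low_fwd (d := d) (γ := (q-1)*d) h.hd hK (by positivity) hr1
  set c2 := c * exp (-(K * R0^2/2))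
  refine ⟨min (c1 * c) c2, lt_min (by positivity) (by positivity), fun t ht r hr => ?_⟩
  have htI : t ∈ Ioo 0 T := ⟨hε.1.trans_le ht.1, ht.2⟩
  have hL := La_pos (q := q) ht.2
  obtain ⟨x, hx1, hx2, hx3⟩ := hpt t ht
  have hI : IsOpen (Ioo 0 T) := isOpen_Ioo
  have p1 : ∀ x > 0, HasDerivAt (fun r => v r t) (Dr v x t) x := fun x hx => h.sol.sm.hasDr' hx htI
  have p2 : ∀ x > 0, HasDerivAt (fun r => Dr v r t) (Dr (Dr v) x t) x := fun x hx => (h.sol.sm.dr hI).hasDr' hx htI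
  have p3 : ∀ x, 0 ≤ x → 0 < v x t := fun x hx => h.sol.pos x hx t htI
  have p4 : ∀ x > 0, Dr (Dr v) x t + HH d x * Dr v x t ≤ K * exp (-((q-1)*d) * x) * v x t := by
    intro x hx
    have e := h.sol.equ hI hx htI
    have e1 := h.dsu_le hε0 ht.1 ht.2 hx.le
    rw [e, one_mul, LL] at e1
    refine e1.trans ?_
    have hp := p3 x hx.le
    have e2 : v x t ^ (q-1) ≤ C ^ (q-1) * T * exp (-((q-1)*d) * x) := by
      calc _ ≤ (C * La q T t * exp (-d * x)) ^ (q-1) := rpow_le_rpow hp.le (hC' t ht x hx.le) hq1.le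
        _ = C ^ (q-1) * (T - t) * exp (-((q-1)*d) * x) := by
            rw [mul_rpow (by positivity) (by positivity), mul_rpow hC.le hL.le, h.La_q ht.2, ← exp_mul]; ring_nf
        _ ≤ _ := by gcongr; linarith [htI.1]
    calc q * (2 / ((q-1) * ε)) * v x t ^ q = q * (2 / ((q-1) * ε)) * v x t ^ (q-1) * v x t := by
          rw [mul_assoc _ (v x t ^ (q-1)), ← rpow_add_one hp.ne']; ring_nf
      _ ≤ q * (2 / ((q-1) * ε)) * (C ^ (q-1) * T * exp (-((q-1)*d) * x)) * v x t := by gcongr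
      _ = _ := by simp only [K]; ring
  have hd0 : (0:ℝ) ≤ d := by linarith
  rcases le_total r x with hrx | hrx
  · have := low_back h.hd hK.le (hr.trans hrx) p1 p2 (h.sol.sm.contr htI) ((h.sol.sm.dr hI).contr htI) p3 (fun x hx => (p4 x hx).trans (by
      have := p3 x hx.le
      have hxp : (0:ℝ) < x := hx
      have : exp (-((q-1)*d) * x) ≤ 1 := exp_le_one_iff.2 (by
        have : 0 ≤ (q-1)*d*x := by positivity
        linarith)
      gcongr
      exact mul_le_of_le_one_right hK.le this)) r ⟨hr, hrx⟩
    refine le_trans ?_ this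
    have hx0 : 0 ≤ x := hr.trans hrx
    calc _ ≤ c2 * La q T t * 1 := by
          gcongr
          · exact min_le_right _ _
          · exact exp_le_one_iff.2 (by nlinarith)
      _ = c * La q T t * exp (-(K * R0^2/2)) := by simp only [c2]; ring
      _ ≤ _ := by
          have := (p3 x hx0).le
          gcongr
  · have := hF _ _ _ p1 p2 p3 p4 x hx1 r hrx
    refine le_trans ?_ this
    calc _ ≤ (c1 * c) * La q T t * exp (-d * r) := by gcongr; exact min_le_left _ _
      _ = c1 * (c * La q T t) * exp (-d * r) := by ring
      _ ≤ _ := by gcongr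

end GS

abbrev IV : Set ℝ := Ioo (-4 : ℝ) 1
lemma hIV : IsOpen IV := isOpen_Ioo

open Classical in
noncomputable def Rc (c : ℝ) : ℝ := if c = 0 then 2 else 1/2
def InQ (c ρ r s : ℝ) : Prop := 0 ≤ r ∧ |r - c| ≤ ρ * Rc c ∧ -ρ ≤ s ∧ s ≤ 0
def Ctr (c : ℝ) : Prop := c = 0 ∨ 1 ≤ c

lemma Ctr.rc {c : ℝ} (h : Ctr c) : c = 0 ∧ Rc c = 2 ∨ 1 ≤ c ∧ Rc c = 1/2 := by
  unfold Rc
  rcases h with h | h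
  · exact Or.inl ⟨h, if_pos h⟩
  · exact Or.inr ⟨h, if_neg (by linarith)⟩

lemma Rc_pos (c : ℝ) : 0 < Rc c := by unfold Rc; split_ifs <;> norm_num

lemma InQ.mono {c ρ ρ' r s : ℝ} (h : InQ c ρ' r s) (hρ : ρ' ≤ ρ) : InQ c ρ r s := by
  obtain ⟨h1, h2, h3, h4⟩ := h
  exact ⟨h1, h2.trans (mul_le_mul_of_nonneg_right hρ (Rc_pos c).le), by linarith, h4⟩

lemma InQ.mem {c ρ r s : ℝ} (h : InQ c ρ r s) (hρ : ρ < 4) : s ∈ IV := ⟨by linarith [h.2.2.1], by linarith [h.2.2.2]⟩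

lemma HH_far {d : ℕ} {r : ℝ} (hr : 1/2 ≤ r) : HH d r ≤ 5 * d := by
  have := HH_le d (r1 := 1/2) (by norm_num) hr
  have h1 : exp (-(2*r)) ≤ 1 := exp_le_one_iff.2 (by linarith)
  have h2 : (d:ℝ) * (1/(1/2)+2) * exp (-(2*r)) ≤ (d:ℝ) * (1/(1/2)+2) * 1 := by gcongr
  linarith

lemma HH_nn {d : ℕ} {r : ℝ} (hr : 0 < r) : 0 ≤ HH d r := by
  have := sinh_pos' hr
  have := cosh_pos r
  unfold HH; positivity

lemma HH_mul {d : ℕ} {r : ℝ} (hr : 0 < r) (h2 : r ≤ 2) : HH d r * r ≤ d * cosh 2 := by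
  have h := sinh_pos' hr
  have h1 : r ≤ sinh r := Real.self_le_sinh_iff.2 hr.le
  have h3 : cosh r ≤ cosh 2 := Real.cosh_le_cosh.2 (by rw [abs_of_pos hr, abs_of_pos] <;> linarith)
  have := cosh_pos r
  unfold HH
  rw [mul_assoc]
  gcongr
  rw [div_mul_eq_mul_div, div_le_iff₀ h]
  nlinarith

lemma HH_cut {d : ℕ} {c ρ r s : ℝ} (hc : Ctr c) (hρ1 : ρ ≤ 1) (h : InQ c ρ r s) (hr : 0 < r) :
    HH d r * |r - c| ≤ d * (cosh 2 + 5) := by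
  have hd : (0:ℝ) ≤ d := Nat.cast_nonneg d
  have hH := HH_nn (d := d) hr
  have hch := cosh_pos 2
  have h2 := h.2.1
  rcases hc.rc with ⟨h0, hR⟩ | ⟨h0, hR⟩
  · rw [hR, h0, sub_zero, abs_of_pos hr] at h2
    rw [h0, sub_zero, abs_of_pos hr]
    have := HH_mul (d := d) hr (by linarith)
    linarith
  · rw [hR] at h2
    have h3 : |r - c| ≤ 1/2 := by linarith
    have h4 : 1/2 ≤ r := by linarith [(abs_le.1 h3).1]
    calc _ ≤ 5 * d * (1:ℝ) := by
          have := HH_far (d := d) h4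
          gcongr; linarith
      _ ≤ _ := by nlinarith

lemma cutoff (d : ℕ) {ρ : ℝ} (hρ : 0 < ρ) (hρ1 : ρ ≤ 1) : ∃ K > 0, ∀ c, Ctr c → ∃ η : ℝ → ℝ → ℝ, Sm IV η ∧
    (∀ r s, InQ c ρ r s → 0 ≤ η r s ∧ η r s ≤ 1 ∧ |Ds η r s| ≤ K ∧ |Dr η r s| ≤ K ∧ (0 < r → |LL d η r s| ≤ K) ∧
      (s = -ρ ∨ |r - c| = ρ * Rc c → η r s = 0)) ∧
    ∀ ρ', 0 < ρ' → ρ' < ρ → ∀ r s, InQ c ρ' r s → (1 - (ρ'/ρ)^2) * (ρ - ρ') ≤ η r s := by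
  refine ⟨1 + 4/ρ + 8/ρ^2 + 8/ρ^2 * (d * (cosh 2 + 5)), by have := cosh_pos 2; positivity, fun c hc => ?_⟩
  have hR := Rc_pos c
  have hR2 : 1/2 ≤ Rc c := by rcases hc.rc with h | h <;> linarith [h.2]
  have hb : 0 < ρ * Rc c := by positivity
  set b := ρ * Rc c with hbd
  have hb2 : 2/b^2 ≤ 8/ρ^2 := by
    have : ρ/2 ≤ b := by rw [hbd]; nlinarith
    calc 2/b^2 ≤ 2/(ρ/2)^2 := by gcongr
      _ = _ := by field_simp; norm_num
  have hch := cosh_pos 2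
  have hsm : Sm IV (fun r s => (1 - (r-c)^2/b^2) * (s + ρ)) :=
    Sm.of (F := fun r s => (1 - (r-c)^2/b^2) * (s + ρ)) (by fun_prop)
  have hDr : ∀ r s : ℝ, 0 ≤ r → Dr (fun r s => (1 - (r-c)^2/b^2) * (s + ρ)) r s = -(2*(r-c)/b^2)*(s+ρ) := by
    intro r s hr
    have := ((((((hasDerivAt_id r).sub_const c).pow 2).div_const (b^2)).const_sub 1).mul_const (s+ρ)).hasDerivWithinAt (s := Ici 0)
    exact Dr_eq hr (this.congr_deriv (by simp))
  have hDrr : ∀ r s : ℝ, 0 ≤ r → Dr (Dr (fun r s => (1 - (r-c)^2/b^2) * (s + ρ))) r s = -(2/b^2)*(s+ρ) := by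
    intro r s hr
    rw [Dr_congr (F := fun r s => -(2*(r-c)/b^2)*(s+ρ)) hr fun r hr => hDr r s hr]
    have := ((((((hasDerivAt_id r).sub_const c).const_mul 2).div_const (b^2)).neg).mul_const (s+ρ)).hasDerivWithinAt (s := Ici 0)
    exact Dr_eq hr (this.congr_deriv (by simp))
  have hDs : ∀ r s : ℝ, Ds (fun r s => (1 - (r-c)^2/b^2) * (s + ρ)) r s = 1 - (r-c)^2/b^2 := by
    intro r s
    have := (((hasDerivAt_id s).add_const ρ).const_mul (1 - (r-c)^2/b^2))
    exact Ds_eq (this.congr_deriv (by simp))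
  refine ⟨_, hsm, fun r s hq => ?_, fun ρ' h0 h1 r s hq => ?_⟩
  · obtain ⟨q1, q2, q3, q4⟩ := id hq
    have e0 : (r-c)^2 ≤ b^2 := by rw [← sq_abs (r-c)]; gcongr
    have e1 : (r-c)^2/b^2 ≤ 1 := (div_le_one (by positivity)).2 e0
    have e2 : 0 ≤ (r-c)^2/b^2 := by positivity
    have hs1 : |s + ρ| ≤ 1 := by rw [abs_le]; constructor <;> linarith
    have p1 : (0:ℝ) ≤ 4/ρ := by positivity
    have p2 : (0:ℝ) ≤ 8/ρ^2 := by positivity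
    have p3 : (0:ℝ) ≤ 8/ρ^2 * (d * (cosh 2 + 5)) := by positivity
    refine ⟨mul_nonneg (by linarith) (by linarith), ?_, ?_, ?_, fun hr => ?_, ?_⟩
    · nlinarith
    · rw [hDs, abs_le]; constructor <;> linarith
    · rw [hDr _ _ q1, abs_mul, abs_neg, abs_div, abs_mul, abs_two, abs_of_pos (by positivity : 0 < b^2)]
      calc 2*|r-c|/b^2 * |s+ρ| ≤ 2*b/b^2*1 := by gcongr
        _ = 2/b := by field_simp
        _ ≤ 2/(ρ/2) := by
            have : ρ/2 ≤ b := by rw [hbd]; nlinarith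
            gcongr
        _ = 4/ρ := by field_simp; norm_num
        _ ≤ _ := by linarith
    · unfold LL
      rw [hDrr _ _ q1, hDr _ _ q1]
      have hH := HH_nn (d := d) hr
      have := HH_cut (d := d) hc hρ1 hq hr
      calc |-(2/b^2)*(s+ρ) + HH d r * (-(2*(r-c)/b^2)*(s+ρ))|
          = 2/b^2 * |1 + HH d r * (r-c)| * |s+ρ| := by
            rw [show -(2/b^2)*(s+ρ) + HH d r * (-(2*(r-c)/b^2)*(s+ρ)) = -(2/b^2 * (1 + HH d r * (r-c)) * (s+ρ)) by ring,
              abs_neg, abs_mul, abs_mul, abs_of_pos (by positivity : 0 < 2/b^2)]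
        _ ≤ 8/ρ^2 * (1 + d * (cosh 2 + 5)) * 1 := by
            gcongr
            refine (abs_add_le _ _).trans ?_
            rw [abs_one, abs_mul, abs_of_nonneg hH]
            linarith
        _ ≤ _ := by linarith
    · rintro (h | h)
      · rw [h]; ring
      · rw [← sq_abs (r-c), h, div_self (by positivity)]; ring
  · obtain ⟨q1, q2, q3, q4⟩ := hq
    have e1 : (r-c)^2/b^2 ≤ (ρ'/ρ)^2 := by
      rw [← sq_abs (r-c)]
      calc _ ≤ (ρ' * Rc c)^2/b^2 := by gcongr
        _ = _ := by rw [hbd]; field_simp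
    have e2 : (ρ'/ρ)^2 ≤ 1 := by
      rw [sq_le_one_iff₀ (by positivity), div_le_one hρ]; exact h1.le
    exact mul_le_mul (by linarith) (by linarith) (by linarith) (by linarith)

/-- pointwise algebra of the Bernstein argument -/
lemma bern_alg {a a1 A c C Mw K η ηr DE x xr DX W Wr DW : ℝ} (ha : 0 ≤ a) (ha1 : a ≤ a1) (hc : 0 < c) (hC : 0 ≤ C)
    (hA : 16 * a1 ≤ c * A) (hA0 : 0 < A) (hK : 0 ≤ K) (hη : 0 ≤ η) (hη1 : η ≤ 1) (hηr : |ηr| ≤ K) (hDE : DE ≤ K)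
    (hW : 0 ≤ W) (hWM : W ≤ Mw) (hDX : DX ≤ - a * xr^2 + C * (|x|^3 + 1)) (hDW : DW ≤ -c*(x^2 + Wr^2) + C) :
    η^2 * (A+W) * DX + η^2*x^2*DW + x^2*(A+W)*DE
      - 2*a*(η^2*(2*x*xr)*Wr + (A+W)*(2*η*ηr)*(2*x*xr) + x^2*(2*η*ηr)*Wr)
    ≤ -(c/2) * (η^2*x^2) * x^2 + ((A+Mw)*K + C + (A+Mw)^2*C^2/(2*c) + 32*a1*(A+Mw)*K^2 + 8*a1^2*K^2/c) * x^2 + (A+Mw)*C := by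
  have hΨ : 0 < A + W := by linarith
  have hE1 : η^2 ≤ 1 := pow_le_one₀ hη hη1
  have hKr : ηr^2 ≤ K^2 := by rw [← sq_abs ηr]; gcongr
  have ha10 : 0 ≤ a1 := ha.trans ha1
  have hAM : 0 ≤ A + Mw := by linarith
  have t1 : η^2 * (A+W) * DX ≤ η^2 * (A+W) * (- a * xr^2 + C * (|x|^3 + 1)) := by gcongr
  have t2 : η^2 * x^2 * DW ≤ η^2 * x^2 * (-c*(x^2 + Wr^2) + C) := by gcongr
  have t3 : x^2*(A+W)*DE ≤ x^2 * ((A+Mw)*K) := by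
    rw [mul_assoc]; gcongr x^2 * ?_
    calc (A+W)*DE ≤ (A+W)*K := by gcongr
      _ ≤ _ := by gcongr
  have t4 : -(4*a*η^2*x*xr*Wr) ≤ a*η^2*((A+W)*xr^2/2) + c/2*(η^2*x^2*Wr^2) := by
    have h1 : -(4*x*xr*Wr) ≤ (A+W)*xr^2/2 + 8*x^2*Wr^2/(A+W) := by
      have : (A+W)*xr^2/2 + 8*x^2*Wr^2/(A+W) + 4*x*xr*Wr = ((A+W)*xr + 4*x*Wr)^2/(2*(A+W)) := by field_simp; ring
      have h2 : 0 ≤ ((A+W)*xr + 4*x*Wr)^2/(2*(A+W)) := by positivity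
      linarith
    have h3 : a * (8/(A+W)) ≤ c/2 := by
      rw [mul_div_assoc', div_le_iff₀ hΨ]; linarith [mul_nonneg hc.le hW]
    calc -(4*a*η^2*x*xr*Wr) = a*η^2*(-(4*x*xr*Wr)) := by ring
      _ ≤ a*η^2*((A+W)*xr^2/2 + 8*x^2*Wr^2/(A+W)) := by gcongr
      _ = a*η^2*((A+W)*xr^2/2) + (a*(8/(A+W)))*(η^2*x^2*Wr^2) := by ring
      _ ≤ _ := by gcongr
  have t5 : -(8*a*(A+W)*η*ηr*x*xr) ≤ a*(A+W)*(η^2*xr^2/2) + 32*a1*(A+Mw)*K^2*x^2 := by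
    calc -(8*a*(A+W)*η*ηr*x*xr) = a*(A+W)*(-(8*(η*xr)*(ηr*x))) := by ring
      _ ≤ a*(A+W)*(η^2*xr^2/2 + 32*(ηr^2*x^2)) := by
          gcongr; linarith [sq_nonneg (η*xr + 8*(ηr*x))]
      _ = a*(A+W)*(η^2*xr^2/2) + 32*a*(A+W)*ηr^2*x^2 := by ring
      _ ≤ _ := by gcongr
  have t6 : -(4*a*x^2*η*ηr*Wr) ≤ c/2*(η^2*x^2*Wr^2) + 8*a1^2*K^2/c*x^2 := by
    have h1 : -(4*a*η*ηr*Wr) ≤ c/2*(η^2*Wr^2) + 8*a^2*ηr^2/c := by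
      have : c/2*(η^2*Wr^2) + 8*a^2*ηr^2/c + 4*a*η*ηr*Wr = (c*(η*Wr) + 4*a*ηr)^2/(2*c) := by field_simp; ring
      have h2 : 0 ≤ (c*(η*Wr) + 4*a*ηr)^2/(2*c) := by positivity
      linarith
    calc -(4*a*x^2*η*ηr*Wr) = x^2*(-(4*a*η*ηr*Wr)) := by ring
      _ ≤ x^2*(c/2*(η^2*Wr^2) + 8*a^2*ηr^2/c) := by gcongr
      _ ≤ x^2*(c/2*(η^2*Wr^2) + 8*a1^2*K^2/c) := by gcongr
      _ = _ := by ring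
  have t7 : η^2*(A+W)*(C*|x|^3) ≤ c/2*(η^2*x^2*x^2) + (A+Mw)^2*C^2/(2*c)*x^2 := by
    have h1 : (A+W)*C*|x| ≤ c/2*x^2 + (A+W)^2*C^2/(2*c) := by
      have : c/2*|x|^2 + (A+W)^2*C^2/(2*c) - (A+W)*C*|x| = (c*|x| - (A+W)*C)^2/(2*c) := by field_simp; ring
      have h2 : 0 ≤ (c*|x| - (A+W)*C)^2/(2*c) := by positivity
      rw [← sq_abs x]; linarith
    calc η^2*(A+W)*(C*|x|^3) = η^2*|x|^2*((A+W)*C*|x|) := by ring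
      _ = η^2*x^2*((A+W)*C*|x|) := by rw [sq_abs]
      _ ≤ η^2*x^2*(c/2*x^2 + (A+W)^2*C^2/(2*c)) := by gcongr
      _ = c/2*(η^2*x^2*x^2) + η^2*((A+W)^2*C^2/(2*c)*x^2) := by ring
      _ ≤ c/2*(η^2*x^2*x^2) + 1*((A+Mw)^2*C^2/(2*c)*x^2) := by gcongr
      _ = _ := by ring
  have t8 : η^2*(A+W)*C ≤ (A+Mw)*C := by
    calc _ ≤ 1*(A+Mw)*C := by gcongr
      _ = _ := by ring
  have t9 : η^2*x^2*C ≤ C*x^2 := by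
    calc _ ≤ 1*x^2*C := by gcongr
      _ = _ := by ring
  linarith [t1, t2, t3, t4, t5, t6, t7, t8, t9]

set_option maxHeartbeats 1000000 in
theorem bern (d : ℕ) (hd : 1 ≤ d) {ρ' ρ a1 Mw C c : ℝ} (h0 : 0 < ρ') (hρ : ρ' < ρ) (hρ1 : ρ ≤ 1)
    (hc : 0 < c) (hC : 0 ≤ C) (ha10 : 0 < a1) (hMw : 0 ≤ Mw) : ∃ M, ∀ (x0 : ℝ) (_ : Ctr x0) (x W a : ℝ → ℝ → ℝ),
    Sm IV x → Sm IV W → (∀ r s, InQ x0 ρ r s → 0 ≤ W r s) →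
    (∀ r s, InQ x0 ρ r s → 0 < r → 0 ≤ a r s ∧ a r s ≤ a1 ∧ W r s ≤ Mw ∧
      2 * x r s * (Ds x r s - a r s * LL d x r s) ≤ a r s * Dr x r s ^ 2 + C * (|x r s|^3 + 1) ∧
      Ds W r s - a r s * LL d W r s ≤ -c*(x r s ^ 2 + Dr W r s ^ 2) + C) →
    ∀ r s, InQ x0 ρ' r s → |x r s| ≤ M := by
  have hρ0 := h0.trans hρ
  obtain ⟨K, hK, hcut⟩ := cutoff d hρ0 hρ1
  set A := 16 * a1 / c
  have hA : 0 < A := by positivity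
  have hA' : 16 * a1 ≤ c * A := by simp only [A]; field_simp; rfl
  set K2 := 2*K + 2*a1*K
  set K3 := (A+Mw)*K2 + C + (A+Mw)^2*C^2/(2*c) + 32*a1*(A+Mw)*K2^2 + 8*a1^2*K2^2/c with hK3
  have hK30 : 0 ≤ K3 := by positivity
  set m := 2/c*(K3 + (A+Mw)*C + 1) + 1
  have hm : 0 < m := by positivity
  set e0 := (1 - (ρ'/ρ)^2) * (ρ - ρ')
  have he0 : 0 < e0 := by
    have : (ρ'/ρ)^2 < 1 := by rw [sq_lt_one_iff₀ (by positivity), div_lt_one hρ0]; exact hρ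
    exact mul_pos (by linarith) (by linarith)
  refine ⟨Real.sqrt (m*(A+Mw)/(e0^2*A)), fun x0 hx0 x W a hx hW hW0 hmain r s hq => ?_⟩
  obtain ⟨η, hη, hη1, hη2⟩ := hcut x0 hx0
  have hR := Rc_pos x0
  have hZ : Sm IV (fun r s => (η r s ^ 2 * x r s ^ 2) * (A + W r s)) :=
    ((hη.pow 2).mul (hx.pow 2)).mul ((Sm.const A).add hW)
  have hsub : Icc (-ρ) 0 ⊆ IV := fun y hy => ⟨by linarith [hy.1], by linarith [hy.2]⟩
  set b := ρ * Rc x0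
  have hb : 0 < b := by positivity
  have hin : ∀ r ∈ Icc (max 0 (x0 - b)) (x0 + b), ∀ s ∈ Icc (-ρ) 0, InQ x0 ρ r s := fun r hr s hs =>
    ⟨(le_max_left _ _).trans hr.1, abs_le.2 ⟨by linarith [(le_max_right _ _).trans hr.1], by linarith [hr.2]⟩, hs.1, hs.2⟩
  have hx00 : 0 ≤ x0 := by rcases hx0 with h | h <;> linarith
  have hmx : max 0 (x0 - b) ≤ x0 + b := max_le (by linarith) (by linarith)
  have key := MP (d := d) hIV hZ (α := max 0 (x0-b)) (β := x0+b) (s0 := -ρ) (s1 := 0) (M := m*(A+Mw)) (le_max_left _ _) hsub hd a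
    (fun _ _ => 0) one_pos
    (fun r hr => by
      rw [((hη1 _ _ (hin r hr (-ρ) ⟨le_rfl, by linarith⟩)).2.2.2.2.2 (Or.inl rfl))]
      simp; positivity)
    (fun s hs => by
      rw [((hη1 _ _ (hin (x0+b) ⟨hmx, le_rfl⟩ s hs)).2.2.2.2.2 (Or.inr (by simp [abs_of_pos hb])))]
      simp; positivity)
    (fun hp s hs => by
      have e : max 0 (x0-b) = x0 - b := max_eq_right (by
        by_contra hh; rw [max_eq_left (by linarith)] at hp; exact lt_irrefl _ hp)
      rw [((hη1 _ _ (hin (max 0 (x0-b)) ⟨le_rfl, hmx⟩ s hs)).2.2.2.2.2 (Or.inr (by rw [e]; simp [abs_of_pos hb])))]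
      simp; positivity)
    (fun r hr s hs => (hmain r s (hin r (Ioo_subset_Icc_self hr) s (Ioc_subset_Icc_self hs)) ((le_max_left _ _).trans_lt hr.1)).1)
    (fun _ _ _ => tendsto_const_nhds) (fun r hr s hs hM => by
      have hq := hin r (Ioo_subset_Icc_self hr) s (Ioc_subset_Icc_self hs)
      have hr0 : 0 < r := (le_max_left _ _).trans_lt hr.1
      have hsI := hsub (Ioc_subset_Icc_self hs)
      obtain ⟨m1, m2, m3, m4, m5⟩ := hmain r s hq hr0
      obtain ⟨n1, n2, n3, n4, n5, -⟩ := hη1 r s hq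
      have n5 := n5 hr0
      have hw := hW0 r s hq
      have sE := hη.pow 2
      have sX := hx.pow 2
      have sP := (Sm.const (I := IV) A).add hW
      have e1 : Ds (fun r s => (η r s ^ 2 * x r s ^ 2) * (A + W r s)) r s =
          (2*η r s*Ds η r s * x r s^2 + η r s^2*(2*x r s*Ds x r s))*(A+W r s) + η r s^2*x r s^2*Ds W r s := by
        rw [Ds_mul hIV (sE.mul sX) sP hr0.le hsI, Ds_mul hIV sE sX hr0.le hsI, Ds_pow hIV hη 2 hr0.le hsI, Ds_pow hIV hx 2 hr0.le hsI,
          Ds_add hIV (Sm.const A) hW hr0.le hsI, Ds_const]; push_cast; ring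
      have e2 : LL d (fun r s => (η r s ^ 2 * x r s ^ 2) * (A + W r s)) r s =
          (LL d (fun r s => η r s ^2) r s * x r s^2 + η r s^2*(2*x r s*LL d x r s + 2*Dr x r s^2)
             + 2*(2*η r s*Dr η r s)*(2*x r s*Dr x r s))*(A+W r s)
            + η r s^2*x r s^2*LL d W r s + 2*(2*η r s*Dr η r s*x r s^2 + η r s^2*(2*x r s*Dr x r s))*Dr W r s := by
        rw [LL_mul hIV (sE.mul sX) sP hr0.le hsI, LL_mul hIV sE sX hr0.le hsI, LL_sq hIV hx hr0.le hsI, Dr_mul sE sX hr0.le hsI,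
          Dr_pow hη 2 hr0.le hsI, Dr_pow hx 2 hr0.le hsI, LL_add hIV (Sm.const A) hW hr0.le hsI, LL_const A hr0.le,
          Dr_add (Sm.const A) hW hr0.le hsI, Dr_const A hr0.le]; push_cast; ring
      have e3 := LL_sq (d := d) hIV hη hr0.le hsI
      have hDE : 2*η r s*Ds η r s - a r s * LL d (fun r s => η r s ^2) r s ≤ K2 := by
        rw [e3]
        have u1 : 2*η r s*Ds η r s ≤ 2*K := by
          have := (abs_le.1 n3).2
          calc 2*η r s*Ds η r s ≤ 2*η r s*K := by gcongr
            _ ≤ 2*1*K := by gcongr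
            _ = _ := by ring
        have u2 : -(a r s * (η r s * LL d η r s)) ≤ a1*K := by
          refine (neg_le_abs _).trans ?_
          rw [abs_mul, abs_mul, abs_of_nonneg m1, abs_of_nonneg n1]
          calc _ ≤ a1*(1*K) := by gcongr
            _ = _ := by ring
        have u3 : 0 ≤ a r s * Dr η r s^2 := by positivity
        simp only [K2]; linarith
      have hK2 : |Dr η r s| ≤ K2 := n4.trans (by simp only [K2]; linarith [mul_pos ha10 hK])
      have hal := bern_alg (DX := 2*x r s*(Ds x r s - a r s*LL d x r s) - 2*a r s*Dr x r s^2) (xr := Dr x r s) m1 m2 hc hC hA' hA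
        (by positivity : 0 ≤ K2) n1 n2 hK2 hDE hw m3 (by linarith) m5
      rw [e1, e2, zero_mul, add_zero]
      have hX : m < η r s^2 * x r s^2 := by
        have hM' : m*(A+Mw) < (η r s^2*x r s^2)*(A+W r s) := hM
        have : (η r s^2*x r s^2)*(A+W r s) ≤ (η r s^2*x r s^2)*(A+Mw) := by gcongr
        exact lt_of_mul_lt_mul_right (hM'.trans_le this) (by positivity)
      have hX1 : 1 ≤ x r s^2 := by
        have : η r s^2*x r s^2 ≤ 1*x r s^2 := by gcongr; exact pow_le_one₀ n1 n2
        have : 1 ≤ m := by simp only [m]; have : 0 ≤ 2/c*(K3 + (A+Mw)*C + 1) := by positivity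
                           linarith
        linarith
      have hfin : -(c/2) * (η r s^2*x r s^2) * x r s^2 + K3*x r s^2 + (A+Mw)*C ≤ -1 := by
        have v1 : c/2*m ≤ c/2*(η r s^2*x r s^2) := by gcongr
        have v2 : c/2*m = (K3 + (A+Mw)*C + 1) + c/2 := by simp only [m]; field_simp
        have v3 : 0 ≤ (A+Mw)*C := by positivity
        have v4 := mul_le_mul_of_nonneg_right v1 (zero_le_one.trans hX1)
        rw [v2] at v4
        have v5 := mul_le_mul_of_nonneg_left hX1 (by positivity : 0 ≤ (A+Mw)*C + 1 + c/2)
        linarith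
      rw [← hK3] at hal
      linarith)
  have hb' : ρ' * Rc x0 ≤ b := mul_le_mul_of_nonneg_right hρ.le hR.le
  have hz := key r ⟨max_le hq.1 (by linarith [(abs_le.1 hq.2.1).1]), by linarith [(abs_le.1 hq.2.1).2]⟩ s
    ⟨by linarith [hq.2.2.1], hq.2.2.2⟩
  apply Real.abs_le_sqrt
  rw [le_div_iff₀ (by positivity)]
  have g1 := hη2 ρ' h0 hρ r s hq
  have g2 := hW0 r s (hq.mono hρ.le)
  calc x r s^2*(e0^2*A) = e0^2*x r s^2*A := by ring
    _ ≤ η r s^2*x r s^2*(A+W r s) := by gcongr; linarith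
    _ ≤ _ := hz

section
variable {ι : Type} {c : ι → ℝ} {F G X : ι → ℝ → ℝ → ℝ}

def LB (c : ι → ℝ) (X F : ι → ℝ → ℝ → ℝ) : Prop :=
  ∀ ρ ∈ Ioo (0:ℝ) 1, ∃ M ≥ 0, ∀ i r s, InQ (c i) ρ r s → |F i r s| ≤ M * (1 + |X i r s|)
abbrev UB (c : ι → ℝ) (F : ι → ℝ → ℝ → ℝ) : Prop := LB c (fun _ _ _ => 0) F

lemma UB.get (h : UB c F) {ρ : ℝ} (hρ : ρ ∈ Ioo (0:ℝ) 1) : ∃ M ≥ 0, ∀ i r s, InQ (c i) ρ r s → |F i r s| ≤ M := by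
  obtain ⟨M, h0, h⟩ := h ρ hρ
  exact ⟨M, h0, fun i r s hq => (h i r s hq).trans (by simp)⟩
lemma UB.mk (h : ∀ ρ ∈ Ioo (0:ℝ) 1, ∃ M, ∀ i r s, InQ (c i) ρ r s → |F i r s| ≤ M) : UB c F := fun ρ hρ => by
  obtain ⟨M, h⟩ := h ρ hρ
  refine ⟨|M|, abs_nonneg _, fun i r s hq => (h i r s hq).trans ?_⟩
  simpa using le_abs_self M
lemma UB.lb (h : UB c F) : LB c X F := fun ρ hρ => by
  obtain ⟨M, h0, h⟩ := h.get hρ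
  exact ⟨M, h0, fun i r s hq => (h i r s hq).trans (le_mul_of_one_le_right h0 (by linarith [abs_nonneg (X i r s)]))⟩
lemma LB.self : LB c X X := fun ρ _ => ⟨1, zero_le_one, fun i r s _ => by linarith [abs_nonneg (X i r s)]⟩
lemma UB.const (a : ℝ) : UB c (fun _ _ _ => a) := UB.mk fun _ _ => ⟨|a|, fun _ _ _ _ => le_rfl⟩
lemma LB.add (h : LB c X F) (h' : LB c X G) : LB c X (fun i r s => F i r s + G i r s) := fun ρ hρ => by
  obtain ⟨M, h0, h⟩ := h ρ hρ
  obtain ⟨M', h0', h'⟩ := h' ρ hρ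
  exact ⟨M + M', by positivity, fun i r s hq => (abs_add_le _ _).trans (by rw [add_mul]; exact add_le_add (h i r s hq) (h' i r s hq))⟩
lemma LB.umul (h : LB c X F) (h' : UB c G) : LB c X (fun i r s => G i r s * F i r s) := fun ρ hρ => by
  obtain ⟨M, h0, h⟩ := h ρ hρ
  obtain ⟨M', h0', h'⟩ := h'.get hρ
  exact ⟨M' * M, by positivity, fun i r s hq => by
    rw [abs_mul, mul_assoc]; exact mul_le_mul (h' i r s hq) (h i r s hq) (abs_nonneg _) h0'⟩
lemma LB.congr (h : LB c X F) (e : ∀ i r s, 0 ≤ r → s ∈ IV → G i r s = F i r s) : LB c X G := fun ρ hρ => by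
  obtain ⟨M, h0, h⟩ := h ρ hρ
  exact ⟨M, h0, fun i r s hq => by rw [e i r s hq.1 (hq.mem (by linarith [hρ.2]))]; exact h i r s hq⟩

structure Fam (d : ℕ) (q c0 : ℝ) (v : ι → ℝ → ℝ → ℝ) (c : ι → ℝ) : Prop where
  hd : 1 ≤ d
  hq : 1 < q
  hc0 : 0 < c0
  sol : ∀ i, Sol d q c0 IV (v i)
  ctr : ∀ i, Ctr (c i)
  bd : ∃ m0 > 0, ∃ M0, ∀ i r s, InQ (c i) 1 r s → m0 ≤ v i r s ∧ v i r s ≤ M0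
  gr : UB c (fun i => Dr (v i))

inductive Alg (v : ι → ℝ → ℝ → ℝ) : ℕ → (ι → ℝ → ℝ → ℝ) → Prop
  | pw (γ : ℝ) (n : ℕ) : Alg v n (fun i r s => v i r s ^ γ)
  | fj (j n : ℕ) (h : j ≤ n) : Alg v n (fun i => Ds^[j] (v i))
  | const (a : ℝ) (n : ℕ) : Alg v n (fun _ _ _ => a)
  | add {n : ℕ} {F G : ι → ℝ → ℝ → ℝ} : Alg v n F → Alg v n G → Alg v n (fun i r s => F i r s + G i r s)
  | mul {n : ℕ} {F G : ι → ℝ → ℝ → ℝ} : Alg v n F → Alg v n G → Alg v n (fun i r s => F i r s * G i r s)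
  | congr {n : ℕ} {F G : ι → ℝ → ℝ → ℝ} : Alg v n F → (∀ i r s, 0 ≤ r → s ∈ IV → G i r s = F i r s) → Alg v n G

variable {v : ι → ℝ → ℝ → ℝ} {d n : ℕ} {q c0 : ℝ}

lemma Sm.dsj {I : Set ℝ} {F : ℝ → ℝ → ℝ} (hI : IsOpen I) (h : Sm I F) (j : ℕ) : Sm I (Ds^[j] F) := by
  induction j with
  | zero => exact h
  | succ j ih => rw [Function.iterate_succ_apply']; exact ih.ds hI
lemma Sm.drj {I : Set ℝ} {F : ℝ → ℝ → ℝ} (hI : IsOpen I) (h : Sm I F) (j : ℕ) : Sm I (Dr^[j] F) := by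
  induction j with
  | zero => exact h
  | succ j ih => rw [Function.iterate_succ_apply']; exact ih.dr hI

lemma Alg.sm (hv : ∀ i, Sol d q c0 IV (v i)) (h : Alg v n F) (i : ι) : Sm IV (F i) := by
  induction h with
  | pw γ n => exact (hv i).sm.rpow (hv i).pos γ
  | fj j n h => exact (hv i).sm.dsj hIV j
  | const a n => exact Sm.const a
  | add _ _ h1 h2 => exact h1.add h2
  | mul _ _ h1 h2 => exact h1.mul h2
  | congr _ e h => exact h.congr (fun r hr s hs => e i r s hr hs)

lemma Alg.mono {k : ℕ} (h : Alg v n F) (hk : n ≤ k) : Alg v k F := by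
  induction h with
  | pw γ n => exact .pw γ k
  | fj j n h => exact .fj j k (h.trans hk)
  | const a n => exact .const a k
  | add _ _ h1 h2 => exact .add (h1 hk) (h2 hk)
  | mul _ _ h1 h2 => exact .mul (h1 hk) (h2 hk)
  | congr _ e h => exact .congr (h hk) e

lemma Alg.ds (hv : ∀ i, Sol d q c0 IV (v i)) (h : Alg v n F) : Alg v (n+1) (fun i => Ds (F i)) := by
  induction h with
  | pw γ n =>
    exact .congr (.mul (.mul (.const γ _) (.pw (γ-1) _)) (.fj 1 _ (by omega))) fun i r s hr hs =>
      Ds_rpow hIV (hv i).sm (hv i).pos γ hr hs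
  | fj j n h => exact .congr (.fj (j+1) _ (by omega)) fun i r s _ _ => by rw [Function.iterate_succ_apply']
  | const a n => exact .congr (.const 0 _) fun i r s _ _ => Ds_const a
  | add a b h1 h2 => exact .congr (.add h1 h2) fun i r s hr hs => Ds_add hIV (a.sm hv i) (b.sm hv i) hr hs
  | mul a b h1 h2 =>
    exact .congr (.add (.mul h1 (b.mono (by omega))) (.mul (a.mono (by omega)) h2)) fun i r s hr hs =>
      Ds_mul hIV (a.sm hv i) (b.sm hv i) hr hs
  | congr a e h => exact .congr h fun i r s hr hs => Ds_congr hIV hs fun s hs => e i r s hr hs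

lemma Fam.pw (h : Fam d q c0 v c) (γ : ℝ) : UB c (fun i r s => v i r s ^ γ) := UB.mk fun ρ hρ => by
  obtain ⟨m0, hm, M0, hb⟩ := h.bd
  refine ⟨m0 ^ γ + M0 ^ γ, fun i r s hq => ?_⟩
  obtain ⟨h1, h2⟩ := hb i r s (hq.mono hρ.2.le)
  have hv : 0 < v i r s := by linarith
  rw [abs_of_pos (by positivity)]
  have p1 : 0 < m0 ^ γ := by positivity
  have p2 : 0 < M0 ^ γ := rpow_pos_of_pos (by linarith) _
  rcases le_total 0 γ with hγ | hγ
  · have := rpow_le_rpow hv.le h2 hγ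
    linarith
  · have := rpow_le_rpow_of_nonpos hm h1 hγ
    linarith

lemma Alg.ub (h : Fam d q c0 v c) (hA : Alg v n F) (hf : ∀ j ≤ n, UB c (fun i => Ds^[j] (v i))) : UB c F := by
  induction hA with
  | pw γ n => exact h.pw γ
  | fj j n hj => exact hf j hj
  | const a n => exact UB.const a
  | add _ _ h1 h2 => exact (h1 hf).add (h2 hf)
  | mul _ _ h1 h2 => exact (h2 hf).umul (h1 hf)
  | congr _ e h => exact (h hf).congr e

structure Der (D : (ℝ → ℝ → ℝ) → ℝ → ℝ → ℝ) : Prop where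
  add : ∀ {F G : ℝ → ℝ → ℝ} {r s : ℝ}, Sm IV F → Sm IV G → 0 ≤ r → s ∈ IV → D (fun r s => F r s + G r s) r s = D F r s + D G r s
  mul : ∀ {F G : ℝ → ℝ → ℝ} {r s : ℝ}, Sm IV F → Sm IV G → 0 ≤ r → s ∈ IV →
    D (fun r s => F r s * G r s) r s = D F r s * G r s + F r s * D G r s
  const : ∀ (a : ℝ) {r s : ℝ}, 0 ≤ r → D (fun _ _ => a) r s = 0
  rpow : ∀ {F : ℝ → ℝ → ℝ} {r s : ℝ}, Sm IV F → (∀ r, 0 ≤ r → ∀ s ∈ IV, 0 < F r s) → ∀ γ : ℝ, 0 ≤ r → s ∈ IV →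
    D (fun r s => F r s ^ γ) r s = γ * F r s ^ (γ-1) * D F r s
  congr : ∀ {F G : ℝ → ℝ → ℝ} {r s : ℝ}, 0 ≤ r → s ∈ IV → (∀ r s, 0 ≤ r → s ∈ IV → G r s = F r s) → D G r s = D F r s

lemma der_Ds : Der Ds := ⟨Ds_add hIV, Ds_mul hIV, fun a _ _ _ => Ds_const a, Ds_rpow hIV,
  fun hr hs h => Ds_congr hIV hs fun s hs => h _ s hr hs⟩
lemma der_Dr : Der Dr := ⟨Dr_add, Dr_mul, fun a _ _ hr => Dr_const a hr, Dr_rpow,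
  fun hr hs h => Dr_congr hr fun r hr => h r _ hr hs⟩

lemma Alg.lb {D : (ℝ → ℝ → ℝ) → ℝ → ℝ → ℝ} (hD : Der D) (h : Fam d q c0 v c) {k : ℕ} (hA : Alg v k F) (hk : k ≤ n)
    (hf : ∀ j ≤ n, UB c (fun i => Ds^[j] (v i))) (hg : ∀ j < n, UB c (fun i => D (Ds^[j] (v i)))) :
    LB c (fun i => D (Ds^[n] (v i))) (fun i => D (F i)) := by
  have hj : ∀ j ≤ n, LB c (fun i => D (Ds^[n] (v i))) (fun i => D (Ds^[j] (v i))) := fun j hj => by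
    rcases hj.lt_or_eq with hj | hj
    · exact (hg j hj).lb
    · rw [hj]; exact LB.self
  induction hA with
  | pw γ _ =>
    exact ((hj 0 (by omega)).umul ((h.pw (γ-1)).umul (UB.const γ))).congr fun i r s hr hs =>
      hD.rpow (h.sol i).sm (h.sol i).pos γ hr hs
  | fj j _ h => exact hj j (h.trans hk)
  | const a _ => exact (UB.const (0:ℝ)).lb.congr fun i r s hr _ => hD.const a hr
  | add a b h1 h2 => exact ((h1 hk).add (h2 hk)).congr fun i r s hr hs => hD.add (a.sm h.sol i) (b.sm h.sol i) hr hs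
  | mul a b h1 h2 =>
    have ua := a.ub h fun j hj => hf j (hj.trans hk)
    have ub := b.ub h fun j hj => hf j (hj.trans hk)
    exact (((h1 hk).umul ub).add ((h2 hk).umul ua)).congr fun i r s hr hs => by
      rw [hD.mul (a.sm h.sol i) (b.sm h.sol i) hr hs]; ring
  | congr a e h1 => exact (h1 hk).congr fun i r s hr hs => hD.congr hr hs (e i)

noncomputable def RR (q : ℝ) (v : ι → ℝ → ℝ → ℝ) : ℕ → ι → ℝ → ℝ → ℝ
  | 0 => fun _ _ _ => 0
  | j+1 => fun i r s => q * (q-1) * v i r s ^ (q-2) * (Ds (v i) r s * Ds^[j+1] (v i) r s) + Ds (RR q v j i) r s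
noncomputable def BB (q : ℝ) (v : ι → ℝ → ℝ → ℝ) (j : ℕ) (i : ι) (r s : ℝ) : ℝ :=
  (-1/q) * v i r s ^ (1-q) * RR q v j i r s
noncomputable def aa (q c0 : ℝ) (v : ι → ℝ → ℝ → ℝ) (i : ι) (r s : ℝ) : ℝ := c0/q * v i r s ^ (1-q)

lemma RR_alg (hv : ∀ i, Sol d q c0 IV (v i)) (j : ℕ) : Alg v j (RR q v j) := by
  induction j with
  | zero => exact .const 0 0
  | succ j ih => exact .add (.mul (.mul (.const _ _) (.pw _ _)) (.mul (.fj 1 _ (by omega)) (.fj (j+1) _ le_rfl))) (ih.ds hv)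
lemma BB_alg (hv : ∀ i, Sol d q c0 IV (v i)) (j : ℕ) : Alg v j (BB q v j) := .mul (.mul (.const _ _) (.pw _ _)) (RR_alg hv j)
lemma aa_alg : Alg v 0 (aa q c0 v) := .mul (.const _ _) (.pw _ _)

lemma uj (hv : ∀ i, Sol d q c0 IV (v i)) (j : ℕ) (i : ι) {r s : ℝ} (hr : 0 ≤ r) (hs : s ∈ IV) :
    Ds^[j+1] (fun r s => v i r s ^ q) r s = q * v i r s ^ (q-1) * Ds^[j+1] (v i) r s + RR q v j i r s := by
  induction j generalizing s with
  | zero => simp only [zero_add, Function.iterate_one, RR, add_zero]; exact Ds_rpow hIV (hv i).sm (hv i).pos q hr hs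
  | succ j ih =>
    rw [Function.iterate_succ_apply', Ds_congr (F := fun r s => q * v i r s ^ (q-1) * Ds^[j+1] (v i) r s + RR q v j i r s) hIV hs
      fun s hs => ih hs]
    have s1 : Sm IV (fun r s => v i r s ^ (q-1)) := (hv i).sm.rpow (hv i).pos _
    have s2 := (hv i).sm.dsj hIV (j+1)
    rw [Ds_add hIV (((Sm.const q).mul s1).mul s2) ((RR_alg hv j).sm hv i) hr hs, Ds_mul hIV ((Sm.const q).mul s1) s2 hr hs,
      Ds_mul hIV (Sm.const q) s1 hr hs, Ds_const, Ds_rpow hIV (hv i).sm (hv i).pos (q-1) hr hs, ← Function.iterate_succ_apply' Ds (j+1)]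
    simp only [RR]
    rw [show q - 1 - 1 = q - 2 by ring]; ring

lemma ujLL (hv : ∀ i, Sol d q c0 IV (v i)) (j : ℕ) (i : ι) {r s : ℝ} (hr : 0 < r) (hs : s ∈ IV) :
    Ds^[j+1] (fun r s => v i r s ^ q) r s = c0 * LL d (Ds^[j] (v i)) r s := by
  induction j generalizing s with
  | zero => exact (hv i).equ hIV hr hs
  | succ j ih =>
    have s2 := (hv i).sm.dsj hIV j
    rw [Function.iterate_succ_apply', Ds_congr (F := fun r s => c0 * LL d (Ds^[j] (v i)) r s) hIV hs fun s hs => ih hs,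
      Function.iterate_succ_apply' Ds j (v i), s2.ll_comm hIV hr.le hs]
    exact deriv_const_mul_field' c0 |> fun h => congrFun h s

lemma Fam.fj_eq (h : Fam d q c0 v c) (j : ℕ) (i : ι) {r s : ℝ} (hr : 0 < r) (hs : s ∈ IV) :
    Ds (Ds^[j] (v i)) r s = aa q c0 v i r s * LL d (Ds^[j] (v i)) r s + BB q v j i r s := by
  have e1 := uj h.sol j i hr.le hs
  rw [ujLL h.sol j i hr hs, Function.iterate_succ_apply'] at e1
  have hq := h.hq
  have hp := (h.sol i).pos r hr.le s hs
  have e2 : v i r s ^ (1-q) * v i r s ^ (q-1) = 1 := by rw [← rpow_add hp]; simp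
  have hq0 : q ≠ 0 := by linarith
  unfold aa BB
  rw [show c0/q * v i r s ^ (1-q) * LL d (Ds^[j] (v i)) r s = v i r s ^ (1-q) * (c0 * LL d (Ds^[j] (v i)) r s)/q by ring, e1]
  field_simp
  linear_combination (-(Ds (Ds^[j] (v i)) r s * q)) * e2

end

lemma HH_sq (d : ℕ) {r : ℝ} (hr : 0 < r) : HH d r ^ 2 = (d:ℝ)^2 + d * (d / sinh r ^ 2) := by
  have h := (sinh_pos' hr).ne'
  unfold HH
  have := Real.cosh_sq r
  field_simp
  rw [this]

lemma hasHH (d : ℕ) {r : ℝ} (hr : 0 < r) : HasDerivAt (HH d) (-(d / sinh r ^ 2)) r := by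
  have h := (sinh_pos' hr).ne'
  refine (((Real.hasDerivAt_cosh r).div (Real.hasDerivAt_sinh r) h).const_mul (d:ℝ)).congr_deriv ?_
  have := Real.cosh_sq r
  field_simp
  linear_combination (-(d:ℝ)) * this

lemma hasLL {I : Set ℝ} (hI : IsOpen I) {f : ℝ → ℝ → ℝ} (d : ℕ) (hf : Sm I f) {r s : ℝ} (hr : 0 < r) (hs : s ∈ I) :
    HasDerivAt (fun ρ => LL d f ρ s) (LL d (Dr f) r s - d / sinh r ^ 2 * Dr f r s) r := by
  have h1 := ((hf.dr hI).dr hI).hasDr' hr hs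
  have h2 := (hf.dr hI).hasDr' hr hs
  refine (h1.add ((hasHH d hr).mul h2)).congr_deriv ?_
  unfold LL; ring

lemma grad_eq {I : Set ℝ} (hI : IsOpen I) {f a B : ℝ → ℝ → ℝ} {d : ℕ} (hf : Sm I f) (ha : Sm I a) (hB : Sm I B) {r s : ℝ}
    (hr : 0 < r) (hs : s ∈ I) (e : ∀ r > 0, Ds f r s = a r s * LL d f r s + B r s) :
    Ds (Dr f) r s = a r s * LL d (Dr f) r s - a r s * (d / sinh r ^ 2) * Dr f r s + Dr a r s * LL d f r s + Dr B r s := by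
  rw [← hf.comm hI hr.le hs]
  rw [Dr_congr' (F := fun r s => a r s * LL d f r s + B r s) hr (by filter_upwards [Ioi_mem_nhds hr] with x hx using e x hx)]
  have h := ((ha.hasDr' hr hs).mul (hasLL hI d hf hr hs)).add (hB.hasDr' hr hs)
  exact Dr_eq hr.le (h.hasDerivWithinAt.congr_deriv (by ring))

/-- absorb the singular terms -/
lemma absorb {d H J a0 a G n nr ar : ℝ} (hd : 1 ≤ d) (hJ : 0 ≤ J) (hH0 : 0 ≤ H) (hH : H^2 = d^2 + d*J) (ha0 : 0 < a0)
    (ha : a0 ≤ a) (hG : 0 ≤ G) (har : |ar| ≤ G) :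
    2*n*(ar*(nr + H*n)) ≤ a*nr^2/2 + a*J*n^2 + (2*G^2/a0 + a0*d + d*G^2/a0)*n^2 := by
  have t1 : 2*n*(ar*nr) ≤ a*nr^2/2 + 2*G^2/a0*n^2 := by
    have h1 : 2*n*(ar*nr) ≤ a0*nr^2/2 + 2*ar^2/a0*n^2 := by
      have : a0*nr^2/2 + 2*ar^2/a0*n^2 - 2*n*(ar*nr) = (a0*nr - 2*ar*n)^2/(2*a0) := by field_simp; ring
      have h2 : 0 ≤ (a0*nr - 2*ar*n)^2/(2*a0) := by positivity
      linarith
    have h3 : ar^2 ≤ G^2 := by rw [← sq_abs ar]; gcongr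
    have h4 : 2*ar^2/a0*n^2 ≤ 2*G^2/a0*n^2 := by gcongr
    have h5 : a0*nr^2/2 ≤ a*nr^2/2 := by gcongr
    linarith
  have t2 : 2*n*(ar*(H*n)) ≤ (a*J + a0*d + d*G^2/a0)*n^2 := by
    have h1 : 2*ar*H ≤ a0*H^2/d + d*ar^2/a0 := by
      have : a0*H^2/d + d*ar^2/a0 - 2*ar*H = (a0*H - d*ar)^2/(a0*d) := by field_simp; ring
      have h2 : 0 ≤ (a0*H - d*ar)^2/(a0*d) := by positivity
      linarith
    have h2 : a0*H^2/d = a0*d + a0*J := by rw [hH]; field_simp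
    have h3 : ar^2 ≤ G^2 := by rw [← sq_abs ar]; gcongr
    have h4 : d*ar^2/a0 ≤ d*G^2/a0 := by gcongr
    have h5 : a0*J ≤ a*J := by gcongr
    calc 2*n*(ar*(H*n)) = (2*ar*H)*n^2 := by ring
      _ ≤ _ := by gcongr; linarith
  linarith

section
variable {ι : Type} {c : ι → ℝ} {v : ι → ℝ → ℝ → ℝ} {d n : ℕ} {q c0 : ℝ}

lemma Fam.aa_bd (h : Fam d q c0 v c) : ∃ a0 > 0, ∃ a1 > 0, ∀ i r s, InQ (c i) 1 r s → a0 ≤ aa q c0 v i r s ∧ aa q c0 v i r s ≤ a1 := by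
  obtain ⟨m0, hm, M0, hb⟩ := h.bd
  have hq := h.hq
  have hc := h.hc0
  by_cases hM : 0 < M0
  · refine ⟨c0/q * M0^(1-q), by positivity, c0/q*m0^(1-q), by positivity, fun i r s hq => ?_⟩
    obtain ⟨h1, h2⟩ := hb i r s hq
    unfold aa
    constructor
    · gcongr c0/q * ?_
      exact rpow_le_rpow_of_nonpos (by linarith) h2 (by linarith)
    · gcongr c0/q * ?_
      exact rpow_le_rpow_of_nonpos (by linarith) h1 (by linarith)
  · exact ⟨1, one_pos, 1, one_pos, fun i r s hq => by linarith [hb i r s hq]⟩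

lemma Fam.step_grad (h : Fam d q c0 v c) (j : ℕ) (hj : 1 ≤ j) (hf : ∀ k ≤ j, UB c (fun i => Ds^[k] (v i)))
    (hg : ∀ k < j, UB c (fun i => Dr (Ds^[k] (v i)))) : UB c (fun i => Dr (Ds^[j] (v i))) := UB.mk fun ρ' hρ' => by
  obtain ⟨a0, ha0, a1, ha1, hab⟩ := h.aa_bd
  obtain ⟨ρ, hρ1, hρ2⟩ := exists_between hρ'.2
  have hρ : ρ ∈ Ioo (0:ℝ) 1 := ⟨hρ'.1.trans hρ1, hρ2⟩
  obtain ⟨Mf, hMf, bf⟩ := (hf j le_rfl).get hρ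
  obtain ⟨MB, hMB, bB⟩ := ((BB_alg h.sol j).ub h hf).get hρ
  obtain ⟨L, hL, bL⟩ := ((BB_alg h.sol j).lb der_Dr h le_rfl hf hg) ρ hρ
  have hgr0 : UB c (fun i => Dr (aa q c0 v i)) := by
    refine (h.gr.umul ((h.pw (1-q-1)).umul (UB.const (c0/q*(1-q))))).congr fun i r s hr hs => ?_
    unfold aa
    rw [Dr_mul (Sm.const _) ((h.sol i).sm.rpow (h.sol i).pos _) hr hs, Dr_const _ hr, Dr_rpow (h.sol i).sm (h.sol i).pos _ hr hs]; ring
  obtain ⟨G, hG, bG⟩ := hgr0.get hρ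
  have hd1 : (1:ℝ) ≤ d := by exact_mod_cast h.hd
  set Kc := 2*G^2/a0 + a0*d + d*G^2/a0
  have hKc : 0 ≤ Kc := by positivity
  set cc := a0 / (1 + 4*Mf^2)
  obtain ⟨M, hM⟩ := bern d h.hd (Mw := Mf^2) (C := Kc + 4*L + 2*Mf*MB) (c := cc) hρ'.1 hρ1 hρ2.le (by positivity) (by positivity) ha1 (by positivity)
  refine ⟨M, fun i => hM (c i) (h.ctr i) _ (fun r s => Ds^[j] (v i) r s ^ 2) (aa q c0 v i) ?_ ?_ (fun r s _ => sq_nonneg _) fun r s hq hr => ?_⟩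
  · exact ((h.sol i).sm.dsj hIV j).dr hIV
  · exact ((h.sol i).sm.dsj hIV j).pow 2
  have hs := hq.mem (by linarith)
  have sf := (h.sol i).sm.dsj hIV j
  obtain ⟨A0, A1⟩ := hab i r s (hq.mono hρ2.le)
  have bf := bf i r s hq
  have bB := bB i r s hq
  have bG := bG i r s hq
  have bL := bL i r s hq
  have sa := (aa_alg (q := q) (c0 := c0) (v := v)).sm h.sol i
  have sB := (BB_alg h.sol j).sm h.sol i
  have eg := grad_eq hIV (d := d) sf sa sB hr hs (fun r hr => h.fj_eq j i hr hs)
  have ef := h.fj_eq j i hr hs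
  have hJ : 0 ≤ (d:ℝ) / sinh r ^ 2 := by positivity
  refine ⟨by linarith, A1, ?_, ?_, ?_⟩
  · rw [← sq_abs]; gcongr
  · rw [eg]
    have hab := absorb (n := Dr (Ds^[j] (v i)) r s) (nr := Dr (Dr (Ds^[j] (v i))) r s) hd1 hJ (HH_nn hr) (HH_sq d hr) ha0 A0 hG bG
    set n := Dr (Ds^[j] (v i)) r s
    rw [show LL d (Ds^[j] (v i)) r s = Dr (Dr (Ds^[j] (v i))) r s + HH d r * n from rfl]
    have h1 : 2*n*Dr (BB q v j i) r s ≤ 2*(L*(1+|n|))*|n| := by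
      refine (le_abs_self _).trans ?_
      rw [abs_mul, abs_mul, abs_two, mul_right_comm]; gcongr
    have h2 : |n|^2 ≤ |n|^3+1 := by
      have : |n|^3 + 1 - |n|^2 = (|n|-1)^2*(|n|+1) + |n| := by ring
      have h3 : 0 ≤ (|n|-1)^2*(|n|+1) + |n| := by positivity
      linarith
    have h3 : |n| ≤ |n|^3+1 := by linarith [sq_nonneg (|n|-1), sq_nonneg |n|, mul_nonneg (abs_nonneg n) (sq_nonneg (|n|-1))]
    have h4 : Kc*n^2 ≤ Kc*(|n|^3+1) := by rw [← sq_abs]; gcongr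
    have h5 : 2*(L*(1+|n|))*|n| ≤ 4*L*(|n|^3+1) := by
      have : 2*(L*(1+|n|))*|n| = 2*L*(|n|+|n|^2) := by ring
      rw [this]
      calc _ ≤ 2*L*((|n|^3+1)+(|n|^3+1)) := by gcongr
        _ = _ := by ring
    have h6 : 0 ≤ 2*Mf*MB*(|n|^3+1) := by positivity
    have h7 : 0 ≤ aa q c0 v i r s*(d / sinh r ^ 2)*n^2 := mul_nonneg (mul_nonneg (by linarith) hJ) (sq_nonneg _)
    have h8 : 0 ≤ aa q c0 v i r s * Dr (Dr (Ds^[j] (v i))) r s ^ 2 := mul_nonneg (by linarith) (sq_nonneg _)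
    linarith
  · rw [Ds_pow hIV sf 2 hr.le hs, LL_sq hIV sf hr.le hs, Dr_pow sf 2 hr.le hs, ef]
    set n := Dr (Ds^[j] (v i)) r s
    set f := Ds^[j] (v i) r s
    have h1 : 2*f*BB q v j i r s ≤ 2*Mf*MB := by
      refine (le_abs_self _).trans ?_
      rw [abs_mul, abs_mul, abs_two]; gcongr
    have h2 : cc*(n^2+(2*f*n)^2) ≤ a0*n^2 := by
      have : f^2 ≤ Mf^2 := by rw [← sq_abs]; gcongr
      calc cc*(n^2+(2*f*n)^2) = cc*(1+4*f^2)*n^2 := by ring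
        _ ≤ cc*(1+4*Mf^2)*n^2 := by gcongr
        _ = _ := by simp only [cc]; field_simp
    have h3 : a0*n^2 ≤ aa q c0 v i r s*n^2 := by gcongr
    have h4 : 0 ≤ a0*n^2 := by positivity
    norm_num
    linarith

set_option maxHeartbeats 1000000 in
lemma Fam.step_time (h : Fam d q c0 v c) (j : ℕ) (hf : ∀ k ≤ j, UB c (fun i => Ds^[k] (v i)))
    (hg : ∀ k ≤ j, UB c (fun i => Dr (Ds^[k] (v i)))) : UB c (fun i => Ds^[j+1] (v i)) := UB.mk fun ρ' hρ' => by
  obtain ⟨a0, ha0, a1, ha1, hab⟩ := h.aa_bd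
  obtain ⟨ρ, hρ1, hρ2⟩ := exists_between hρ'.2
  have hρ : ρ ∈ Ioo (0:ℝ) 1 := ⟨hρ'.1.trans hρ1, hρ2⟩
  obtain ⟨Mn, hMn, bn⟩ := (hg j le_rfl).get hρ
  obtain ⟨MB, hMB, bB⟩ := ((BB_alg h.sol j).ub h hf).get hρ
  obtain ⟨L0, hL0, bL⟩ := ((BB_alg h.sol j).lb der_Dr h le_rfl hf (fun k hk => hg k hk.le)) ρ hρ
  obtain ⟨L1, hL1, bL1⟩ := ((RR_alg h.sol j).lb der_Ds h le_rfl hf (fun k hk => by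
    simpa only [← Function.iterate_succ_apply' Ds] using hf (k+1) hk)) ρ hρ
  obtain ⟨P1, hP1, bP1⟩ := (h.pw (1-q)).get hρ
  obtain ⟨P2, hP2, bP2⟩ := (h.pw (q-2)).get hρ
  have hf1 : LB c (fun i => Ds^[j+1] (v i)) (fun i => Ds (v i)) := by
    rcases Nat.eq_zero_or_pos j with rfl | hj
    · exact LB.self
    · exact (hf 1 hj).lb
  obtain ⟨L2, hL2, bL2⟩ := hf1 ρ hρ
  have hgr0 : UB c (fun i => Dr (aa q c0 v i)) := by
    refine (h.gr.umul ((h.pw (1-q-1)).umul (UB.const (c0/q*(1-q))))).congr fun i r s hr hs => ?_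
    unfold aa
    rw [Dr_mul (Sm.const _) ((h.sol i).sm.rpow (h.sol i).pos _) hr hs, Dr_const _ hr, Dr_rpow (h.sol i).sm (h.sol i).pos _ hr hs]; ring
  obtain ⟨G, hG, bG⟩ := hgr0.get hρ
  have hd1 : (1:ℝ) ≤ d := by exact_mod_cast h.hd
  have hq1 := h.hq
  set Kc := 2*G^2/a0 + a0*d + d*G^2/a0
  have hKc : 0 ≤ Kc := by positivity
  set cc := a0 / (6*a1^2*d + 8*Mn^2 + 1)
  have hcc : 0 < cc := by positivity
  set CB := 1/q*P1*(q*(q-1)*P2*L2 + L1)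
  have hq1' : 0 ≤ q - 1 := by linarith
  set C := Kc*Mn^2 + 2*Mn*(L0*(1+Mn)) + cc*(3*a1^2*d^2*Mn^2+3*MB^2) + 8*CB
  obtain ⟨M, hM⟩ := bern d h.hd (Mw := Mn^2) (C := C) (c := cc) hρ'.1 hρ1 hρ2.le hcc (by positivity) ha1 (by positivity)
  refine ⟨M, fun i => hM (c i) (h.ctr i) _ (fun r s => Dr (Ds^[j] (v i)) r s ^ 2) (aa q c0 v i) ?_ ?_ (fun r s _ => sq_nonneg _) fun r s hq hr => ?_⟩
  · exact ((h.sol i).sm.dsj hIV _)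
  · exact (((h.sol i).sm.dsj hIV j).dr hIV).pow 2
  have hs := hq.mem (by linarith)
  have sf := (h.sol i).sm.dsj hIV j
  have sn := sf.dr hIV
  obtain ⟨A0, A1⟩ := hab i r s (hq.mono hρ2.le)
  have bn := bn i r s hq
  have bB := bB i r s hq
  have bG := bG i r s hq
  have bL := bL i r s hq
  have bL1 := bL1 i r s hq
  have bL2 := bL2 i r s hq
  have bP1 := bP1 i r s hq
  have bP2 := bP2 i r s hq
  have sa := (aa_alg (q := q) (c0 := c0) (v := v)).sm h.sol i
  have sB := (BB_alg h.sol j).sm h.sol i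
  have eg := grad_eq hIV (d := d) sf sa sB hr hs (fun r hr => h.fj_eq j i hr hs)
  have ef := h.fj_eq j i hr hs
  have ef1 := h.fj_eq (j+1) i hr hs
  beta_reduce at bL1
  rw [← Function.iterate_succ_apply' Ds j] at ef bL1
  have hJ : 0 ≤ (d:ℝ) / sinh r ^ 2 := by positivity
  refine ⟨by linarith, A1, ?_, ?_, ?_⟩
  · rw [← sq_abs]; gcongr
  · rw [ef1]
    set x := Ds^[j+1] (v i) r s with hx
    have hB : |BB q v (j+1) i r s| ≤ CB*(1+|x|)^2 := by
      unfold BB; simp only [RR]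
      rw [abs_mul, abs_mul, neg_div, abs_neg, abs_of_pos (by positivity : 0 < 1/q)]
      have : |q * (q-1) * v i r s ^ (q-2) * (Ds (v i) r s * Ds^[j+1] (v i) r s) + Ds (RR q v j i) r s|
          ≤ q*(q-1)*P2*(L2*(1+|x|)*(1+|x|)) + L1*(1+|x|)*(1+|x|) := by
        refine (abs_add_le _ _).trans (add_le_add ?_ ?_)
        · rw [abs_mul, abs_mul, abs_mul, abs_of_nonneg hq1', abs_of_pos (by linarith : 0 < q), abs_mul, ← hx]
          gcongr; linarith
        · refine bL1.trans (le_mul_of_one_le_right (by positivity) (by linarith [abs_nonneg x]))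
      calc _ ≤ 1/q*P1*(q*(q-1)*P2*(L2*(1+|x|)*(1+|x|)) + L1*(1+|x|)*(1+|x|)) := by gcongr
        _ = _ := by simp only [CB]; ring
    have h1 : 2*x*BB q v (j+1) i r s ≤ 8*CB*(|x|^3+1) := by
      refine (le_abs_self _).trans ?_
      rw [abs_mul, abs_mul, abs_two]
      have hy := abs_nonneg x
      have h3 : |x| * (1+|x|)^2 ≤ 4*(|x|^3+1) := by
        linarith [hy, sq_nonneg (|x|-1), mul_nonneg hy (sq_nonneg (|x|-1))]
      have hCB : 0 ≤ CB := by positivity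
      calc _ ≤ 2*|x| * (CB*(1+|x|)^2) := by gcongr
        _ = 2*CB*(|x| * (1+|x|)^2) := by ring
        _ ≤ 2*CB*(4*(|x|^3+1)) := by gcongr
        _ = _ := by ring
    have h2 : 0 ≤ aa q c0 v i r s * Dr (Ds^[j+1] (v i)) r s ^ 2 := mul_nonneg (by linarith) (sq_nonneg _)
    have h3 : 8*CB*(|x|^3+1) ≤ C*(|x|^3+1) := by
      gcongr
      have : 0 ≤ Kc*Mn^2 + 2*Mn*(L0*(1+Mn)) + cc*(3*a1^2*d^2*Mn^2+3*MB^2) := by positivity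
      simp only [C]; linarith
    linarith
  · rw [Ds_pow hIV sn 2 hr.le hs, LL_sq hIV sn hr.le hs, Dr_pow sn 2 hr.le hs, eg, ef]
    have hab := absorb (n := Dr (Ds^[j] (v i)) r s) (nr := Dr (Dr (Ds^[j] (v i))) r s) hd1 hJ (HH_nn hr) (HH_sq d hr) ha0 A0 hG bG
    have hHs := HH_sq d hr
    set n := Dr (Ds^[j] (v i)) r s
    rw [show LL d (Ds^[j] (v i)) r s = Dr (Dr (Ds^[j] (v i))) r s + HH d r * n from rfl]
    set nr := Dr (Dr (Ds^[j] (v i))) r s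
    set a := aa q c0 v i r s
    set J := (d:ℝ) / sinh r ^ 2
    set B := BB q v j i r s
    have hn2 : n^2 ≤ Mn^2 := by rw [← sq_abs]; gcongr
    have ha2 : a^2 ≤ a1^2 := by gcongr; linarith
    have hB2 : B^2 ≤ MB^2 := by rw [← sq_abs]; gcongr
    have h1 : 2*n*Dr (BB q v j i) r s ≤ 2*Mn*(L0*(1+Mn)) := by
      refine (le_abs_self _).trans ?_
      rw [abs_mul, abs_mul, abs_two]
      calc _ ≤ 2*Mn*(L0*(1+|n|)) := by gcongr
        _ ≤ _ := by gcongr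
    have h2 : (a*(nr+HH d r*n)+B)^2 ≤ 3*a1^2*nr^2 + 3*a1^2*d^2*Mn^2 + 3*a1^2*d*(J*n^2) + 3*MB^2 := by
      have u1 : (a*(nr+HH d r*n)+B)^2 ≤ 3*(a^2*nr^2) + 3*(a^2*(HH d r*n)^2) + 3*B^2 := by
        linarith [sq_nonneg (a*nr - a*(HH d r*n)), sq_nonneg (a*nr - B), sq_nonneg (a*(HH d r*n) - B)]
      have u2 : a^2*(HH d r*n)^2 ≤ a1^2*(d^2*Mn^2 + d*(J*n^2)) := by
        rw [mul_pow, hHs]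
        gcongr
        have := mul_le_mul_of_nonneg_left hn2 (sq_nonneg (d:ℝ))
        linarith
      have u3 : a^2*nr^2 ≤ a1^2*nr^2 := by gcongr
      linarith
    have h3 : (2*n*nr)^2 ≤ 4*Mn^2*nr^2 := by
      calc _ = 4*n^2*nr^2 := by ring
        _ ≤ _ := by gcongr
    have h4 : cc*(6*a1^2*d + 8*Mn^2 + 1) = a0 := by simp only [cc]; field_simp
    have hJn : 0 ≤ J*n^2 := by positivity
    have h5 : cc*(3*a1^2 + 4*Mn^2)*nr^2 ≤ a0/2*nr^2 := by
      gcongr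
      have : cc*(a1^2*1) ≤ cc*(a1^2*d) := by gcongr
      linarith
    have h6 : cc*(3*a1^2*d)*(J*n^2) ≤ a0/2*(J*n^2) := by
      gcongr
      have : 0 ≤ cc*Mn^2 := by positivity
      linarith
    have h7 : a0*nr^2 ≤ a*nr^2 := by gcongr
    have h8 : a0*(J*n^2) ≤ a*(J*n^2) := by gcongr
    have h9 : Kc*n^2 ≤ Kc*Mn^2 := by gcongr
    have h10 : cc*((a*(nr+HH d r*n)+B)^2 + (2*n*nr)^2) ≤ cc*((3*a1^2*nr^2 + 3*a1^2*d^2*Mn^2 + 3*a1^2*d*(J*n^2) + 3*MB^2) + 4*Mn^2*nr^2) := by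
      gcongr
    have hCB : 0 ≤ 8*CB := by positivity
    have hn0 : 0 ≤ a0*nr^2 := by positivity
    have hn1 : 0 ≤ a0*(J*n^2) := by positivity
    norm_num
    simp only [C]
    linarith

lemma Fam.all (h : Fam d q c0 v c) (j : ℕ) : UB c (fun i => Ds^[j] (v i)) ∧ UB c (fun i => Dr (Ds^[j] (v i))) := by
  induction j using Nat.strong_induction_on with
  | _ j ih =>
    rcases Nat.eq_zero_or_pos j with rfl | hj
    · exact ⟨(h.pw 1).congr fun i r s _ _ => by simp, h.gr⟩
    · obtain ⟨k, rfl⟩ : ∃ k, j = k+1 := ⟨j-1, by omega⟩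
      have h1 := h.step_time k (fun l hl => (ih l (by omega)).1) (fun l hl => (ih l (by omega)).2)
      refine ⟨h1, h.step_grad (k+1) hj (fun l hl => ?_) (fun l hl => (ih l hl).2)⟩
      rcases hl.lt_or_eq with hl | hl
      · exact (ih l hl).1
      · rw [hl]; exact h1
end

section
variable {ι : Type} {c : ι → ℝ} {v F G : ι → ℝ → ℝ → ℝ} {d n k : ℕ} {q c0 : ℝ}

def Reg (c : ι → ℝ) : ℕ → (ι → ℝ → ℝ → ℝ) → Prop
  | 0, F => UB c F
  | k+1, F => UB c F ∧ Reg c k (fun i => Dr (F i))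

lemma Reg.ub (h : Reg c k F) : UB c F := by cases k with
  | zero => exact h
  | succ k => exact h.1
lemma Reg.down (h : Reg c (k+1) F) : Reg c k F := by
  induction k generalizing F with
  | zero => exact h.1
  | succ k ih => exact ⟨h.1, ih h.2⟩
lemma Reg.congr (h : Reg c k F) (e : ∀ i r s, 0 ≤ r → s ∈ IV → G i r s = F i r s) : Reg c k G := by
  induction k generalizing F G with
  | zero => exact LB.congr h e
  | succ k ih => exact ⟨h.1.congr e, ih h.2 fun i r s hr hs => Dr_congr hr fun r hr => e i r s hr hs⟩
lemma Reg.const (a : ℝ) : Reg c k (fun _ _ _ => a) := by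
  induction k generalizing a with
  | zero => exact UB.const a
  | succ k ih => exact ⟨UB.const a, (ih 0).congr fun i r s hr _ => Dr_const a hr⟩
lemma Reg.add (sF : ∀ i, Sm IV (F i)) (sG : ∀ i, Sm IV (G i)) (h : Reg c k F) (h' : Reg c k G) :
    Reg c k (fun i r s => F i r s + G i r s) := by
  induction k generalizing F G with
  | zero => exact LB.add h h'
  | succ k ih => exact ⟨LB.add h.1 h'.1, (ih (fun i => (sF i).dr hIV) (fun i => (sG i).dr hIV) h.2 h'.2).congr
      fun i r s hr hs => Dr_add (sF i) (sG i) hr hs⟩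
lemma Reg.mul (sF : ∀ i, Sm IV (F i)) (sG : ∀ i, Sm IV (G i)) (h : Reg c k F) (h' : Reg c k G) :
    Reg c k (fun i r s => F i r s * G i r s) := by
  induction k generalizing F G with
  | zero => exact LB.umul h' h
  | succ k ih =>
    have dF := fun i => (sF i).dr hIV
    have dG := fun i => (sG i).dr hIV
    exact ⟨LB.umul h'.1 h.1, (Reg.add (fun i => (dF i).mul (sG i)) (fun i => (sF i).mul (dG i)) (ih dF sG h.2 h'.down)
      (ih sF dG h.down h'.2)).congr fun i r s hr hs => Dr_mul (sF i) (sG i) hr hs⟩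
lemma Reg.iter (h : Reg c k F) : UB c (fun i => Dr^[k] (F i)) := by
  induction k generalizing F with
  | zero => exact h
  | succ k ih => exact ih h.2

lemma Fam.reg_pw (h : Fam d q c0 v c) (hv : Reg c k v) (γ : ℝ) : Reg c k (fun i r s => v i r s ^ γ) := by
  induction k generalizing γ with
  | zero => exact h.pw γ
  | succ k ih =>
    have s1 := fun i => (h.sol i).sm.rpow (h.sol i).pos (γ-1)
    exact ⟨h.pw γ, (Reg.mul (fun i => (Sm.const γ).mul (s1 i)) (fun i => (h.sol i).sm.dr hIV) (Reg.mul (fun i => Sm.const γ) s1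
      (Reg.const γ) (ih hv.down (γ-1))) hv.2).congr fun i r s hr hs => Dr_rpow (h.sol i).sm (h.sol i).pos γ hr hs⟩

lemma Alg.reg (h : Fam d q c0 v c) (hA : Alg v n F) (hf : ∀ j, Reg c k (fun i => Ds^[j] (v i))) : Reg c k F := by
  induction hA with
  | pw γ _ => exact h.reg_pw (hf 0) γ
  | fj j _ _ => exact hf j
  | const a _ => exact Reg.const a
  | add a b h1 h2 => exact h1.add (a.sm h.sol) (b.sm h.sol) h2
  | mul a b h1 h2 => exact h1.mul (a.sm h.sol) (b.sm h.sol) h2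
  | congr _ e h1 => exact h1.congr e

lemma Alg.dsj (hv : ∀ i, Sol d q c0 IV (v i)) (h : Alg v n F) (j : ℕ) : Alg v (n+j) (fun i => Ds^[j] (F i)) := by
  induction j with
  | zero => exact h
  | succ j ih => exact .congr (ih.ds hv) fun i r s _ _ => by rw [Function.iterate_succ_apply']

lemma sm_of {f : ℝ → ℝ} (hf : ContDiff ℝ (⊤ : ℕ∞) f) : Sm IV (fun r _ => f r) :=
  Sm.of (F := fun r _ => f r) (hf.comp contDiff_fst)
lemma Dr_of {f : ℝ → ℝ} {f' r s : ℝ} (hr : 0 ≤ r) (h : HasDerivAt f f' r) : Dr (fun r _ => f r) r s = f' :=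
  Dr_eq hr h.hasDerivWithinAt

lemma near_r (hc : ∀ i, c i = 0) {i : ι} {ρ r s : ℝ} (hρ : ρ ∈ Ioo (0:ℝ) 1) (h : InQ (c i) ρ r s) : r ≤ 2 := by
  have h1 := h.2.1
  have : Rc (c i) = 2 := by unfold Rc; rw [if_pos (hc i)]
  rw [this, hc i, sub_zero] at h1
  linarith [le_abs_self r, hρ.2]
lemma far_r (hc : ∀ i, 1 ≤ c i) {i : ι} {ρ r s : ℝ} (hρ : ρ ∈ Ioo (0:ℝ) 1) (h : InQ (c i) ρ r s) : 1/2 ≤ r := by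
  have h1 := h.2.1
  have : Rc (c i) = 1/2 := by unfold Rc; rw [if_neg (by linarith [hc i])]
  rw [this] at h1
  linarith [(abs_le.1 h1).1, hρ.2, hc i]

lemma reg_hyp (hc : ∀ i, c i = 0) : Reg c k (fun _ r _ => sinh r) ∧ Reg c k (fun _ r _ => cosh r) := by
  have u1 : UB c (fun _ r _ => sinh r) := UB.mk fun ρ hρ => ⟨sinh 2, fun i r s hq => by
    rw [abs_of_nonneg (sinh_nn hq.1)]; exact Real.sinh_le_sinh.2 (near_r hc hρ hq)⟩
  have u2 : UB c (fun _ r _ => cosh r) := UB.mk fun ρ hρ => ⟨cosh 2, fun i r s hq => by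
    rw [abs_of_pos (cosh_pos r)]
    exact Real.cosh_le_cosh.2 (by rw [abs_of_nonneg hq.1, abs_two]; exact near_r hc hρ hq)⟩
  induction k with
  | zero => exact ⟨u1, u2⟩
  | succ k ih => exact ⟨⟨u1, ih.2.congr fun i r s hr _ => Dr_of hr (Real.hasDerivAt_sinh r)⟩,
      ⟨u2, ih.1.congr fun i r s hr _ => Dr_of hr (Real.hasDerivAt_cosh r)⟩⟩
lemma reg_exp : Reg c k (fun _ r _ => exp (-2*r)) := by
  have u : UB c (fun _ r _ => exp (-2*r)) := UB.mk fun ρ hρ => ⟨1, fun i r s hq => by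
    rw [abs_of_pos (exp_pos _)]; exact exp_le_one_iff.2 (by linarith [hq.1])⟩
  induction k with
  | zero => exact u
  | succ k ih =>
    refine ⟨u, (Reg.mul (fun _ => Sm.const (-2)) (fun _ => sm_of (f := fun r => exp (-2*r)) (by fun_prop)) (Reg.const (-2)) ih).congr fun i r s hr _ => Dr_of hr ?_⟩
    exact (((hasDerivAt_id r).const_mul (-2)).exp).congr_deriv (by simp; ring)

lemma near_ub (hc : ∀ i, c i = 0) {f : ι → ℝ → ℝ → ℝ} (sf : ∀ i, Sm IV (f i)) (hn : 1 ≤ n)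
    (e : ∀ i r s, 0 ≤ r → s ∈ IV → sinh r * Dr (f i) r s + n * cosh r * f i r s = G i r s) (hG : UB c G) : UB c f :=
  UB.mk fun ρ hρ => by
    obtain ⟨M, hM, bM⟩ := hG.get hρ
    refine ⟨M, fun i r s hq => ?_⟩
    have hs := hq.mem (by linarith [hρ.2])
    have hn0 : (1:ℝ) ≤ n := by exact_mod_cast hn
    have hin : ∀ x ∈ Icc 0 r, InQ (c i) ρ x s := fun x hx => ⟨hx.1, by
      have := hq.2.1
      rw [hc i, sub_zero, abs_of_nonneg hq.1] at this
      rw [hc i, sub_zero, abs_of_nonneg hx.1]; exact hx.2.trans this, hq.2.2.1, hq.2.2.2⟩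
    have hMn : M/n ≤ M := div_le_self hM hn0
    rcases hq.1.eq_or_lt with h0 | h0
    · have := e i r s hq.1 hs
      have h2 := bM i r s hq
      rw [← this, ← h0] at h2
      simp only [sinh_zero, Real.cosh_zero, zero_mul, zero_add, mul_one, abs_mul, abs_of_pos (by linarith : (0:ℝ) < n)] at h2
      rw [← h0]; nlinarith [abs_nonneg (f i 0 s)]
    have hder : ∀ (σ : ℝ), ∀ x ∈ Ioo 0 r, HasDerivAt (fun x => sinh x ^ n * (M/n - σ * f i x s))
        (sinh x ^ (n-1) * (M * cosh x - σ * G i x s)) x := by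
      intro σ x hx
      refine (((Real.hasDerivAt_sinh x).fun_pow n).fun_mul ((((sf i).hasDr' hx.1 hs).const_mul σ).const_sub (M/n))).congr_deriv ?_
      rw [← e i x s hx.1.le hs]
      obtain ⟨l, rfl⟩ : ∃ l, n = l+1 := ⟨n-1, by omega⟩
      simp only [Nat.add_sub_cancel]
      field_simp
      push_cast
      ring
    have hmono : ∀ σ : ℝ, |σ| = 1 → σ * f i r s ≤ M := by
      intro σ hσ
      have := monotoneOn_of_deriv_nonneg (convex_Icc 0 r) (f := fun x => sinh x ^ n * (M/n - σ * f i x s))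
        (ContinuousOn.mul (by fun_prop) (continuousOn_const.sub (continuousOn_const.mul (((sf i).contr hs).mono fun x hx => hx.1))))
        (fun x hx => by rw [interior_Icc] at hx; exact (hder σ x hx).differentiableAt.differentiableWithinAt)
        (fun x hx => by
          rw [interior_Icc] at hx
          rw [(hder σ x hx).deriv]
          have h1 := bM i x s (hin x (Ioo_subset_Icc_self hx))
          have h2 : σ * G i x s ≤ M := by
            refine (le_abs_self _).trans ?_
            rw [abs_mul, hσ, one_mul]; exact h1
          have h3 := Real.one_le_cosh x
          have := sinh_nn hx.1.le
          refine mul_nonneg (by positivity) (by nlinarith)) ⟨le_rfl, h0.le⟩ ⟨h0.le, le_rfl⟩ h0.le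
      simp only [sinh_zero, zero_pow (by omega : n ≠ 0), zero_mul] at this
      have := nonneg_of_mul_nonneg_right this (pow_pos (sinh_pos' h0) n)
      linarith
    rw [abs_le]
    constructor <;> linarith [hmono 1 (by simp), hmono (-1) (by simp)]

lemma near_ode (hc : ∀ i, c i = 0) {f : ι → ℝ → ℝ → ℝ} (sf : ∀ i, Sm IV (f i)) (sG : ∀ i, Sm IV (G i)) (hn : 1 ≤ n)
    (e : ∀ i r s, 0 ≤ r → s ∈ IV → sinh r * Dr (f i) r s + n * cosh r * f i r s = G i r s) (hG : Reg c k G) : Reg c k f := by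
  induction k generalizing f G n with
  | zero => exact near_ub hc sf hn e hG
  | succ k ih =>
    have hf := ih sf sG hn e hG.down
    have sS : Sm IV (fun r _ => sinh r) := sm_of Real.contDiff_sinh
    have sC : Sm IV (fun r _ => cosh r) := sm_of Real.contDiff_cosh
    have df := fun i => (sf i).dr hIV
    have dG := fun i => (sG i).dr hIV
    refine ⟨near_ub hc sf hn e hG.ub, ih (G := fun i r s => Dr (G i) r s + -(n:ℝ) * (sinh r * f i r s)) (n := n+1) df
      (fun i => (dG i).add ((Sm.const _).mul (sS.mul (sf i)))) (by omega) (fun i r s hr hs => ?_) ?_⟩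
    · have e1 : Dr (fun r s => sinh r * Dr (f i) r s + n * cosh r * f i r s) r s = Dr (G i) r s :=
        Dr_congr hr fun r hr => e i r s hr hs
      rw [Dr_add (sS.mul (df i)) (((Sm.const _).mul sC).mul (sf i)) hr hs, Dr_mul sS (df i) hr hs, Dr_mul ((Sm.const _).mul sC) (sf i) hr hs,
        Dr_mul (Sm.const _) sC hr hs, Dr_const _ hr, Dr_of hr (Real.hasDerivAt_sinh r), Dr_of hr (Real.hasDerivAt_cosh r)] at e1
      push_cast
      linarith
    · exact Reg.add dG (fun i => (Sm.const _).mul (sS.mul (sf i))) hG.2 (Reg.mul (fun i => Sm.const _) (fun i => sS.mul (sf i)) (Reg.const _)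
        (Reg.mul (fun _ => sS) sf (reg_hyp hc).1 hf))

lemma far_div (hc : ∀ i, 1 ≤ c i) {f : ι → ℝ → ℝ → ℝ} (sf : ∀ i, Sm IV (f i)) (sG : ∀ i, Sm IV (G i))
    (e : ∀ i r s, 0 ≤ r → s ∈ IV → (1 - exp (-2*r)) * f i r s = G i r s) (hG : Reg c k G) : Reg c k f := by
  have ub : ∀ {f G : ι → ℝ → ℝ → ℝ}, (∀ i r s, 0 ≤ r → s ∈ IV → (1 - exp (-2*r)) * f i r s = G i r s) → UB c G → UB c f := by
    intro f G e hG
    refine UB.mk fun ρ hρ => ?_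
    obtain ⟨M, hM, bM⟩ := hG.get hρ
    refine ⟨2*M, fun i r s hq => ?_⟩
    have h1 := bM i r s hq
    have hr := far_r hc hρ hq
    rw [← e i r s hq.1 (hq.mem (by linarith [hρ.2])), abs_mul] at h1
    have h2 : exp (-2*r) ≤ 1/2 := by
      have h3 := Real.add_one_le_exp (2*r)
      rw [show -2*r = -(2*r) by ring, Real.exp_neg, inv_le_comm₀ (exp_pos _) (by norm_num)]
      linarith
    rw [abs_of_pos (by linarith)] at h1
    nlinarith [abs_nonneg (f i r s)]
  induction k generalizing f G with
  | zero => exact ub e hG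
  | succ k ih =>
    have hf := ih sf sG e hG.down
    have sE : Sm IV (fun r _ => exp (-2*r)) := sm_of (f := fun r => exp (-2*r)) (by fun_prop)
    have df := fun i => (sf i).dr hIV
    have dG := fun i => (sG i).dr hIV
    refine ⟨ub e hG.ub, ih (G := fun i r s => Dr (G i) r s + (-2:ℝ) * (exp (-2*r) * f i r s)) df
      (fun i => (dG i).add ((Sm.const _).mul (sE.mul (sf i)))) (fun i r s hr hs => ?_) ?_⟩
    · have e1 : Dr (fun r s => (1 - exp (-2*r)) * f i r s) r s = Dr (G i) r s :=
        Dr_congr hr fun r hr => e i r s hr hs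
      rw [Dr_mul ((Sm.const 1).sub sE) (sf i) hr hs, Dr_sub (Sm.const 1) sE hr hs, Dr_const _ hr,
        Dr_of (f := fun r => exp (-2*r)) (f' := -2*exp (-2*r)) hr (((hasDerivAt_id r).const_mul (-2)).exp.congr_deriv (by simp; ring))] at e1
      linarith
    · exact Reg.add dG (fun i => (Sm.const _).mul (sE.mul (sf i))) hG.2 (Reg.mul (fun i => Sm.const _) (fun i => sE.mul (sf i)) (Reg.const _)
        (Reg.mul (fun _ => sE) sf reg_exp hf))

lemma eq_zero_of {I : Set ℝ} {f : ℝ → ℝ → ℝ} (sf : Sm I f) {s : ℝ} (hs : s ∈ I) (h : ∀ r > 0, f r s = 0) (r : ℝ) (hr : 0 ≤ r) : f r s = 0 := by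
  rcases hr.eq_or_lt with h0 | h0
  · rw [← h0]
    have h1 : Tendsto (fun r => f r s) (𝓝[>] 0) (𝓝 (f 0 s)) := ((sf.contr hs) 0 self_mem_Ici).mono Ioi_subset_Ici_self
    have h2 : Tendsto (fun r => f r s) (𝓝[>] 0) (𝓝 0) := by
      refine tendsto_const_nhds.congr' ?_
      filter_upwards [self_mem_nhdsWithin] with x hx using (h x hx).symm
    exact tendsto_nhds_unique h1 h2
  · exact h r h0

theorem Fam.reg (h : Fam d q c0 v c) (hc : (∀ i, c i = 0) ∨ ∀ i, 1 ≤ c i) (k : ℕ) : ∀ j, Reg c k (fun i => Ds^[j] (v i)) := by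
  induction k with
  | zero => exact fun j => (h.all j).1
  | succ k ih =>
    intro j
    refine ⟨(h.all j).1, ?_⟩
    have hA : Alg v (0+(j+1)) (fun i => Ds^[j+1] (fun r s => v i r s ^ q)) := (Alg.pw q 0).dsj h.sol (j+1)
    have sA := hA.sm h.sol
    have rA := hA.reg h ih
    have sf := fun i => (h.sol i).sm.dsj hIV j
    have dsf := fun i => (sf i).dr hIV
    have ddsf := fun i => (dsf i).dr hIV
    have sS : Sm IV (fun r _ => sinh r) := sm_of Real.contDiff_sinh
    have sC : Sm IV (fun r _ => cosh r) := sm_of Real.contDiff_cosh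
    have hc0 := h.hc0
    have e1 : ∀ i r s, 0 ≤ r → s ∈ IV → sinh r * Dr (Dr (Ds^[j] (v i))) r s + d * cosh r * Dr (Ds^[j] (v i)) r s
        = c0⁻¹ * (sinh r * Ds^[j+1] (fun r s => v i r s ^ q) r s) := by
      intro i r s hr hs
      have := eq_zero_of (((sS.mul (ddsf i)).add (((Sm.const d).mul sC).mul (dsf i))).sub ((Sm.const c0⁻¹).mul (sS.mul (sA i)))) hs
        (fun r hr => ?_) r hr
      · exact sub_eq_zero.1 this
      · have := (sinh_pos' hr).ne'
        rw [ujLL h.sol j i hr hs]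
        unfold LL HH
        field_simp
        ring
    rcases hc with hc | hc
    · exact near_ode hc dsf (fun i => (Sm.const c0⁻¹).mul (sS.mul (sA i))) h.hd e1
        (Reg.mul (fun i => Sm.const c0⁻¹) (fun i => sS.mul (sA i)) (Reg.const _) (Reg.mul (fun _ => sS) sA (reg_hyp hc).1 rA))
    · cases k with
      | zero => exact (h.all j).2
      | succ k =>
        refine ⟨(h.all j).2, ?_⟩
        have sE : Sm IV (fun r _ => exp (-2*r)) := sm_of (f := fun r => exp (-2*r)) (by fun_prop)
        have s1 := fun i => (Sm.const c0⁻¹).mul (((Sm.const 1).add ((Sm.const (-1)).mul sE)).mul (sA i))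
        have s2 := fun i => (Sm.const (-(d:ℝ))).mul (((Sm.const 1).add sE).mul (dsf i))
        refine far_div hc ddsf (fun i => (s1 i).add (s2 i)) (fun i r s hr hs => ?_) (Reg.add s1 s2 ?_ ?_)
        · have := e1 i r s hr hs
          have h2 : sinh r = exp r * (1 - exp (-2*r))/2 := by
            rw [Real.sinh_eq, mul_sub, ← exp_add]; ring_nf
          have h3 : cosh r = exp r * (1 + exp (-2*r))/2 := by
            rw [Real.cosh_eq, mul_add, ← exp_add]; ring_nf
          rw [h2, h3] at this
          have hp := exp_pos r
          refine mul_left_cancel₀ (by positivity : exp r/2 ≠ 0) ?_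
          linarith
        · exact Reg.mul (fun i => Sm.const _) (fun i => ((Sm.const 1).add ((Sm.const (-1)).mul sE)).mul (sA i)) (Reg.const _)
            (Reg.mul (fun _ => (Sm.const 1).add ((Sm.const (-1)).mul sE)) sA (Reg.add (fun _ => Sm.const 1) (fun _ => (Sm.const (-1)).mul sE)
              (Reg.const _) (Reg.mul (fun _ => Sm.const (-1)) (fun _ => sE) (Reg.const _) reg_exp)) rA.down)
        · exact Reg.mul (fun i => Sm.const _) (fun i => ((Sm.const 1).add sE).mul (dsf i)) (Reg.const _)
            (Reg.mul (fun _ => (Sm.const 1).add sE) dsf (Reg.add (fun _ => Sm.const 1) (fun _ => sE) (Reg.const _) reg_exp) (ih j).2)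

/-- everything we need from the interior theory -/
theorem Fam.final (h : Fam d q c0 v c) (hc : (∀ i, c i = 0) ∨ ∀ i, 1 ≤ c i) (k : ℕ) :
    UB c (fun i => Dr^[k] (fun r s => v i r s ^ q)) ∧ UB c (fun i => Ds^[k] (fun r s => v i r s ^ q)) :=
  ⟨((Alg.pw (v := v) q 0).reg h (h.reg hc k)).iter, (((Alg.pw (v := v) q 0).dsj h.sol k).reg h (k := 0) (h.reg hc 0))⟩
end

section
variable {d : ℕ} {q c0 : ℝ} {v : ℝ → ℝ → ℝ} {I : Set ℝ} {r s : ℝ}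

/-- the logarithmic time derivative -/
noncomputable def LQ (v : ℝ → ℝ → ℝ) (r s : ℝ) : ℝ := Ds v r s * v r s ^ (-1:ℝ)

lemma Sol.smQ (hI : IsOpen I) (h : Sol d q c0 I v) : Sm I (LQ v) := (h.sm.ds hI).mul (h.sm.rpow h.pos _)

lemma Sol.vQ (h : Sol d q c0 I v) (hr : 0 ≤ r) (hs : s ∈ I) : Ds v r s = v r s * LQ v r s := by
  have := (h.pos r hr s hs).ne'
  unfold LQ
  rw [Real.rpow_neg_one]; field_simp

lemma Sol.LQv (h : Sol d q c0 I v) (hc0 : 0 < c0) (hr : 0 < r) (hs : s ∈ I) :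
    LL d v r s = q/c0 * (v r s ^ q * LQ v r s) := by
  have h1 := h.eq r hr s hs
  have hp := h.pos r hr.le s hs
  rw [h.vQ hr.le hs, Real.rpow_sub_one hp.ne'] at h1
  field_simp at h1 ⊢
  linarith

lemma Sol.eqQ (hI : IsOpen I) (h : Sol d q c0 I v) (hc0 : 0 < c0) (hr : 0 < r) (hs : s ∈ I) :
    q/c0 * v r s ^ q * Ds (LQ v) r s = q/c0 * v r s ^ q * (LQ v r s)^2 * (1-q) + v r s * LL d (LQ v) r s
      + 2 * Dr v r s * Dr (LQ v) r s := by
  have sQ := h.smQ hI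
  have hp := h.pos r hr.le s hs
  have e1 : LL d (Ds v) r s = LL d (fun r s => v r s * LQ v r s) r s := LL_congr hr.le fun x hx => h.vQ hx hs
  rw [h.sm.ll_comm hI hr.le hs, LL_mul hI h.sm sQ hr.le hs] at e1
  have e2 : Ds (fun r s => LL d v r s) r s = Ds (fun r s => q/c0 * (v r s ^ q * LQ v r s)) r s :=
    Ds_congr hI hs fun x hx => h.LQv hc0 hr hx
  rw [e2, Ds_mul hI (Sm.const _) (h.smu.mul sQ) hr.le hs, Ds_const, Ds_mul hI h.smu sQ hr.le hs, Ds_rpow hI h.sm h.pos q hr.le hs, h.vQ hr.le hs,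
    h.LQv hc0 hr hs, Real.rpow_sub_one hp.ne'] at e1
  field_simp at e1 ⊢
  linarith

lemma Sol.dr0 (h : Sol d q c0 IV v) (hd : 1 ≤ d) (hc0 : 0 < c0) (hs : s ∈ IV) : Dr v 0 s = 0 := by
  have hI := hIV
  have sS : Sm IV (fun r _ => sinh r) := sm_of Real.contDiff_sinh
  have sC : Sm IV (fun r _ => cosh r) := sm_of Real.contDiff_cosh
  have dv := h.sm.dr hI
  have := eq_zero_of (((sS.mul (dv.dr hI)).add (((Sm.const d).mul sC).mul dv)).sub (sS.mul ((Sm.const (q/c0)).mul (h.smu.mul (h.smQ hI))))) hs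
    (fun r hr => by
      have h1 := h.LQv hc0 hr hs
      have := (sinh_pos' hr).ne'
      rw [← h1]
      unfold LL HH
      field_simp
      ring) 0 le_rfl
  have hd1 : (0:ℝ) < d := by exact_mod_cast hd
  simp at this
  rcases this with h | h
  · omega
  · exact h

lemma int_alg {p q K b0 b1 V1 : ℝ} (n : ℕ) (hp : 1 < p) (hq : 1 < q) (hpq : p*(q-1) < q+1) (hn : p ≤ n) (hK : 0 ≤ K) (hb0 : 0 < b0) (hb1 : 0 ≤ b1) (hV : 0 ≤ V1) :
    ∃ C > 0, ∀ P χ β V D e x : ℝ, 1 ≤ P → 0 ≤ χ → χ ≤ 3 → b0 ≤ β → β ≤ b1 → 0 ≤ V → V ≤ V1 → |e| ≤ 6 → 0 ≤ x → x ≤ 1 →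
      β*P^(p-2)*P*χ^(2*n+2)*((q+1)*P*(K-P)+p*(q-1)*(P-K)^2) + β*P^(p-2)*P^2*((2*n+2)*χ^(2*n+1)*x)
        ≤ C + p*V*((p-1)*P^(p-2)*D^2*χ^(2*n+2) + P^(p-2)*P*D*((2*n+2)*χ^(2*n+1)*e)) := by
  set C3 := K*(q+1)+p*(q-1)*K^2
  set c' := q+1-p*(q-1)
  have hc' : 0 < c' := by simp only [c']; linarith
  have hC3 : 0 ≤ C3 := by have : 0 < q-1 := by linarith
                          positivity
  have hp1 : 0 < p-1 := by linarith
  set C4 := p*V1*((n+1)^2*36/(p-1)) + b1*C3*9 + b1*((2*n+2)*3) + 1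
  have hC4 : 0 < C4 := by positivity
  set X := C4/(b0*c')
  have hX : 0 < X := by positivity
  refine ⟨C4*X^n, by positivity, fun P χ β V D e x hP hχ hχ3 hβ0 hβ1 hV0 hV1 he hx0 hx1 => ?_⟩
  have hP0 : 0 < P := by linarith
  have hβ : 0 ≤ β := by linarith
  set A := P^(p-2)
  have hA : 0 < A := rpow_pos_of_pos hP0 _
  have t1 : -(p*V*((p-1)*D^2*χ^2 + P*D*((2*n+2)*χ*e))) ≤ p*V1*((n+1)^2*36/(p-1)) * P^2 := by
    have h1 : -((p-1)*D^2*χ^2 + P*D*((2*n+2)*χ*e)) ≤ (n+1)^2*e^2/(p-1) * P^2 := by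
      have : (n+1)^2*e^2/(p-1) * P^2 + ((p-1)*D^2*χ^2 + P*D*((2*n+2)*χ*e)) = ((p-1)*D*χ + (n+1)*e*P)^2/(p-1) := by field_simp; ring
      have h2 : 0 ≤ ((p-1)*D*χ + (n+1)*e*P)^2/(p-1) := by positivity
      linarith
    have h3 : e^2 ≤ 36 := by rw [← sq_abs]; nlinarith [abs_nonneg e]
    calc _ = p*V*(-((p-1)*D^2*χ^2 + P*D*((2*n+2)*χ*e))) := by ring
      _ ≤ p*V*((n+1)^2*e^2/(p-1) * P^2) := by gcongr
      _ ≤ p*V1*((n+1)^2*36/(p-1) * P^2) := by gcongr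
      _ = _ := by ring
  have t2 : β*P*χ^2*((q+1)*P*(K-P)+p*(q-1)*(P-K)^2) ≤ -(b0*c'*P^3*χ^2) + b1*C3*9*P^2 := by
    have h1 : (q+1)*P*(K-P)+p*(q-1)*(P-K)^2 ≤ -c'*P^2 + C3*P := by
      have h2 : p*(q-1)*K^2*(P-1) ≥ 0 := by have : 0 < q-1 := by linarith
                                            have : 0 ≤ P-1 := by linarith
                                            positivity
      have h3 : 0 ≤ 2*(p*(q-1)*K*P) := by have : 0 < q-1 := by linarith
                                          positivity
      simp only [c', C3]; linarith
    have h4 : χ^2 ≤ 9 := by nlinarith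
    calc _ ≤ β*P*χ^2*(-c'*P^2 + C3*P) := by gcongr
      _ = -(β*c'*P^3*χ^2) + β*C3*χ^2*P^2 := by ring
      _ ≤ _ := by gcongr
  have t3 : β*P^2*((2*n+2)*χ*x) ≤ b1*((2*n+2)*3)*P^2 := by
    calc _ ≤ b1*P^2*((2*n+2)*3*1) := by gcongr
      _ = _ := by ring
  have t4 : A*χ^(2*n)*(P^2*(C4 - b0*c'*P*χ^2)) ≤ C4*X^n := by
    by_cases hh : C4 ≤ b0*c'*P*χ^2
    · have : A*χ^(2*n)*(P^2*(C4 - b0*c'*P*χ^2)) ≤ 0 := mul_nonpos_of_nonneg_of_nonpos (by positivity) (mul_nonpos_of_nonneg_of_nonpos (by positivity) (by linarith))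
      have : 0 ≤ C4*X^n := by positivity
      linarith
    · push Not at hh
      have hx : P*χ^2 ≤ X := by rw [le_div_iff₀ (by positivity)]; linarith
      have e1 : A*P^2 = P^p := by
        rw [← rpow_natCast, ← rpow_add hP0]; norm_num
      have e2 : P^p ≤ P^n := by rw [← rpow_natCast]; exact Real.rpow_le_rpow_of_exponent_le hP hn
      have h5 : 0 ≤ b0*c'*P*χ^2 := by positivity
      calc _ = P^p*χ^(2*n)*(C4 - b0*c'*P*χ^2) := by rw [← e1]; ring
        _ ≤ P^n*χ^(2*n)*C4 := by gcongr; linarith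
        _ = C4*(P*χ^2)^n := by rw [mul_pow, ← pow_mul]; ring
        _ ≤ _ := by gcongr
  have t5 := mul_le_mul_of_nonneg_left (add_le_add (add_le_add t1 t2) t3) (by positivity : 0 ≤ A*χ^(2*n))
  have t6 : A*χ^(2*n)*(p*V1*((n+1)^2*36/(p-1)) * P^2 + (-(b0*c'*P^3*χ^2) + b1*C3*9*P^2) + b1*((2*n+2)*3)*P^2) ≤ A*χ^(2*n)*(P^2*(C4 - b0*c'*P*χ^2)) := by
    gcongr
    have : 0 < P^2 := by positivity
    simp only [C4]; linarith
  have e : χ^(2*n+2) = χ^(2*n)*χ^2 := pow_add ..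
  have e' : χ^(2*n+1) = χ^(2*n)*χ := pow_succ ..
  rw [e, e']
  linarith

lemma near_int {m0 M0 K p : ℝ} (hd : 1 ≤ d) (hq : 1 < q) (hc0 : 0 < c0) (hm : 0 < m0) (hM : m0 ≤ M0) (hK : 0 ≤ K) (hp : 1 < p) (hpq : p*(q-1) < q+1) :
    ∃ C > 0, ∀ v, Sol d q c0 IV v → (∀ r ∈ Icc (0:ℝ) 2, ∀ s ∈ Icc (-3:ℝ) 0, m0 ≤ v r s ∧ v r s ≤ M0) → (∀ r, 0 ≤ r → ∀ s ∈ IV, LQ v r s ≤ K) →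
      ∀ s ∈ Icc (-2:ℝ) 0, ∫ r in (0:ℝ)..(1/2), sinh r ^ d * (K+1-LQ v r s)^p ≤ C := by
  obtain ⟨n, hn⟩ := exists_nat_ge p
  have hM0 : 0 < M0 := by linarith
  have hqc : 0 < q/c0 := by positivity
  obtain ⟨C, hC, hCp⟩ := int_alg (K := K+1) (b0 := q/c0*m0^(q+1)) (b1 := q/c0*M0^(q+1)) (V1 := M0^2) n hp hq hpq hn (by linarith) (by positivity) (by positivity) (by positivity)
  set W := ∫ r in (0:ℝ)..1, sinh r ^ d
  have hW : 0 ≤ W := intervalIntegral.integral_nonneg (by norm_num) fun r hr => pow_nonneg (sinh_nn hr.1) _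
  set b := q/c0*m0^(q+1)*(3/4)^(2*n+2)
  have hb : 0 < b := by positivity
  refine ⟨C*W*3/b + 1, by positivity, fun v h hv hQ s hs => ?_⟩
  set P := fun r s => K+1-LQ v r s with hPd
  set χ := fun r s : ℝ => (1-r^2)*(s+3) with hχd
  have sP : Sm IV P := (Sm.const _).sub (h.smQ hIV)
  have hP1 : ∀ r, 0 ≤ r → ∀ s ∈ IV, 1 ≤ P r s := fun r hr s hs => by have := hQ r hr s hs; simp only [hPd]; linarith
  have hP : ∀ r, 0 ≤ r → ∀ s ∈ IV, 0 < P r s := fun r hr s hs => by linarith [hP1 r hr s hs]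
  have sχ : Sm IV χ := Sm.of (by fun_prop)
  have sw : Sm IV (fun r _ => sinh r ^ d) := sm_of (f := fun r => sinh r ^ d) (by fun_prop)
  have svq := h.sm.rpow h.pos (q+1)
  have sPp := sP.rpow hP p
  have sη := sχ.pow (2*n+2)
  have sF := (sw.mul ((Sm.const (q/c0)).mul (svq.mul (sPp.mul sη))))
  have hsub : Icc (-3:ℝ) 0 ⊆ IV := fun x hx => ⟨by linarith [hx.1], by linarith [hx.2]⟩
  have eDs : ∀ r, 0 ≤ r → ∀ s ∈ IV, Ds (fun r s => sinh r ^ d * (q/c0 * (v r s ^ (q+1) * (P r s ^ p * χ r s ^ (2*n+2))))) r s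
      = sinh r ^ d * (q/c0 * (v r s ^ (q+1) * ((q+1) * (K+1-P r s) * P r s^p * χ r s^(2*n+2) + p * P r s^(p-1) * Ds P r s * χ r s^(2*n+2)
        + P r s^p * ((2*n+2) * χ r s^(2*n+1) * (1-r^2))))) := by
    intro r hr s hs
    have e1 : Ds χ r s = 1 - r^2 := Ds_eq ((((hasDerivAt_id s).add_const 3).const_mul (1-r^2)).congr_deriv (by ring))
    have e2 : v r s ^ (q+1-1) * Ds v r s = v r s^(q+1) * LQ v r s := by
      rw [h.vQ hr hs, ← mul_assoc, ← rpow_add_one (h.pos r hr s hs).ne']; ring_nf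
    have e3 : K+1-P r s = LQ v r s := by simp only [hPd]; ring
    rw [Ds_mul hIV sw ((Sm.const (q/c0)).mul (svq.mul (sPp.mul sη))) hr hs, Ds_mul hIV (Sm.const (q/c0)) (svq.mul (sPp.mul sη)) hr hs,
      Ds_mul hIV svq (sPp.mul sη) hr hs, Ds_mul hIV sPp sη hr hs, Ds_const, Ds_rpow hIV h.sm h.pos _ hr hs, Ds_rpow hIV sP hP _ hr hs,
      Ds_pow hIV sχ _ hr hs, e1, mul_assoc (q+1), e2, e3, Ds_eq (hasDerivAt_const _ _)]
    push_cast
    ring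
  set J := fun r s => (sinh r ^ d * Dr P r s) * (v r s ^ 2 * (P r s^(p-1) * χ r s^(2*n+2))) with hJ
  have sg := (h.sm.pow 2).mul ((sP.rpow hP (p-1)).mul sη)
  have sJ : Sm IV J := (sw.mul (sP.dr hIV)).mul sg
  have key : ∀ s ∈ Icc (-3:ℝ) 0, ∀ r ∈ Ioo (0:ℝ) 1, Ds (fun r s => sinh r ^ d * (q/c0 * (v r s ^ (q+1) * (P r s ^ p * χ r s ^ (2*n+2))))) r s
      ≤ C * sinh r ^ d + p * Dr J r s := by
    intro s hs r hr
    have hsI := hsub hs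
    have hr0 := hr.1
    have eJ : Dr J r s = sinh r ^ d * (LL d P r s * (v r s ^ 2 * (P r s^(p-1) * χ r s^(2*n+2))) + Dr P r s * (2 * v r s * Dr v r s * (P r s^(p-1) * χ r s^(2*n+2))
        + v r s^2 * ((p-1) * P r s^(p-2) * Dr P r s * χ r s^(2*n+2) + P r s^(p-1) * ((2*n+2) * χ r s^(2*n+1) * (-2*r*(s+3)))))) := by
      refine Dr_eq hr0.le ((((sP.hasFlux (d := d) hIV hr0 hsI).mul (sg.hasDr' hr0 hsI)).congr_deriv ?_).hasDerivWithinAt)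
      have e1 : Dr χ r s = -2*r*(s+3) := Dr_eq hr0.le (((((hasDerivAt_id r).fun_pow 2).const_sub 1).mul_const (s+3)).congr_deriv (by simp)).hasDerivWithinAt
      rw [Dr_mul (h.sm.pow 2) ((sP.rpow hP (p-1)).mul sη) hr0.le hsI, Dr_mul (sP.rpow hP (p-1)) sη hr0.le hsI, Dr_pow h.sm _ hr0.le hsI,
        Dr_pow sχ _ hr0.le hsI, Dr_rpow sP hP _ hr0.le hsI, e1]
      push_cast
      simp only [show p-1-1 = p-2 by ring, show 2-1 = 1 from rfl, pow_one]
      ring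
    obtain ⟨v1, v2⟩ := hv r ⟨hr0.le, by linarith [hr.2]⟩ s hs
    have hvp : 0 < v r s := by linarith
    have hr2 : r^2 ≤ 1 := by nlinarith [hr.2]
    have hχ0 : 0 ≤ χ r s := mul_nonneg (by linarith) (by linarith [hs.1])
    have hχ3 : χ r s ≤ 3 := by simp only [hχd]; nlinarith [hs.1, hs.2, sq_nonneg r]
    have hal := hCp (P r s) (χ r s) (q/c0*v r s^(q+1)) (v r s^2) (Dr P r s) (-2*r*(s+3)) (1-r^2) (hP1 r hr0.le s hsI) hχ0 hχ3 (by gcongr) (by gcongr)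
      (by positivity) (by gcongr) (by rw [abs_mul, abs_mul, abs_of_pos hr0, abs_of_nonneg (by linarith [hs.1] : 0 ≤ s+3)]; norm_num; nlinarith [hs.1, hs.2, hr.2])
      (by linarith) (by linarith [sq_nonneg r])
    have hPp := hP r hr0.le s hsI
    have p1 : P r s^(p-1) = P r s^(p-2)*P r s := by rw [← rpow_add_one hPp.ne']; ring_nf
    have p2 : P r s^p = P r s^(p-2)*P r s^2 := by rw [← rpow_natCast, ← rpow_add hPp]; norm_num
    have eP1 : Ds P r s = - Ds (LQ v) r s := by rw [Ds_sub hIV (Sm.const _) (h.smQ hIV) hr0.le hsI, Ds_const]; ring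
    have eP2 : Dr P r s = - Dr (LQ v) r s := by rw [Dr_sub (Sm.const _) (h.smQ hIV) hr0.le hsI, Dr_const _ hr0.le]; ring
    have eP3 : LL d P r s = - LL d (LQ v) r s := by rw [LL_sub hIV (Sm.const _) (h.smQ hIV) hr0.le hsI, LL_const _ hr0.le]; ring
    have eQ := h.eqQ hIV hc0 hr0 hsI
    have e3 : LQ v r s = K+1-P r s := by simp only [hPd]; ring
    rw [e3] at eQ
    have eQ' : q/c0*v r s^(q+1)*Ds P r s = q/c0*v r s^(q+1)*(P r s-(K+1))^2*(q-1) + v r s^2*LL d P r s + 2*v r s*Dr v r s*Dr P r s := by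
      rw [rpow_add_one hvp.ne', eP1, eP2, eP3]
      linear_combination (-v r s) * eQ
    rw [eDs r hr0.le s hsI, eJ, p1, p2]
    have hw : 0 ≤ sinh r ^ d := pow_nonneg (sinh_nn hr0.le) _
    have := mul_le_mul_of_nonneg_left hal hw
    have eQ2 := congrArg (fun x => x * (sinh r ^ d * (p * (P r s^(p-2)*P r s) * χ r s^(2*n+2)))) eQ'
    linarith
  have yder := fun s (hs : s ∈ Icc (-3:ℝ) 0) => sF.hasInt hIV (a := 0) (b := 1) le_rfl zero_le_one (hsub hs)
  have ybd : ∀ s ∈ Icc (-3:ℝ) 0, (∫ r in (0:ℝ)..1, Ds (fun r s => sinh r ^ d * (q/c0 * (v r s ^ (q+1) * (P r s ^ p * χ r s ^ (2*n+2))))) r s) ≤ C*W := by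
    intro s hs
    have hsI := hsub hs
    have i1 := sw.ii (a := 0) (b := 1) le_rfl zero_le_one hsI
    have i2 := (sJ.dr hIV).ii (a := 0) (b := 1) le_rfl zero_le_one hsI
    have := intervalIntegral.integral_mono_on_of_le_Ioo zero_le_one ((sF.ds hIV).ii le_rfl zero_le_one hsI) ((i1.const_mul C).add (i2.const_mul p)) (key s hs)
    rw [intervalIntegral.integral_add (i1.const_mul C) (i2.const_mul p), intervalIntegral.integral_const_mul, intervalIntegral.integral_const_mul,
      sJ.ftcr hIV le_rfl zero_le_one hsI] at this
    have e1 : J 1 s = 0 := by simp [hJ, hχd]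
    have e0 : J 0 s = 0 := by simp [hJ, show d ≠ 0 by omega]
    rw [e1, e0] at this
    linarith
  have hle := le_of_der (a := -3) (b := s) (c := C*W) (by linarith [hs.1]) (fun x hx => yder x ⟨hx.1, by linarith [hx.2, hs.2]⟩) (fun x hx => ybd x ⟨hx.1, by linarith [hx.2, hs.2]⟩)
  have hs3 : s ∈ Icc (-3:ℝ) 0 := ⟨by linarith [hs.1], hs.2⟩
  have hsI := hsub hs3
  have y0 : (∫ r in (0:ℝ)..1, sinh r ^ d * (q/c0 * (v r (-3) ^ (q+1) * (P r (-3) ^ p * χ r (-3) ^ (2*n+2))))) = 0 := by simp [hχd]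
  rw [y0] at hle
  have hnn : ∀ r ∈ Icc (0:ℝ) 1, 0 ≤ sinh r ^ d * (q/c0 * (v r s ^ (q+1) * (P r s ^ p * χ r s ^ (2*n+2)))) := fun r hr => by
    have h1 := (h.pos r hr.1 s hsI).le
    have h2 := (hP r hr.1 s hsI).le
    have h3 := sinh_nn hr.1
    have h4 : χ r s ^ (2*n+2) = (χ r s ^ (n+1))^2 := by rw [← pow_mul]; ring_nf
    rw [h4]
    positivity
  have m1 := intervalIntegral.integral_mono_interval (μ := volume) (a := 0) (b := 1/2) (c := 0) (d := 1) le_rfl (by norm_num) (by norm_num)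
    (f := fun r => sinh r ^ d * (q/c0 * (v r s ^ (q+1) * (P r s ^ p * χ r s ^ (2*n+2)))))
    ((ae_restrict_iff' measurableSet_Ioc).2 (Eventually.of_forall fun r hr => hnn r ⟨hr.1.le, hr.2⟩)) (sF.ii le_rfl zero_le_one hsI)
  have m2 := intervalIntegral.integral_mono_on (a := 0) (b := 1/2) (μ := volume) (by norm_num) (((sw.mul sPp).ii le_rfl (by norm_num) hsI).const_mul b) (sF.ii le_rfl (by norm_num) hsI) (fun r hr => by
    have h1 := (hv r ⟨hr.1, by linarith [hr.2]⟩ s hs3).1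
    have h2 := (hP r hr.1 s hsI).le
    have h3 := sinh_nn hr.1
    have h4 : 3/4 ≤ χ r s := by simp only [hχd]; nlinarith [hr.1, hr.2, hs.1, (by nlinarith [hr.1, hr.2] : r^2 ≤ 1/4)]
    have h5 : m0^(q+1) ≤ v r s^(q+1) := by gcongr
    have h6 : (3/4:ℝ)^(2*n+2) ≤ χ r s^(2*n+2) := by gcongr
    calc b * (sinh r ^ d * P r s^p) = sinh r ^ d * (q/c0 * (m0^(q+1) * (P r s^p * (3/4)^(2*n+2)))) := by simp only [b]; ring
      _ ≤ _ := by have := h.pos r hr.1 s hsI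
                  gcongr)
  rw [intervalIntegral.integral_const_mul] at m2
  have m3 : b * (∫ r in (0:ℝ)..(1/2), sinh r ^ d * P r s^p) ≤ C*W*3 := by
    have : C*W*(s - -3) ≤ C*W*3 := by gcongr; linarith [hs.2]
    linarith
  have m4 : (∫ r in (0:ℝ)..(1/2), sinh r ^ d * P r s^p) ≤ C*W*3/b := by rw [le_div_iff₀ hb]; linarith
  simp only [hPd] at m4
  linarith
end

section
variable {d : ℕ} {q c0 : ℝ} {v : ℝ → ℝ → ℝ} {r s : ℝ}

lemma w_int (hr : 0 < r) (h1 : r ≤ 1) : (∫ x in (0:ℝ)..r, sinh x ^ d) ≤ sinh r ^ d * r := by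
  have := intervalIntegral.integral_mono_on (μ := volume) hr.le ((by fun_prop : Continuous fun x => sinh x ^ d).intervalIntegrable 0 r)
    (intervalIntegrable_const (c := sinh r ^ d)) (fun x hx => pow_le_pow_left₀ (sinh_nn hx.1) (Real.sinh_le_sinh.2 hx.2) d)
  rw [intervalIntegral.integral_const] at this
  simpa [mul_comm] using this

lemma near_n {m0 M0 K : ℝ} (hd : 1 ≤ d) (hq : 1 < q) (hsub : ((d:ℝ) - 1) * q < d + 3) (hc0 : 0 < c0) (hm : 0 < m0) (hM : m0 ≤ M0) (hK : 0 ≤ K) :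
    ∃ C > 0, ∃ μ > (0:ℝ), ∀ v, Sol d q c0 IV v → (∀ r ∈ Icc (0:ℝ) 2, ∀ s ∈ Icc (-3:ℝ) 0, m0 ≤ v r s ∧ v r s ≤ M0) → (∀ r, 0 ≤ r → ∀ s ∈ IV, LQ v r s ≤ K) →
      ∀ s ∈ Icc (-2:ℝ) 0, ∀ r ∈ Ioc (0:ℝ) (1/2), Dr v r s ≤ C ∧ r * (-Dr v r s) ≤ C * r ^ μ := by
  have hq1 : 0 < q-1 := by linarith
  have hd1 : (1:ℝ) ≤ d := by exact_mod_cast hd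
  obtain ⟨p, hp1, hp2⟩ : ∃ p, max 1 (((d:ℝ)+1)/2) < p ∧ p < (q+1)/(q-1) := exists_between (by
    rw [max_lt_iff, lt_div_iff₀ hq1, lt_div_iff₀ hq1]; constructor <;> nlinarith)
  rw [max_lt_iff] at hp1
  have hp0 : 0 < p := by linarith
  rw [lt_div_iff₀ hq1] at hp2
  obtain ⟨C, hC, hCI⟩ := near_int (d := d) (K := K) hd hq hc0 hm hM hK hp1.1 hp2
  have hM0 : 0 < M0 := by linarith
  set A := q/c0*M0^q
  have hA : 0 < A := by positivity
  refine ⟨A*(K+1) + A*(C + cosh 1^d), by positivity, 2-(d+1)/p, ?_, fun v h hv hQ s hs r hr => ?_⟩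
  · have : (d+1)/p < 2 := by rw [div_lt_iff₀ hp0]; linarith
    linarith
  have hs3 : s ∈ Icc (-3:ℝ) 0 := ⟨by linarith [hs.1], hs.2⟩
  have hsI : s ∈ IV := ⟨by linarith [hs.1], by linarith [hs.2]⟩
  obtain ⟨hr0, hr2⟩ := hr
  have hw := pow_pos (sinh_pos' hr0) d
  have sQ := h.smQ hIV
  have sw : Sm IV (fun r _ => sinh r ^ d) := sm_of (f := fun r => sinh r ^ d) (by fun_prop)
  have sg := (Sm.const (I := IV) (q/c0)).mul (h.smu.mul sQ)
  have fl := h.sm.flux (d := d) (b := r) hIV hd sg (fun x hx s hs => (h.LQv hc0 hx hs).symm) hr0.le hsI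
  have ii := fun {F} (hF : Sm IV F) => hF.ii (a := 0) (b := r) le_rfl hr0.le hsI
  have hbd : ∀ x ∈ Icc 0 r, 0 < v x s ^ q ∧ v x s ^ q ≤ M0^q := fun x hx => by
    have := hv x ⟨hx.1, by linarith [hx.2]⟩ s hs3
    exact ⟨rpow_pos_of_pos (by linarith) _, rpow_le_rpow (by linarith) this.2 (by linarith)⟩
  have hqc : 0 < q/c0 := by positivity
  have hW := w_int (d := d) hr0 (by linarith)
  constructor
  · have m := intervalIntegral.integral_mono_on (μ := volume) hr0.le (ii (sw.mul sg)) ((ii sw).const_mul (A*K)) (fun x hx => by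
      have h1 := hbd x hx
      have h2 := hQ x hx.1 s hsI
      have h3 : 0 ≤ sinh x ^ d := pow_nonneg (sinh_nn hx.1) _
      calc sinh x ^ d * (q/c0 * (v x s^q * LQ v x s)) ≤ sinh x ^ d * (q/c0 * (v x s^q * K)) := by gcongr; exact h1.1.le
        _ ≤ sinh x ^ d * (q/c0 * (M0^q * K)) := by gcongr ?_ * (?_ * (?_ * ?_)); exact h1.2
        _ = _ := by ring)
    rw [fl, intervalIntegral.integral_const_mul] at m
    have h1 : A*K*(∫ x in (0:ℝ)..r, sinh x ^ d) ≤ A*K*(sinh r^d*1) := by gcongr; nlinarith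
    have h2 : Dr v r s ≤ A*K := le_of_mul_le_mul_left (by linarith) hw
    have : 0 ≤ A*(C+cosh 1^d) := by positivity
    linarith
  · set l := r^(-(((d:ℝ)+1)/p))
    have hl : 0 < l := by positivity
    have sP : Sm IV (fun r s => K+1-LQ v r s) := (Sm.const _).sub sQ
    have hP1 : ∀ r, 0 ≤ r → ∀ s ∈ IV, 1 ≤ K+1-LQ v r s := fun r hr s hs => by have := hQ r hr s hs; linarith
    have hP : ∀ r, 0 ≤ r → ∀ s ∈ IV, 0 < K+1-LQ v r s := fun r hr s hs => by linarith [hP1 r hr s hs]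
    have sPp := sw.mul (sP.rpow hP p)
    have m := intervalIntegral.integral_mono_on (μ := volume) (f := fun x => -(sinh x ^ d * (q/c0 * (v x s^q * LQ v x s)))) hr0.le (ii (sw.mul sg)).neg (((ii sPp).const_mul (A*l^(1-p))).add ((ii sw).const_mul (A*l))) (fun x hx => by
      have h1 := hbd x hx
      have h2 := hP1 x hx.1 s hsI
      have h3 : 0 ≤ sinh x ^ d := pow_nonneg (sinh_nn hx.1) _
      set P := K+1-LQ v x s
      have h4 : -LQ v x s ≤ P := by simp only [P]; linarith
      have h5 : P ≤ l^(1-p)*P^p + l := by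
        rcases le_total P l with h | h
        · have : 0 ≤ l^(1-p)*P^p := by positivity
          linarith
        · have e : P^(1-p)*P^p = P := by rw [← rpow_add (by linarith)]; simp
          have := rpow_le_rpow_of_nonpos hl h (by linarith : 1-p ≤ 0)
          have h6 : P^(1-p)*P^p ≤ l^(1-p)*P^p := by gcongr
          linarith
      calc -(sinh x ^ d * (q/c0 * (v x s^q * LQ v x s))) = sinh x ^ d * (q/c0 * (v x s^q * (-LQ v x s))) := by ring
        _ ≤ sinh x ^ d * (q/c0 * (v x s^q * P)) := by gcongr; exact h1.1.le
        _ ≤ sinh x ^ d * (q/c0 * (M0^q * P)) := by gcongr ?_ * (?_ * (?_ * ?_)); exact h1.2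
        _ ≤ sinh x ^ d * (q/c0 * (M0^q * (l^(1-p)*P^p + l))) := by gcongr
        _ = _ := by simp only [A]; ring)
    rw [intervalIntegral.integral_neg, fl, intervalIntegral.integral_add ((ii sPp).const_mul _) ((ii sw).const_mul _), intervalIntegral.integral_const_mul,
      intervalIntegral.integral_const_mul] at m
    have m1 : (∫ x in (0:ℝ)..r, sinh x ^ d * (K+1-LQ v x s)^p) ≤ C := by
      refine le_trans ?_ (hCI v h hv hQ s hs)
      refine intervalIntegral.integral_mono_interval le_rfl hr0.le hr2
        ((ae_restrict_iff' measurableSet_Ioc).2 (Eventually.of_forall fun x hx => ?_)) (sPp.ii le_rfl (by norm_num) hsI)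
      have := hP x hx.1.le s hsI
      have := sinh_nn hx.1.le
      simp only [Pi.zero_apply]
      positivity
    have hcr : sinh r ^ d ≤ cosh 1 ^ d * r^d := by
      rw [← mul_pow]; exact pow_le_pow_left₀ (sinh_nn hr0.le) (sinh_le_lin hr0.le (by linarith)) d
    have m2 : sinh r^d * (-Dr v r s) ≤ A*l^(1-p)*C + A*l*(cosh 1 ^ d * r^d * r) := by
      have h1 : A*l*(∫ x in (0:ℝ)..r, sinh x ^ d) ≤ A*l*(cosh 1 ^ d * r^d * r) := by
        gcongr; exact hW.trans (by gcongr)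
      have h2 : A*l^(1-p)*(∫ x in (0:ℝ)..r, sinh x ^ d * (K+1-LQ v x s)^p) ≤ A*l^(1-p)*C := by gcongr
      linarith
    have e1 : l^(1-p) = l * r^d * r := by
      simp only [l]
      rw [← rpow_mul hr0.le, ← rpow_natCast, ← rpow_add hr0, ← rpow_add_one hr0.ne']
      congr 1; field_simp; ring
    have e2 : r * (l * r) = r^(2-((d:ℝ)+1)/p) := by
      rw [show (2-((d:ℝ)+1)/p) = -(((d:ℝ)+1)/p) + 1 + 1 by ring, rpow_add_one hr0.ne', rpow_add_one hr0.ne']; ring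
    rw [e1] at m2
    rw [← e2]
    by_cases hn : 0 ≤ -Dr v r s
    · have hsr : r^d ≤ sinh r^d := pow_le_pow_left₀ hr0.le (Real.self_le_sinh_iff.2 hr0.le) d
      have h3 : r^d * (-Dr v r s) ≤ r^d * (A*(C+cosh 1^d)*(l*r)) := by
        calc _ ≤ sinh r^d * (-Dr v r s) := by gcongr
          _ ≤ _ := by linarith
      have h4 := le_of_mul_le_mul_left h3 (by positivity)
      have h5 : 0 ≤ A*(K+1)*(r*(l*r)) := by positivity
      have := mul_le_mul_of_nonneg_left h4 hr0.le
      linarith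
    · have : r * (-Dr v r s) ≤ 0 := mul_nonpos_of_nonneg_of_nonpos hr0.le (by linarith)
      have h5 : 0 ≤ (A*(K+1) + A*(C + cosh 1^d))*(r*(l*r)) := by positivity
      linarith
end

set_option maxHeartbeats 1000000 in
lemma near_grad {d : ℕ} {q c0 m0 M0 K G0 : ℝ} (hd : 1 ≤ d) (hq : 1 < q) (hsub : ((d:ℝ) - 1) * q < d + 3) (hc0 : 0 < c0) (hm : 0 < m0) (hM : m0 ≤ M0) (hK : 0 ≤ K) :
    ∃ G, ∀ v, Sol d q c0 IV v → (∀ r ∈ Icc (0:ℝ) 2, ∀ s ∈ Icc (-3:ℝ) 0, m0 ≤ v r s ∧ v r s ≤ M0) → (∀ r, 0 ≤ r → ∀ s ∈ IV, LQ v r s ≤ K) →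
      (∀ r ∈ Icc (1/2:ℝ) 2, ∀ s ∈ Icc (-1:ℝ) 0, |Dr v r s| ≤ G0) → ∀ r ∈ Icc (0:ℝ) 2, ∀ s ∈ Icc (-1:ℝ) 0, |Dr v r s| ≤ G := by
  obtain ⟨C, hC, μ, hμ, hn⟩ := near_n hd hq hsub hc0 hm hM hK
  have hd1 : (1:ℝ) ≤ d := by exact_mod_cast hd
  have hq1 : 0 < q-1 := by linarith
  have hM0 : 0 < M0 := by linarith
  set ch := cosh 1
  have hch : 1 ≤ ch := Real.one_le_cosh 1
  set τ := m0/(2*(q-1)*ch^2)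
  have hτ : 0 < τ := by positivity
  set a0 := c0/q*M0^(1-q)
  have ha0 : 0 < a0 := by positivity
  obtain ⟨r1, hr1, hr2, hrτ⟩ : ∃ r1 > (0:ℝ), r1 ≤ 1/2 ∧ C * r1^μ ≤ τ := by
    refine ⟨min (1/2) ((τ/C)^(1/μ)), by positivity, min_le_left _ _, ?_⟩
    have : (min (1/2) ((τ/C)^(1/μ)))^μ ≤ ((τ/C)^(1/μ))^μ := by gcongr; exact min_le_right _ _
    rw [← rpow_mul (by positivity), one_div_mul_cancel hμ.ne', rpow_one, le_div_iff₀ hC] at this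
    linarith
  set M := 2*τ/r1 + 4*τ*ch^2/a0
  have hMp : 0 < M := by positivity
  have hpw : ∀ r : ℝ, 0 ≤ r → r ≤ 1/2 → r^μ ≤ 1 := fun r h1 h2 => Real.rpow_le_one h1 (by linarith) hμ.le
  refine ⟨G0 + C + C/r1 + M, fun v h hv hQ hG r hr s hs => ?_⟩
  have hG0 : 0 ≤ G0 := (abs_nonneg _).trans (hG 1 ⟨by norm_num, by norm_num⟩ 0 ⟨by norm_num, by norm_num⟩)
  have hCr : 0 ≤ C/r1 := by positivity
  have hs2 : s ∈ Icc (-2:ℝ) 0 := ⟨by linarith [hs.1], hs.2⟩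
  have hsI : Icc (-2:ℝ) 0 ⊆ IV := fun x hx => ⟨by linarith [hx.1], by linarith [hx.2]⟩
  by_cases hh : 1/2 ≤ r
  · have := hG r ⟨hh, hr.2⟩ s hs; linarith
  push Not at hh
  rcases hr.1.eq_or_lt with h0 | h0
  · rw [← h0, h.dr0 hd hc0 (hsI hs2), abs_zero]; positivity
  obtain ⟨u1, u2⟩ := hn v h hv hQ s hs2 r ⟨h0, hh.le⟩
  rw [abs_le]
  refine ⟨?_, by linarith⟩
  by_cases hh1 : r1 ≤ r
  · have h1 : C * r^μ ≤ C*1 := by gcongr; exact hpw r h0.le hh.le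
    by_cases hneg : 0 ≤ -Dr v r s
    · have : r1 * (-Dr v r s) ≤ r * (-Dr v r s) := by gcongr
      have : -Dr v r s ≤ C/r1 := by rw [le_div_iff₀ hr1]; linarith
      linarith
    · linarith
  push Not at hh1
  have sD := h.sm.dr hIV
  have sσ : Sm IV (fun _ s => s+2) := Sm.of (by fun_prop)
  have sZ := sσ.mul sD.neg
  set a := fun r s => c0/q * v r s ^ (1-q)
  have sa : Sm IV a := (Sm.const _).mul (h.sm.rpow h.pos _)
  have ea : ∀ r s, 0 ≤ r → s ∈ IV → Dr a r s = -(q-1) * (a r s / v r s) * Dr v r s := fun r s hr hs => by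
    have := (h.pos r hr s hs)
    rw [Dr_mul (Sm.const _) (h.sm.rpow h.pos _) hr hs, Dr_const _ hr, Dr_rpow h.sm h.pos _ hr hs, Real.rpow_sub_one this.ne']; simp only [a]; ring
  have hrt : ∀ r ∈ Ioc 0 r1, ∀ s ∈ Icc (-2:ℝ) 0, r * (-Dr v r s) ≤ τ := fun r hr s hs => by
    have h1 := (hn v h hv hQ s hs r ⟨hr.1, hr.2.trans hr2⟩).2
    have h2 : C * r^μ ≤ C * r1^μ := by
      have := hr.1.le
      have := hr.2
      gcongr
    linarith
  have key := MP (d := d) (α := 0) (β := r1) (s0 := -2) (s1 := 0) (M := M) hIV sZ le_rfl hsI hd a (Dr a) (δ := M/2) (by positivity) (fun r _ => by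
    simp only [neg_add_cancel, zero_mul]; exact hMp.le) (fun s hs => ?_) (fun h => absurd h (lt_irrefl _)) (fun r hr s hs => ?_) (fun _ s hs => ?_) ?_
      r ⟨h0.le, hh1.le⟩ s hs2
  · by_cases hneg : 0 ≤ -Dr v r s
    · have : 1 * (-Dr v r s) ≤ (s+2) * (-Dr v r s) := by gcongr; linarith [hs.1]
      linarith
    · linarith
  · have h1 := hrt r1 ⟨hr1, le_rfl⟩ s hs
    have h2 : -Dr v r1 s ≤ τ/r1 := by rw [le_div_iff₀ hr1]; linarith
    have h3 : (s+2) * (-Dr v r1 s) ≤ (s+2) * (τ/r1) := mul_le_mul_of_nonneg_left h2 (by linarith [hs.1])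
    have h4 : (s+2) * (τ/r1) ≤ 2 * (τ/r1) := by gcongr; linarith [hs.2]
    have h5 : 0 < 4*τ*ch^2/a0 := by positivity
    have h6 : M = 2 * (τ/r1) + 4*τ*ch^2/a0 := by simp only [M]; ring
    linarith
  · have := h.pos r hr.1.le s (hsI ⟨hs.1.le, hs.2⟩)
    simp only [a]; positivity
  · have hsi := hsI ⟨hs.1.le, hs.2⟩
    have h1 : Tendsto (fun x => Dr a x s) (𝓝[>] 0) (𝓝 (Dr a 0 s)) := (((sa.dr hIV).contr hsi) 0 self_mem_Ici).mono Ioi_subset_Ici_self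
    rwa [ea 0 s le_rfl hsi, h.dr0 hd hc0 hsi, mul_zero] at h1
  · intro r hr s hs hZ
    have hs2 : s ∈ Icc (-2:ℝ) 0 := ⟨hs.1.le, hs.2⟩
    have hsi := hsI hs2
    have hr0 := hr.1
    have hS := sinh_pos' hr0
    have ee : ∀ r > 0, Ds v r s = a r s * LL d v r s + 0 := fun r hr => by
      have hp := h.pos r hr.le s hsi
      have := h.eq r hr s hsi
      simp only [a]
      rw [add_zero, div_mul_eq_mul_div, div_mul_eq_mul_div, eq_div_iff (by positivity), show c0 * v r s^(1-q) * LL d v r s = v r s^(1-q) * (c0 * LL d v r s) by ring,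
        ← this, show v r s^(1-q) * (q * v r s^(q-1) * Ds v r s) = (v r s^(1-q) * v r s^(q-1)) * (Ds v r s * q) by ring, ← rpow_add hp]
      simp
    have eg := grad_eq (d := d) hIV h.sm sa (Sm.const 0) hr0 hsi ee
    rw [Dr_const _ hr0.le, ea r s hr0.le hsi] at eg
    have eσ : Ds (fun _ s => s+2) r s = 1 := Ds_eq ((hasDerivAt_id s).add_const 2)
    have eZ1 : Ds (fun r s => (s+2) * -Dr v r s) r s = -Dr v r s - (s+2) * Ds (Dr v) r s := by
      rw [Ds_mul hIV sσ sD.neg hr0.le hsi, eσ, Ds_eq (sD.hasDs hIV hr0.le hsi).neg]; ring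
    have eZ2 : ∀ x, 0 ≤ x → Dr (fun r s => (s+2) * -Dr v r s) x s = (s+2) * -Dr (Dr v) x s := fun x hx =>
      Dr_eq hx ((sD.hasDr hx hsi).neg.const_mul (s+2))
    have eZ3 : LL d (fun r s => (s+2) * -Dr v r s) r s = -(s+2) * LL d (Dr v) r s := by
      unfold LL
      rw [Dr_congr (F := fun r s => (s+2) * -Dr (Dr v) r s) hr0.le eZ2, eZ2 r hr0.le, Dr_eq hr0.le (((sD.dr hIV).hasDr hr0.le hsi).neg.const_mul (s+2))]; ring
    rw [eZ1, eZ3, eZ2 r hr0.le, eg, ea r s hr0.le hsi]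
    obtain ⟨v1, v2⟩ := hv r ⟨hr0.le, by linarith [hr.2]⟩ s ⟨by linarith [hs.1], hs.2⟩
    have hvp : 0 < v r s := by linarith
    have hrn := hrt r ⟨hr0, hr.2.le⟩ s hs2
    have haL : a0 ≤ a r s := by
      simp only [a0, a]; gcongr c0/q * ?_
      exact rpow_le_rpow_of_nonpos hvp v2 (by linarith)
    rw [show LL d v r s = Dr (Dr v) r s + HH d r * Dr v r s from rfl]
    set A := a r s
    set n := -Dr v r s with hnd
    have hD : Dr v r s = -n := by rw [hnd]; ring
    rw [hD]
    set σ := s+2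
    have hσ0 : 0 < σ := by simp only [σ]; linarith [hs.1]
    have hσ2 : σ ≤ 2 := by simp only [σ]; linarith [hs.2]
    have hn0 : 0 < n := by
      by_contra hc
      have : σ * n ≤ 0 := mul_nonpos_of_nonneg_of_nonpos hσ0.le (by linarith)
      linarith
    have hA : 0 < A := by linarith
    set J := (d:ℝ)/sinh r^2 with hJ
    have hsl : sinh r ≤ ch*r := sinh_le_lin hr0.le (by linarith [hr.2])
    have hcl : cosh r ≤ ch := Real.cosh_le_cosh.2 (by rw [abs_of_pos hr0, abs_one]; linarith [hr.2])
    have k1 : (q-1)/v r s * (HH d r * n) ≤ J/2 := by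
      have h1 : (q-1)/v r s * (cosh r * sinh r * n) ≤ 1/2 := by
        calc _ ≤ (q-1)/m0 * (ch * (ch*r) * n) := by have := cosh_pos r; gcongr
          _ = (q-1)/m0*ch^2*(r*n) := by ring
          _ ≤ (q-1)/m0*ch^2*τ := by gcongr
          _ = _ := by simp only [τ]; field_simp
      have h2 : (q-1)/v r s * (HH d r * n) = (q-1)/v r s * (cosh r * sinh r * n) * J := by
        simp only [hJ, HH]; field_simp
      rw [h2]
      have : 0 ≤ J := by positivity
      linarith [mul_le_mul_of_nonneg_right h1 this]
    have k2 : 2 ≤ A*J*σ/2 := by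
      have h1 : M*r ≤ σ*τ := by
        calc M*r ≤ σ*n*r := by gcongr
          _ = σ*(r*n) := by ring
          _ ≤ _ := by gcongr
      have h2 : 1/(ch*r)^2 ≤ J := by
        rw [hJ]; gcongr
      have h3 : 4*τ*ch^2 ≤ M*a0 := by
        have : M*a0 = 2*τ/r1*a0 + 4*τ*ch^2 := by simp only [M]; field_simp
        have h4 : 0 < 2*τ/r1*a0 := by positivity
        linarith
      have h4 : 4 ≤ a0*(1/(ch*r)^2)*(M*r/τ) := by
        have : a0*(1/(ch*r)^2)*(M*r/τ) = M*a0/(τ*ch^2*r) := by field_simp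
        rw [this, le_div_iff₀ (by positivity)]
        have : 4*(τ*ch^2*r) ≤ 4*(τ*ch^2*1) := by gcongr; linarith [hr.2]
        linarith
      have h5 : a0*(1/(ch*r)^2)*(M*r/τ) ≤ A*J*σ := by
        gcongr
        rw [div_le_iff₀ hτ]; exact h1
      linarith
    have k3 : M/2 ≤ n := by
      have : σ*n ≤ 2*n := by gcongr
      linarith
    have k4 := mul_le_mul_of_nonneg_left k1 (by positivity : 0 ≤ A*σ*n)
    have k5 := mul_le_mul_of_nonneg_left k2 hn0.le
    have e1 : A/v r s = A*(1/v r s) := by ring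
    have e2 : (q-1)/v r s = (q-1)*(1/v r s) := by ring
    rw [e2] at k4
    rw [e1]
    linarith

/-- scaling parameters -/
noncomputable def kap (d : ℕ) (q T r0 t0 : ℝ) : ℝ := GS.La q T t0 * exp (-d*r0)
noncomputable def tht (d : ℕ) (q T δ r0 t0 : ℝ) : ℝ := δ * ((T - t0) * exp (-((q-1)*d*r0)))
noncomputable def vh (d : ℕ) (q T δ : ℝ) (v : ℝ → ℝ → ℝ) (r0 t0 r s : ℝ) : ℝ := (kap d q T r0 t0)⁻¹ * v r (t0 + tht d q T δ r0 t0 * s)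

section
variable {d : ℕ} {q T δ r0 t0 ε : ℝ} {v : ℝ → ℝ → ℝ}

lemma GS.resc (h : GS d q T v) (hε : ε ∈ Ioo 0 T) (hδ : δ = ε/(16*T)) : ∃ m0 > 0, ∃ M0, m0 ≤ M0 ∧ ∃ K, 0 ≤ K ∧ ∃ G, ∀ r0, 0 ≤ r0 → ∀ t0 ∈ Ico ε T,
    Sol d q δ IV (vh d q T δ v r0 t0) ∧ (∀ r, 0 ≤ r → |r-r0| ≤ 2 → ∀ s ∈ IV, m0 ≤ vh d q T δ v r0 t0 r s ∧ vh d q T δ v r0 t0 r s ≤ M0) ∧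
    (∀ r, 0 ≤ r → ∀ s ∈ IV, LQ (vh d q T δ v r0 t0) r s ≤ K) ∧ (∀ r, 1/2 ≤ r → |r-r0| ≤ 2 → ∀ s ∈ IV, |Dr (vh d q T δ v r0 t0) r s| ≤ G) := by
  have hT := h.hT
  have hq1 : 0 < q-1 := by linarith [h.hq]
  have hε0 := hε.1
  have hε' : ε/2 ∈ Ioo 0 T := ⟨by linarith, by linarith [hε.2]⟩
  have hδ0 : 0 < δ := by rw [hδ]; positivity
  have hδ1 : δ ≤ 1/16 := by rw [hδ, div_le_div_iff₀ (by positivity) (by norm_num)]; linarith [hε.2]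
  have hδT : δ*T = ε/16 := by rw [hδ]; field_simp
  obtain ⟨C, hC, bC⟩ := h.decR (ε/2) hε'
  obtain ⟨c, hc, bc⟩ := h.low (ε/2) hε'
  obtain ⟨B, hB, bB⟩ := h.fluxR (ε/2) hε'
  set γ := 1/(q-1)
  have hγ : 0 < γ := by positivity
  set E := exp (2*d)
  set m0 := c*(1/2)^γ*exp (-(2*d))
  set M0 := C*2^γ*E
  refine ⟨min m0 M0, by positivity, M0, min_le_right _ _, 4*T/((q-1)*ε), by positivity, B*2^γ*4^d*E, fun r0 hr0 t0 ht0 => ?_⟩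
  set κ := kap d q T r0 t0
  set θ := tht d q T δ r0 t0 with hθd
  have hl : 0 < T - t0 := by linarith [ht0.2]
  have hLa := GS.La_pos (q := q) ht0.2
  have hκ : 0 < κ := mul_pos hLa (exp_pos _)
  have hθ : 0 < θ := mul_pos hδ0 (mul_pos hl (exp_pos _))
  have hθ1 : θ ≤ δ*(T-t0) := by
    have : exp (-((q-1)*d*r0)) ≤ 1 := exp_le_one_iff.2 (neg_nonpos.2 (by positivity))
    have h2 : (T-t0)*exp (-((q-1)*d*r0)) ≤ (T-t0)*1 := by gcongr
    simp only [hθd, tht]; nlinarith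
  have hθ2 : θ ≤ (T-t0)/16 := by nlinarith
  have hθ3 : θ ≤ ε/16 := by nlinarith [ht0.1]
  have ht : ∀ s ∈ IV, t0 + θ*s ∈ Ico (ε/2) T ∧ (T-t0)/2 ≤ T-(t0+θ*s) ∧ T-(t0+θ*s) ≤ 2*(T-t0) := fun s hs => by
    have h1 : θ*s ≤ θ*1 := by gcongr; exact hs.2.le
    have h2 : θ*(-4) ≤ θ*s := by gcongr; exact hs.1.le
    exact ⟨⟨by linarith [ht0.1], by linarith⟩, by linarith, by linarith⟩
  have hLs : ∀ s ∈ IV, (1/2)^γ * GS.La q T t0 ≤ GS.La q T (t0+θ*s) ∧ GS.La q T (t0+θ*s) ≤ 2^γ * GS.La q T t0 := fun s hs => by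
    obtain ⟨_, h2, h3⟩ := ht s hs
    unfold GS.La
    rw [← mul_rpow (by norm_num) hl.le, ← mul_rpow (by norm_num) hl.le]
    exact ⟨rpow_le_rpow (by linarith) (by linarith) hγ.le, rpow_le_rpow (by linarith) (by linarith) hγ.le⟩
  have sol : Sol d q δ IV (vh d q T δ v r0 t0) := by
    have h1 := (h.sol.scale (t0 := t0) (θ := θ) isOpen_Ioo hκ).mono (J := IV) (fun s hs => ⟨by linarith [(ht s hs).1.1], (ht s hs).1.2⟩)
    have e : κ^(1-q)*θ*1 = δ := by
      have h2 : κ^(q-1) = (T-t0)*exp (-((q-1)*d*r0)) := by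
        simp only [κ, kap]
        rw [mul_rpow hLa.le (exp_pos _).le, h.La_q ht0.2, ← exp_mul]; ring_nf
      rw [show 1-q = -(q-1) by ring, Real.rpow_neg hκ.le, mul_one, h2, hθd, tht]
      have := exp_pos (-((q-1)*d*r0))
      field_simp
    rw [e] at h1
    exact h1
  have eκ : ∀ r, κ⁻¹ * (GS.La q T t0 * exp (-d*r)) = exp (-d*(r-r0)) := fun r => by
    rw [show -(d:ℝ)*(r-r0) = -(d:ℝ)*r - (-(d:ℝ)*r0) by ring, Real.exp_sub]; simp only [κ, kap]
    have := exp_pos (-(d:ℝ)*r0)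
    field_simp
  have hex : ∀ r, |r-r0| ≤ 2 → exp (-(2*d)) ≤ exp (-d*(r-r0)) ∧ exp (-d*(r-r0)) ≤ E := fun r hr => by
    obtain ⟨h1, h2⟩ := abs_le.1 hr
    have hd0 : (0:ℝ) ≤ d := by positivity
    exact ⟨exp_le_exp.2 (by nlinarith), exp_le_exp.2 (by nlinarith)⟩
  refine ⟨sol, fun r hr hrr s hs => ?_, fun r hr s hs => ?_, fun r hr hrr s hs => ?_⟩
  · obtain ⟨h1, h2⟩ := hex r hrr
    obtain ⟨l1, l2⟩ := hLs s hs
    have b1 := bc _ (ht s hs).1 r hr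
    have b2 := bC _ (ht s hs).1 r hr
    constructor
    · refine (min_le_left _ _).trans ?_
      calc m0 ≤ c*(1/2)^γ*exp (-d*(r-r0)) := by simp only [m0]; gcongr
        _ = κ⁻¹ * (c*((1/2)^γ*GS.La q T t0)*exp (-d*r)) := by rw [← eκ r]; ring
        _ ≤ κ⁻¹ * (c*GS.La q T (t0+θ*s)*exp (-d*r)) := by gcongr
        _ ≤ _ := mul_le_mul_of_nonneg_left b1 (by positivity)
    · calc _ ≤ κ⁻¹ * (C*GS.La q T (t0+θ*s)*exp (-d*r)) := mul_le_mul_of_nonneg_left b2 (by positivity)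
        _ ≤ κ⁻¹ * (C*(2^γ*GS.La q T t0)*exp (-d*r)) := by gcongr
        _ = C*2^γ*exp (-d*(r-r0)) := by rw [← eκ r]; ring
        _ ≤ M0 := by simp only [M0]; gcongr
  · have e1 : Ds (vh d q T δ v r0 t0) r s = κ⁻¹ * (Ds v r (t0+θ*s) * θ) := by
      refine Ds_eq ?_
      have h2 : HasDerivAt (fun τ => t0 + θ * τ) θ s := by simpa using ((hasDerivAt_id s).const_mul θ).const_add t0
      exact ((h.sol.sm.hasDs isOpen_Ioo hr ⟨by linarith [(ht s hs).1.1], (ht s hs).1.2⟩).comp s h2).const_mul κ⁻¹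
    have hp := sol.pos r hr s hs
    unfold LQ
    rw [Real.rpow_neg_one, ← div_eq_mul_inv, div_le_iff₀ hp, e1]
    have h1 := h.dsle hε'.1 (ht s hs).1.1 (ht s hs).1.2 hr
    have hv := h.sol.pos r hr _ ⟨by linarith [(ht s hs).1.1], (ht s hs).1.2⟩
    have h2 : θ ≤ T := by linarith [ht0.1, hε.1]
    calc κ⁻¹ * (Ds v r (t0+θ*s) * θ) ≤ κ⁻¹ * (2/((q-1)*(ε/2))*v r (t0+θ*s) * θ) := by gcongr
      _ ≤ κ⁻¹ * (2/((q-1)*(ε/2))*v r (t0+θ*s) * T) := by gcongr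
      _ = 4*T/((q-1)*ε) * (κ⁻¹ * v r (t0+θ*s)) := by field_simp; ring
  · have hr0' : 0 < r := by linarith
    have e1 : Dr (vh d q T δ v r0 t0) r s = κ⁻¹ * Dr v r (t0+θ*s) :=
      Dr_eq hr0'.le ((h.sol.sm.hasDr hr0'.le ⟨by linarith [(ht s hs).1.1], (ht s hs).1.2⟩).const_mul κ⁻¹)
    obtain ⟨h1, h2⟩ := hex r hrr
    obtain ⟨l1, l2⟩ := hLs s hs
    have b1 := bB _ (ht s hs).1 r hr0'.le
    have hw := w_lower d hr0'
    have h4 : (1/4:ℝ)^d ≤ (r/(1+2*r))^d := by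
      refine pow_le_pow_left₀ (by norm_num) ?_ d
      rw [div_le_div_iff₀ (by norm_num) (by linarith)]; linarith
    rw [abs_mul, abs_of_nonneg (pow_nonneg (sinh_nn hr0'.le) d)] at b1
    have h5 : (1/4:ℝ)^d*exp (d*r)*|Dr v r (t0+θ*s)| ≤ B*GS.La q T (t0+θ*s) := by
      refine le_trans ?_ b1
      gcongr
      refine le_trans ?_ hw
      gcongr
    have h6 : |Dr v r (t0+θ*s)| ≤ B*(2^γ*GS.La q T t0)*4^d*exp (-d*r) := by
      have e2 : |Dr v r (t0+θ*s)| = ((1/4:ℝ)^d*exp (d*r)*|Dr v r (t0+θ*s)|)*(4^d*exp (-d*r)) := by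
        rw [neg_mul, Real.exp_neg, one_div, inv_pow]
        have := exp_pos (d*r)
        field_simp
      rw [e2]
      calc _ ≤ B*GS.La q T (t0+θ*s)*(4^d*exp (-d*r)) := by gcongr
        _ ≤ B*(2^γ*GS.La q T t0)*(4^d*exp (-d*r)) := by gcongr
        _ = _ := by ring
    rw [e1, abs_mul, abs_of_pos (inv_pos.2 hκ)]
    calc _ ≤ κ⁻¹ * (B*(2^γ*GS.La q T t0)*4^d*exp (-d*r)) := by gcongr
      _ = B*2^γ*4^d*exp (-d*(r-r0)) := by rw [← eκ r]; ring
      _ ≤ _ := by gcongr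

lemma GS.bd (h : GS d q T v) (hε : ε ∈ Ioo 0 T) (hδ : δ = ε/(16*T)) (k : ℕ) : ∃ C > 0, ∀ r0, 0 ≤ r0 → ∀ t0 ∈ Ico ε T,
    |Dr^[k] (fun r s => vh d q T δ v r0 t0 r s ^ q) r0 0| ≤ C ∧ |Ds^[k] (fun r s => vh d q T δ v r0 t0 r s ^ q) r0 0| ≤ C := by
  obtain ⟨m0, hm0, M0, hM0, K, hK, G, hall⟩ := h.resc hε hδ
  have hT := h.hT
  have hε0 := hε.1
  have hδ0 : 0 < δ := by rw [hδ]; positivity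
  obtain ⟨G', hG'⟩ := near_grad (G0 := G) h.hd h.hq h.hsub hδ0 hm0 hM0 hK
  let ι1 := {x : ℝ × ℝ // (0 ≤ x.1 ∧ x.1 ≤ 1) ∧ x.2 ∈ Ico ε T}
  let ι2 := {x : ℝ × ℝ // 1 ≤ x.1 ∧ x.2 ∈ Ico ε T}
  have h20 : Rc 0 = 2 := by simp [Rc]
  have hs4 : ∀ s : ℝ, -3 ≤ s → s ≤ 0 → s ∈ IV := fun s h1 h2 => ⟨by linarith, by linarith⟩
  have F1 : Fam d q δ (fun i : ι1 => vh d q T δ v i.1.1 i.1.2) (fun _ => 0) := by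
    refine ⟨h.hd, h.hq, hδ0, fun i => (hall _ i.2.1.1 _ i.2.2).1, fun i => Or.inl rfl, ⟨m0, hm0, M0, fun i r s hq => ?_⟩, UB.mk fun ρ hρ => ⟨G', fun i r s hq => ?_⟩⟩
    · obtain ⟨h1, h2, h3, h4⟩ := hq
      rw [h20, sub_zero, abs_of_nonneg h1] at h2
      exact (hall _ i.2.1.1 _ i.2.2).2.1 r h1 (abs_le.2 ⟨by linarith [i.2.1.2], by linarith [i.2.1.1]⟩) s (hs4 s (by linarith) h4)
    · obtain ⟨h1, h2, h3, h4⟩ := hq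
      rw [h20, sub_zero, abs_of_nonneg h1] at h2
      obtain ⟨a1, a2, a3, a4⟩ := hall _ i.2.1.1 _ i.2.2
      have hab : ∀ r : ℝ, 0 ≤ r → r ≤ 2 → |r - i.1.1| ≤ 2 := fun r h1 h2 => abs_le.2 ⟨by linarith [i.2.1.2], by linarith [i.2.1.1]⟩
      exact hG' _ a1 (fun r hr s hs => a2 r hr.1 (hab r hr.1 hr.2) s (hs4 s hs.1 hs.2)) a3
        (fun r hr s hs => a4 r hr.1 (hab r (by linarith [hr.1]) hr.2) s (hs4 s (by linarith [hs.1]) hs.2)) r ⟨h1, by linarith [hρ.2]⟩ s ⟨by linarith [hρ.2], h4⟩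
  have h2f : ∀ c : ℝ, 1 ≤ c → Rc c = 1/2 := fun c hc => if_neg (by linarith)
  have F2 : Fam d q δ (fun i : ι2 => vh d q T δ v i.1.1 i.1.2) (fun i => i.1.1) := by
    refine ⟨h.hd, h.hq, hδ0, fun i => (hall _ (by linarith [i.2.1]) _ i.2.2).1, fun i => Or.inr i.2.1, ⟨m0, hm0, M0, fun i r s hq => ?_⟩, UB.mk fun ρ hρ => ⟨G, fun i r s hq => ?_⟩⟩
    · obtain ⟨h1, h2, h3, h4⟩ := hq
      rw [h2f _ i.2.1] at h2
      exact (hall _ (by linarith [i.2.1]) _ i.2.2).2.1 r h1 (by linarith) s (hs4 s (by linarith) h4)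
    · obtain ⟨h1, h2, h3, h4⟩ := hq
      rw [h2f _ i.2.1] at h2
      have := (abs_le.1 h2).1
      exact (hall _ (by linarith [i.2.1]) _ i.2.2).2.2.2 r (by linarith [i.2.1, hρ.2]) (by linarith [hρ.2]) s (hs4 s (by linarith [hρ.2]) h4)
  have hhalf : (1/2:ℝ) ∈ Ioo (0:ℝ) 1 := by constructor <;> norm_num
  obtain ⟨A1, hA1, b1⟩ := (F1.final (Or.inl fun _ => rfl) k).1.get hhalf
  obtain ⟨A2, hA2, b2⟩ := (F1.final (Or.inl fun _ => rfl) k).2.get hhalf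
  obtain ⟨A3, hA3, b3⟩ := (F2.final (Or.inr fun i => i.2.1) k).1.get hhalf
  obtain ⟨A4, hA4, b4⟩ := (F2.final (Or.inr fun i => i.2.1) k).2.get hhalf
  refine ⟨A1+A2+A3+A4+1, by positivity, fun r0 hr0 t0 ht0 => ?_⟩
  rcases le_total r0 1 with hr | hr
  · have hq : InQ 0 (1/2) r0 0 := ⟨hr0, by rw [h20, sub_zero, abs_of_nonneg hr0]; linarith, by norm_num, le_rfl⟩
    have u1 := b1 ⟨(r0, t0), ⟨hr0, hr⟩, ht0⟩ r0 0 hq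
    have u2 := b2 ⟨(r0, t0), ⟨hr0, hr⟩, ht0⟩ r0 0 hq
    constructor <;> linarith
  · have hq : InQ r0 (1/2) r0 0 := ⟨hr0, by rw [h2f _ hr, sub_self, abs_zero]; norm_num, by norm_num, le_rfl⟩
    have u1 := b3 ⟨(r0, t0), hr, ht0⟩ r0 0 hq
    have u2 := b4 ⟨(r0, t0), hr, ht0⟩ r0 0 hq
    constructor <;> linarith
end

section
variable {N : ℕ} {m T : ℝ} {u : ℝ → ℝ → ℝ}

lemma deriv_Dr {F : ℝ → ℝ → ℝ} {r s : ℝ} (hr : 0 < r) : deriv (fun ρ => F ρ s) r = Dr F r s :=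
  (derivWithin_of_mem_nhds (Ici_mem_nhds hr)).symm

lemma rad_pow (hu : IsRadialEnergySolution N m T u) (hm0 : 0 < m) {r t : ℝ} (hr : 0 ≤ r) (ht : t ∈ Ioo 0 T) : (u r t ^ m) ^ (1/m) = u r t := by
  rw [← rpow_mul (hu.pos r hr t ht).le, mul_one_div_cancel hm0.ne', rpow_one]

lemma rad_sol (hN : 2 ≤ N) (hu : IsRadialEnergySolution N m T u) (hm0 : 0 < m) : Sol (N-1) (1/m) 1 (Ioo 0 T) (fun r t => u r t ^ m) := by
  have sm : Sm (Ioo 0 T) (fun r t => u r t ^ m) := Sm.rpow (F := u) hu.smooth (fun r hr s hs => hu.pos r hr s hs) m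
  have pos : ∀ r, 0 ≤ r → ∀ s ∈ Ioo 0 T, 0 < u r s ^ m := fun r hr s hs => rpow_pos_of_pos (hu.pos r hr s hs) m
  refine ⟨sm, pos, fun r hr s hs => ?_⟩
  have h1 := hu.pde r hr s hs
  have e1 : deriv (fun τ => u r τ) s = 1/m * (u r s ^ m)^(1/m-1) * Ds (fun r t => u r t ^ m) r s := by
    rw [← Ds_rpow isOpen_Ioo sm pos (1/m) hr.le hs, Ds_congr (F := u) isOpen_Ioo hs fun s hs => rad_pow hu hm0 hr.le hs]; rfl
  have e2 : deriv (deriv (fun ρ => u ρ s ^ m)) r = Dr (Dr (fun r t => u r t ^ m)) r s := by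
    rw [← deriv_Dr hr]
    refine EventuallyEq.deriv_eq ?_
    filter_upwards [Ioi_mem_nhds hr] with x hx using deriv_Dr (F := fun r t => u r t ^ m) hx
  rw [← e1, h1, e2, deriv_Dr (F := fun r t => u r t ^ m) hr]
  unfold LL HH
  rw [Nat.cast_sub (by omega)]; push_cast; ring

lemma rad_en (hu : IsRadialEnergySolution N m T u) (hm0 : 0 < m) (sm : Sm (Ioo 0 T) (fun r t => u r t ^ m)) {ε : ℝ} (hε : ε ∈ Ioo 0 T) :
    ∃ E > 0, ∀ t ∈ Ico ε T, ∀ R, 0 ≤ R → ∫ x in (0:ℝ)..R, Dr (fun r t => u r t ^ m) x t^2*sinh x^(N-1) ≤ E := by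
  obtain ⟨C, hC⟩ := hu.energy_bdd ε hε
  refine ⟨max C 1, by positivity, fun t ht R hR => le_trans ?_ ((hC t ht).trans (le_max_left _ _))⟩
  obtain ⟨_, i1, i2⟩ := hu.energy t ⟨by linarith [hε.1, ht.1], ht.2⟩
  have hn : ∀ g : ℝ → ℝ, 0 ≤ᵐ[volume.restrict (Ioi (0:ℝ))] fun s => g s ^ 2 * sinh s ^ (N-1) := fun g => by
    filter_upwards [ae_restrict_mem measurableSet_Ioi] with x hx
    exact mul_nonneg (sq_nonneg _) (pow_nonneg (sinh_nn (le_of_lt hx)) _)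
  have h1 : 0 ≤ ∫ s in Ioi (0:ℝ), (u s t ^ m)^2 * sinh s ^ (N-1) := integral_nonneg_of_ae (hn _)
  have h2 : ∫ x in (0:ℝ)..R, Dr (fun r t => u r t ^ m) x t^2*sinh x^(N-1) =
      ∫ x in Ioc (0:ℝ) R, (deriv (fun ρ => u ρ t ^ m) x)^2*sinh x^(N-1) := by
    rw [intervalIntegral.integral_of_le hR]
    exact setIntegral_congr_fun measurableSet_Ioc fun x hx => by simp only [deriv_Dr (F := fun r t => u r t ^ m) hx.1]
  have h3 : _ ≤ _ := setIntegral_mono_set (s := Ioc (0:ℝ) R) i2 (hn _) (Ioc_subset_Ioi_self.eventuallyLE)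
  unfold H1normSq
  rw [h2]; linarith

lemma rad_van (hN : 2 ≤ N) (hu : IsRadialEnergySolution N m T u) {t : ℝ} (ht : t ∈ Ioo 0 T) {ε : ℝ} (hε : 0 < ε) (R : ℝ) : ∃ x ≥ R, u x t ^ m ≤ ε := by
  by_contra! hc
  obtain ⟨_, i1, _⟩ := hu.energy t ht
  set R1 := max R 1
  have h1 : IntegrableOn (fun _ : ℝ => ε^2) (Ioi R1) := by
    refine Integrable.mono' (i1.mono_set (Ioi_subset_Ioi (le_trans zero_le_one (le_max_right R 1)))) aestronglyMeasurable_const ?_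
    filter_upwards [ae_restrict_mem measurableSet_Ioi] with x hx
    have hx1 : R ≤ x := (le_max_left R 1).trans hx.le
    have hx2 : 1 ≤ x := (le_max_right R 1).trans hx.le
    have h2 := hc x hx1
    have h3 : 1 ≤ sinh x ^ (N-1) := one_le_pow₀ (by linarith [Real.self_le_sinh_iff.2 (by linarith : 0 ≤ x)])
    rw [Real.norm_eq_abs, abs_of_pos (by positivity)]
    nlinarith [pow_le_pow_left₀ hε.le h2.le 2, sq_nonneg (u x t ^ m)]
  rw [integrableOn_const_iff] at h1
  rcases h1 with h1 | h1
  · exact absurd (enorm_eq_zero.1 h1) (pow_pos hε 2).ne'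
  · simp at h1

lemma rad_ext (hT : 0 < T) (hm0 : 0 < m) (hu : IsRadialEnergySolution N m T u) (R : ℝ) {ε : ℝ} (hε : 0 < ε) :
    ∃ t1 < T, ∀ t ∈ Ioo t1 T, 0 < t → ∀ r ∈ Icc 0 R, u r t ^ m ≤ ε := by
  have hK : IsCompact (Icc 0 R ×ˢ Icc 0 T : Set (ℝ × ℝ)) := isCompact_Icc.prod isCompact_Icc
  have hc : ContinuousOn (fun p : ℝ × ℝ => u p.1 p.2 ^ m) (Icc 0 R ×ˢ Icc 0 T) :=
    (hu.continuousOn.mono (prod_mono_left Icc_subset_Ici_self)).rpow_const fun _ _ => Or.inr hm0.le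
  obtain ⟨δ, hδ, h⟩ := Metric.uniformContinuousOn_iff.1 (hK.uniformContinuousOn_of_continuous hc) ε hε
  refine ⟨T-δ, by linarith, fun t ht h0 r hr => ?_⟩
  have h2 := h (r, t) ⟨hr, h0.le, ht.2.le⟩ (r, T) ⟨hr, hT.le, le_rfl⟩ (by
    rw [Prod.dist_eq, dist_self, Real.dist_eq, abs_of_neg (by linarith [ht.2])]
    exact max_lt hδ (by linarith [ht.1]))
  simp only [hu.extinction r hr.1, Real.zero_rpow hm0.ne', dist_zero_right] at h2
  exact (le_abs_self _).trans h2.le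

lemma rad_GS (hN : 2 ≤ N) (hm : m ∈ Ioo (((N : ℝ) - 2) / ((N : ℝ) + 2)) 1) (hT : 0 < T) (hu : IsRadialEnergySolution N m T u) :
    0 < m ∧ GS (N-1) (1/m) T (fun r t => u r t ^ m) := by
  have hN' : (2:ℝ) ≤ N := by exact_mod_cast hN
  have hm0 : 0 < m := lt_of_le_of_lt (div_nonneg (by linarith) (by linarith)) hm.1
  have s := rad_sol hN hu hm0
  refine ⟨hm0, by omega, (one_lt_div hm0).2 hm.2, ?_, hT, s, fun ε hε => rad_en hu hm0 s.sm hε, fun t ht ε hε R => rad_van hN hu ht hε R, fun R ε hε => rad_ext hT hm0 hu R hε⟩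
  have h1 := hm.1
  rw [div_lt_iff₀ (by linarith)] at h1
  rw [Nat.cast_sub (by omega), mul_one_div, div_lt_iff₀ hm0]; push_cast; linarith
end

section
variable {N : ℕ} {m T : ℝ} {u : ℝ → ℝ → ℝ}

lemma DrIt_congr {F G : ℝ → ℝ → ℝ} {s : ℝ} (h : ∀ r, 0 ≤ r → G r s = F r s) (k : ℕ) : ∀ r, 0 ≤ r → Dr^[k] G r s = Dr^[k] F r s := by
  induction k with
  | zero => exact h
  | succ k ih => intro r hr; rw [Function.iterate_succ_apply', Function.iterate_succ_apply']; exact Dr_congr hr ih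

lemma DsIt_congr {F G : ℝ → ℝ → ℝ} {I : Set ℝ} {r : ℝ} (hI : IsOpen I) (h : ∀ s ∈ I, G r s = F r s) (k : ℕ) : ∀ s ∈ I, Ds^[k] G r s = Ds^[k] F r s := by
  induction k with
  | zero => exact h
  | succ k ih => intro s hs; rw [Function.iterate_succ_apply', Function.iterate_succ_apply']; exact Ds_congr hI hs ih

lemma DrIt_scale (F : ℝ → ℝ → ℝ) (a t0 θ : ℝ) (k : ℕ) : Dr^[k] (fun r s => a * F r (t0+θ*s)) = fun r s => a * Dr^[k] F r (t0+θ*s) := by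
  induction k with
  | zero => rfl
  | succ k ih =>
    rw [Function.iterate_succ_apply', Function.iterate_succ_apply', ih]
    funext r s
    exact derivWithin_const_mul_field a

lemma DsIt_scale (F : ℝ → ℝ → ℝ) (a t0 θ : ℝ) (k : ℕ) : Ds^[k] (fun r s => a * F r (t0+θ*s)) = fun r s => a * θ^k * Ds^[k] F r (t0+θ*s) := by
  induction k with
  | zero => simp
  | succ k ih =>
    rw [Function.iterate_succ_apply', Function.iterate_succ_apply', ih]
    funext r s
    change deriv (fun s => a * θ^k * Ds^[k] F r (t0+θ*s)) s = a * θ^(k+1) * deriv (Ds^[k] F r) (t0+θ*s)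
    rw [deriv_const_mul_field, deriv_comp_mul_left (f := fun x => (Ds^[k] F r) (t0 + x)), deriv_comp_const_add, smul_eq_mul, pow_succ]
    ring

lemma DsIt_eq (F : ℝ → ℝ → ℝ) (k : ℕ) (r t : ℝ) : Ds^[k] F r t = iteratedDeriv k (fun τ => F r τ) t := by
  have : ∀ k, Ds^[k] F r = iteratedDeriv k (F r) := fun k => by
    induction k with
    | zero => simp
    | succ k ih => rw [Function.iterate_succ_apply', iteratedDeriv_succ, ← ih]; rfl
  exact congrFun (this k) t

lemma DrIt_eq (F : ℝ → ℝ → ℝ) (t : ℝ) (k : ℕ) : ∀ r > 0, iteratedDeriv k (fun ρ => F ρ t) r = Dr^[k] F r t := by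
  induction k with
  | zero => simp
  | succ k ih =>
    intro r hr
    rw [Function.iterate_succ_apply', iteratedDeriv_succ, ← deriv_Dr hr]
    refine EventuallyEq.deriv_eq ?_
    filter_upwards [Ioi_mem_nhds hr] with x hx using ih x hx

lemma DrIt_zero {F : ℝ → ℝ → ℝ} {t : ℝ} {I : Set ℝ} (hI : IsOpen I) (h : Sm I F) (ht : t ∈ I) (k : ℕ) :
    |iteratedDeriv (k+1) (fun ρ => F ρ t) 0| ≤ |Dr^[k+1] F 0 t| := by
  rw [iteratedDeriv_succ]
  set g := iteratedDeriv k (fun ρ => F ρ t) with hg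
  by_cases hd : DifferentiableAt ℝ g 0
  · have hs : ∀ k, Sm I (Dr^[k] F) := h.drj hI
    have e := DrIt_eq F t k
    have hd1 : ∀ x > 0, HasDerivAt g (Dr^[k+1] F x t) x := fun x hx => by
      rw [Function.iterate_succ_apply']
      refine ((hs k).hasDr' hx ht).congr_of_eventuallyEq ?_
      filter_upwards [Ioi_mem_nhds hx] with y hy using e y hy
    have h1 : HasDerivWithinAt g (Dr^[k+1] F 0 t) (Ici 0) 0 := by
      refine hasDerivWithinAt_Ici_of_tendsto_deriv (s := Ioi 0) (fun x hx => (hd1 x hx).differentiableAt.differentiableWithinAt) hd.continuousAt.continuousWithinAt self_mem_nhdsWithin ?_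
      have h2 : Tendsto (fun x => Dr^[k+1] F x t) (𝓝[>] 0) (𝓝 (Dr^[k+1] F 0 t)) :=
        ((hs (k+1)).contr ht 0 self_mem_Ici).mono_left (nhdsWithin_mono _ Ioi_subset_Ici_self)
      refine h2.congr' ?_
      filter_upwards [self_mem_nhdsWithin] with x hx using (hd1 x hx).deriv.symm
    rw [(uniqueDiffOn_Ici (0:ℝ) 0 self_mem_Ici).eq_deriv _ hd.hasDerivAt.hasDerivWithinAt h1]
  · rw [deriv_zero_of_not_differentiableAt hd]; simp

lemma DrIt_le {F : ℝ → ℝ → ℝ} {r t : ℝ} {I : Set ℝ} (hI : IsOpen I) (h : Sm I F) (ht : t ∈ I) (hr : 0 ≤ r) {k : ℕ} (hk : 1 ≤ k) :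
    |iteratedDeriv k (fun ρ => F ρ t) r| ≤ |Dr^[k] F r t| := by
  rcases hr.eq_or_lt with rfl | hr
  · obtain ⟨j, rfl⟩ := Nat.exists_eq_add_of_le' hk
    exact DrIt_zero hI h ht j
  · rw [DrIt_eq F t k r hr]

end

/-- Upper bounds for space and time derivatives of the solution. -/
theorem derivative_upper_bounds
    (N : ℕ) (hN : 2 ≤ N) (m T : ℝ)
    (hm : m ∈ Set.Ioo (((N : ℝ) - 2) / ((N : ℝ) + 2)) 1) (hT : 0 < T)
    (u : ℝ → ℝ → ℝ) (hu : IsRadialEnergySolution N m T u) :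
    ∀ ε ∈ Set.Ioo (0:ℝ) T, ∀ k : ℕ, 1 ≤ k → ∃ C₁ > (0:ℝ), ∃ C₂ > (0:ℝ),
      ∀ r ∈ Set.Ici (0:ℝ), ∀ t ∈ Set.Ico ε T,
        |iteratedDeriv k (fun ρ => u ρ t) r| ≤
          C₁ * (1 - t / T) ^ (1 / (1 - m)) * Real.exp (-((N : ℝ) - 1) * r / m) ∧
        |iteratedDeriv k (fun τ => u r τ) t| ≤
          C₂ * (1 - t / T) ^ (1 / (1 - m) - (k : ℝ)) *
            Real.exp ((k : ℝ) * ((N : ℝ) - 1) * (1 / m - 1) * r) *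
            Real.exp (-((N : ℝ) - 1) * r / m) := by
  intro ε hε k hk
  obtain ⟨hm0, h⟩ := rad_GS hN hm hT hu
  have hε0 := hε.1
  set δ := ε/(16*T) with hδ
  have hδ0 : 0 < δ := by positivity
  obtain ⟨C, hC, hb⟩ := h.bd hε hδ k
  have hm1 : 0 < 1 - m := by linarith [hm.2]
  refine ⟨C*T^(1/(1-m)), by positivity, C*T^(1/(1-m)-k)*(δ^k)⁻¹, by positivity, fun r hr t ht => ?_⟩
  have hr : 0 ≤ r := hr
  have htI : t ∈ Ioo 0 T := ⟨by linarith [ht.1], ht.2⟩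
  have hl : 0 < T - t := by linarith [ht.2]
  obtain ⟨b1, b2⟩ := hb r hr t ht
  set d := N - 1 with hd
  have hdc : (d:ℝ) = N - 1 := by rw [hd, Nat.cast_sub (by omega)]; simp
  set κ := kap d (1/m) T r t with hκd
  set θ := tht d (1/m) T δ r t with hθd
  have hκ : 0 < κ := mul_pos (GS.La_pos ht.2) (exp_pos _)
  have hθ : 0 < θ := mul_pos hδ0 (mul_pos hl (exp_pos _))
  have eκ : κ^(1/m) = (T-t)^(1/(1-m)) * exp (-((N : ℝ) - 1) * r / m) := by
    rw [hκd, kap, GS.La, mul_rpow (Real.rpow_nonneg hl.le _) (exp_pos _).le, ← rpow_mul hl.le, ← exp_mul, hdc]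
    congr 2
    · field_simp
    · field_simp
      try ring
  set I := {s : ℝ | t + θ*s ∈ Ioo 0 T} with hId
  have hI : IsOpen I := isOpen_Ioo.preimage (by fun_prop)
  have h0 : (0:ℝ) ∈ I := by simpa [hId] using htI
  have ev : ∀ x, 0 ≤ x → ∀ s ∈ I, vh d (1/m) T δ (fun r t => u r t ^ m) r t x s ^ (1/m) = (κ^(1/m))⁻¹ * u x (t+θ*s) := fun x hx s hs => by
    unfold vh
    rw [mul_rpow (by positivity) (Real.rpow_nonneg (hu.pos x hx _ hs).le _), rad_pow hu hm0 hx hs, Real.inv_rpow hκ.le]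
  rw [DrIt_congr (F := fun x s => (κ^(1/m))⁻¹ * u x (t+θ*s)) (fun x hx => ev x hx 0 h0) k r hr, DrIt_scale] at b1
  rw [DsIt_congr (F := fun x s => (κ^(1/m))⁻¹ * u x (t+θ*s)) hI (fun s hs => ev r hr s hs) k 0 h0, DsIt_scale] at b2
  have hκ' : 0 < κ^(1/m) := by positivity
  simp only [mul_zero, add_zero, abs_mul, DsIt_eq, abs_inv, abs_of_pos hκ', abs_of_pos (pow_pos hθ k)] at b1 b2
  have hTt : T - t = T*(1-t/T) := by field_simp
  have h1t : 0 < 1 - t/T := by rw [sub_pos, div_lt_one hT]; exact ht.2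
  constructor
  · refine (DrIt_le isOpen_Ioo hu.smooth htI hr hk).trans ?_
    rw [inv_mul_le_iff₀ hκ', eκ, hTt, mul_rpow hT.le h1t.le] at b1
    linarith
  · rw [mul_assoc, inv_mul_le_iff₀ hκ', mul_comm, ← le_div_iff₀ (by positivity)] at b2
    refine b2.trans (le_of_eq ?_)
    rw [eκ, hTt, mul_rpow hT.le h1t.le, hθd, tht, hTt, Real.rpow_sub hT, Real.rpow_sub h1t, rpow_natCast, rpow_natCast,
      mul_pow, mul_pow, mul_pow, ← Real.exp_nat_mul, hdc,
      show (k:ℝ)*(N-1)*(1/m-1)*r = -(k*(-((1/m-1)*(N-1)*r))) by ring, Real.exp_neg]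
    field_simp
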